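/- arXiv:1612.07727 — 2 statements merged into one kernel-verified Lean document; each statement's English description precedes it below -/
import Mathlib

section
/- Suppose a : ℝⁿ × [0,∞) → ℝ^{n×n} is measurable, symmetric-matrix valued with λ|ξ|² ≤ ⟨ξ, a(x,t)ξ⟩ ≤ λ^{−1}|ξ|², and b(·,t) is a skew-symmetric matrix of BMO functions with sup_t ‖b(·,t)‖_BMO = B < ∞. For u ∈ H¹(ℝⁿ), define the functional F_t(ψ) = ∫_{ℝⁿ} ⟨A(x,t)∇u(x), ∇ψ(x)⟩ dx on H¹(ℝⁿ), where A = a + b and the skew part is interpreted via the 𝓗¹–BMO pairing. Then F_t is a bounded linear functional on H¹(ℝⁿ) with |F_t(ψ)| ≤ (λ^{−1} + C B) ‖∇u‖₂ ‖∇ψ‖₂ for a constant C depending only on n. -/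
open MeasureTheory Metric

/-- `M` is a bound for the BMO seminorm of `f`. -/
def IsBMOBound {n : ℕ} (f : EuclideanSpace ℝ (Fin n) → ℝ) (M : ℝ) : Prop :=
  ∀ (x : EuclideanSpace ℝ (Fin n)) (r : ℝ), 0 < r →
    ⨍ y in ball x r, |f y - ⨍ z in ball x r, f z| ≤ M

namespace BmoAux

/-- Euclidean space. -/
abbrev EE (n : ℕ) := EuclideanSpace ℝ (Fin n)

/-- unit vectors -/
noncomputable abbrev ee {n : ℕ} (k : Fin n) : EE n := EuclideanSpace.single k (1:ℝ)

/-- partial derivative -/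
noncomputable def DD {n : ℕ} (k : Fin n) (f : EE n → ℝ) : EE n → ℝ := fun x => fderiv ℝ f x (ee k)

/-- unnormalised Gaussian -/
noncomputable def gau {n : ℕ} (z : EE n) : ℝ := Real.exp (-(1/2) * ‖z‖^2)

lemma gau_pos {n : ℕ} (z : EE n) : 0 < gau z := Real.exp_pos _

lemma gau_cont {n : ℕ} : Continuous (gau (n := n)) := by unfold gau; fun_prop

lemma integrable_exp (n : ℕ) {b : ℝ} (hb : 0 < b) :
    Integrable (fun z : EE n => Real.exp (-b * ‖z‖^2)) := by
  apply Integrable.of_integral_ne_zero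
  rw [GaussianFourier.integral_rexp_neg_mul_sq_norm hb]
  positivity

lemma gau_integrable (n : ℕ) : Integrable (gau (n := n)) := integrable_exp n (by norm_num)

/-- normalised Gaussian density -/
noncomputable def rho {n : ℕ} (z : EE n) : ℝ := (∫ y : EE n, gau y)⁻¹ * gau z

lemma gau_int_pos (n : ℕ) : 0 < ∫ y : EE n, gau y := by
  unfold gau
  rw [GaussianFourier.integral_rexp_neg_mul_sq_norm (by norm_num)]
  positivity

lemma rho_pos {n : ℕ} (z : EE n) : 0 < rho z := mul_pos (inv_pos.2 (gau_int_pos n)) (gau_pos z)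

lemma rho_cont {n : ℕ} : Continuous (rho (n := n)) := by
  unfold rho; exact continuous_const.mul gau_cont

lemma rho_integrable (n : ℕ) : Integrable (rho (n := n)) := (gau_integrable n).const_mul _

lemma rho_int (n : ℕ) : ∫ z : EE n, rho z = 1 := by
  unfold rho
  rw [integral_const_mul, inv_mul_cancel₀ (gau_int_pos n).ne']

/-- the standard Gaussian measure -/
noncomputable def gam (n : ℕ) : Measure (EE n) :=
  volume.withDensity (fun z => ENNReal.ofReal (rho z))

instance (n : ℕ) : IsProbabilityMeasure (gam n) := by
  constructor
  rw [gam, withDensity_apply _ MeasurableSet.univ, Measure.restrict_univ,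
    ← ofReal_integral_eq_lintegral_ofReal (rho_integrable n) (Filter.Eventually.of_forall fun z => (rho_pos z).le),
    rho_int]
  simp

lemma integral_gam {n : ℕ} (f : EE n → ℝ) : ∫ z, f z ∂(gam n) = ∫ z, rho z * f z := by
  rw [gam, integral_withDensity_eq_integral_toReal_smul (by have := rho_cont (n := n); fun_prop)
    (Filter.Eventually.of_forall fun z => ENNReal.ofReal_lt_top)]
  congr 1; ext z
  rw [ENNReal.toReal_ofReal (rho_pos z).le, smul_eq_mul]

lemma integrable_gam {n : ℕ} (f : EE n → ℝ) :
    Integrable f (gam n) ↔ Integrable (fun z => rho z * f z) := by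
  rw [gam, integrable_withDensity_iff_integrable_smul' (by have := rho_cont (n := n); fun_prop)
    (Filter.Eventually.of_forall fun z => ENNReal.ofReal_lt_top)]
  apply integrable_congr
  filter_upwards with z
  rw [ENNReal.toReal_ofReal (rho_pos z).le, smul_eq_mul]

lemma pow_mul_exp_bound (N : ℕ) : ∃ C : ℝ, ∀ r : ℝ, 0 ≤ r →
    (1 + r)^N * Real.exp (-(1/2) * r^2) ≤ C * Real.exp (-(1/4) * r^2) := by
  refine ⟨(N.factorial : ℝ) * Real.exp 2, fun r hr => ?_⟩
  have h1 : (1+r)^N / N.factorial ≤ Real.exp (1+r) := Real.pow_div_factorial_le_exp _ (by linarith) N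
  have hN : (0:ℝ) < N.factorial := by exact_mod_cast N.factorial_pos
  rw [div_le_iff₀ hN] at h1
  calc (1 + r)^N * Real.exp (-(1/2) * r^2) ≤ (Real.exp (1+r) * N.factorial) * Real.exp (-(1/2) * r^2) := by
        gcongr
    _ = N.factorial * Real.exp (1 + r + -(1/2) * r^2) := by rw [Real.exp_add (1+r)]; ring
    _ ≤ N.factorial * Real.exp (2 + -(1/4) * r^2) := by
        apply mul_le_mul_of_nonneg_left _ hN.le
        apply Real.exp_le_exp.2; nlinarith [sq_nonneg (r - 2)]
    _ = _ := by rw [Real.exp_add]; ring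

lemma gam_moment (n N : ℕ) : Integrable (fun z : EE n => (1 + ‖z‖)^N) (gam n) := by
  rw [integrable_gam]
  obtain ⟨C, hC⟩ := pow_mul_exp_bound N
  refine Integrable.mono' ((integrable_exp n (b := 1/4) (by norm_num)).const_mul ((∫ y : EE n, gau y)⁻¹ * C)) ?_ ?_
  · have := rho_cont (n := n)
    exact (Continuous.aestronglyMeasurable (by fun_prop))
  · filter_upwards with z
    have hp := gau_int_pos n
    rw [Real.norm_of_nonneg (mul_nonneg (rho_pos z).le (by positivity))]
    unfold rho
    have := hC ‖z‖ (norm_nonneg z)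
    calc _ = (∫ y : EE n, gau y)⁻¹ * ((1 + ‖z‖)^N * Real.exp (-(1/2) * ‖z‖^2)) := by simp only [gau]; ring
      _ ≤ (∫ y : EE n, gau y)⁻¹ * (C * Real.exp (-(1/4) * ‖z‖^2)) := by gcongr
      _ = _ := by ring

lemma gam_lin (n : ℕ) : Integrable (fun z : EE n => 1 + ‖z‖) (gam n) := by
  simpa using gam_moment n 1

/-- line derivative in direction `k` -/
abbrev LD {n : ℕ} (k : Fin n) (f : EE n → ℝ) (f' : ℝ) (x : EE n) : Prop :=
  HasDerivAt (fun h : ℝ => f (x + h • ee k)) f' 0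

lemma ibp {n : ℕ} {k : Fin n} {f f' g g' : EE n → ℝ}
    (hf'g : Integrable (fun x => f' x * g x)) (hfg' : Integrable (fun x => f x * g' x))
    (hfg : Integrable (fun x => f x * g x))
    (hf : ∀ x, LD k f (f' x) x) (hg : ∀ x, LD k g (g' x) x) :
    ∫ x, f x * g' x = - ∫ x, f' x * g x :=
  integral_bilinear_hasLineDerivAt_right_eq_neg_left_of_integrable
    (B := ContinuousLinearMap.mul ℝ ℝ) hf'g hfg' hfg (fun x _ => hf x) (fun x _ => hg x)

/-- line derivative from Fréchet derivative -/
lemma ld_of_fderiv {n : ℕ} {f : EE n → ℝ} {L : EE n →L[ℝ] ℝ} {x : EE n} (h : HasFDerivAt f L x)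
    (k : Fin n) {c : ℝ} (hc : L (ee k) = c) : LD k f c x := by
  subst hc
  exact h.hasLineDerivAt (ee k)

lemma norm_coord_le {n : ℕ} (z : EE n) (k : Fin n) : |z k| ≤ ‖z‖ := by
  simpa using PiLp.norm_apply_le z k

lemma rho_line {n : ℕ} (k : Fin n) (z : EE n) :
    LD k (rho (n := n)) (-(z k) * rho z) z := by
  have h1 : HasFDerivAt (fun z : EE n => ‖z‖^2) (2 • (innerSL ℝ z)) z := (hasStrictFDerivAt_norm_sq z).hasFDerivAt
  have h2 := ((h1.const_mul (-(1/2):ℝ)).exp).const_mul ((∫ y : EE n, gau y)⁻¹)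
  refine ld_of_fderiv h2 k ?_
  simp [rho, gau, EuclideanSpace.inner_single_right]
  ring

/-- Bounded continuous integrable -/
lemma integrable_bdd_gam {n : ℕ} {g : EE n → ℝ} {C : ℝ} (hg : AEStronglyMeasurable g (gam n))
    (hC : ∀ z, |g z| ≤ C) : Integrable g (gam n) :=
  Integrable.of_bound hg C (Filter.Eventually.of_forall hC)

lemma integrable_lin_gam {n : ℕ} {g : EE n → ℝ} {C : ℝ} (hg : AEStronglyMeasurable g (gam n))
    (hC : ∀ z, |g z| ≤ C * (1 + ‖z‖)) : Integrable g (gam n) :=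
  Integrable.mono' ((gam_lin n).const_mul C) hg (Filter.Eventually.of_forall hC)

/-- Stein's lemma -/
lemma stein {n : ℕ} {k : Fin n} {g g' : EE n → ℝ} {C : ℝ} (hgc : Continuous g) (hg'c : Continuous g')
    (hg : ∀ z, LD k g (g' z) z) (h1 : ∀ z, |g z| ≤ C) (h2 : ∀ z, |g' z| ≤ C) :
    ∫ z, g z * z k ∂(gam n) = ∫ z, g' z ∂(gam n) := by
  have hC : 0 ≤ C := (abs_nonneg _).trans (h1 0)
  have i1 : Integrable g (gam n) := integrable_bdd_gam hgc.aestronglyMeasurable h1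
  have i2 : Integrable g' (gam n) := integrable_bdd_gam hg'c.aestronglyMeasurable h2
  have i3 : Integrable (fun z => g z * z k) (gam n) := by
    refine integrable_lin_gam (C := C) (Continuous.aestronglyMeasurable (by fun_prop)) fun z => ?_
    rw [abs_mul]
    have := norm_coord_le z k
    gcongr
    · exact h1 z
    · linarith
  have j1 := (integrable_gam _).1 i1
  have j2 := (integrable_gam _).1 i2
  have j3 := (integrable_gam _).1 i3
  have := ibp (k := k) (f := rho) (f' := fun z => -(z k) * rho z) (g := g) (g' := g')
    (by refine j3.neg.congr ?_
        filter_upwards with z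
        simp only [Pi.neg_apply]; ring) j2 j1 (rho_line k) hg
  rw [integral_gam, integral_gam, this, ← integral_neg]
  congr 1; ext z; ring

end BmoAux

namespace BmoAux

/-- heat extension in the variable `s = sqrt t` -/
noncomputable def HH {n : ℕ} (f : EE n → ℝ) (s : ℝ) (x : EE n) : ℝ := ∫ z, f (x + s • z) ∂(gam n)

/-- `f` continuous and bounded -/
def B0 {n : ℕ} (f : EE n → ℝ) : Prop := Continuous f ∧ ∃ C, ∀ x, |f x| ≤ C
/-- `f` is C1 with bounded derivatives -/
def B1 {n : ℕ} (f : EE n → ℝ) : Prop := ContDiff ℝ 1 f ∧ B0 f ∧ ∀ k, B0 (DD k f)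
/-- `f` is C2 with bounded derivatives -/
def B2 {n : ℕ} (f : EE n → ℝ) : Prop := B1 f ∧ ∀ k, B1 (DD k f)

lemma hd_congr {f g : ℝ → ℝ} {a b x : ℝ} (h : HasDerivAt f a x) (hfg : ∀ t, f t = g t) (hab : a = b) :
    HasDerivAt g b x := by
  subst hab
  have : f = g := funext hfg
  subst this
  exact h

lemma fderiv_apply_sum {n : ℕ} (f : EE n → ℝ) (x v : EE n) :
    fderiv ℝ f x v = ∑ k, v k * DD k f x := by
  have h : v = ∑ k, v k • ee k := by
    ext i
    simp [Pi.single_apply]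
  conv_lhs => rw [h]
  simp [DD]

lemma fderiv_norm_le {n : ℕ} (f : EE n → ℝ) (x : EE n) :
    ‖fderiv ℝ f x‖ ≤ ∑ k, |DD k f x| := by
  refine ContinuousLinearMap.opNorm_le_bound _ (by positivity) fun v => ?_
  rw [fderiv_apply_sum, Finset.sum_mul]
  refine (Finset.abs_sum_le_sum_abs _ _).trans (Finset.sum_le_sum fun k _ => ?_)
  rw [abs_mul, mul_comm]
  have := norm_coord_le v k
  gcongr

lemma B1.fderiv_bdd {n : ℕ} {f : EE n → ℝ} (hf : B1 f) : ∃ C, 0 ≤ C ∧ ∀ x, ‖fderiv ℝ f x‖ ≤ C := by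
  choose C hC using fun k => (hf.2.2 k).2
  refine ⟨∑ k, C k, Finset.sum_nonneg fun k _ => (abs_nonneg _).trans (hC k 0), fun x => (fderiv_norm_le f x).trans (Finset.sum_le_sum fun k _ => hC k x)⟩

lemma B0.aesm {n : ℕ} {f : EE n → ℝ} (hf : B0 f) (s : ℝ) (x : EE n) :
    AEStronglyMeasurable (fun z => f (x + s • z)) (gam n) := by
  have := hf.1
  exact Continuous.aestronglyMeasurable (by fun_prop)

lemma B0.integrable {n : ℕ} {f : EE n → ℝ} (hf : B0 f) (s : ℝ) (x : EE n) :
    Integrable (fun z => f (x + s • z)) (gam n) := by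
  obtain ⟨C, hC⟩ := hf.2
  exact integrable_bdd_gam (hf.aesm s x) fun z => hC _

lemma HH_bound {n : ℕ} {f : EE n → ℝ} {C : ℝ} (hC : ∀ x, |f x| ≤ C) (s : ℝ) (x : EE n) :
    |HH f s x| ≤ C := by
  have := norm_integral_le_of_norm_le_const (μ := gam n) (f := fun z => f (x + s • z)) (C := C)
    (Filter.Eventually.of_forall fun z => hC _)
  simpa [HH] using this

lemma HH_cont {n : ℕ} {f : EE n → ℝ} (hf : B0 f) : Continuous (fun p : ℝ × EE n => HH f p.1 p.2) := by
  obtain ⟨C, hC⟩ := hf.2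
  have := hf.1
  unfold HH
  refine continuous_of_dominated (bound := fun _ => C) (fun p => hf.aesm _ _)
    (fun p => Filter.Eventually.of_forall fun z => hC _) (integrable_const C)
    (Filter.Eventually.of_forall fun z => by fun_prop)

lemma HH_zero {n : ℕ} (f : EE n → ℝ) (x : EE n) : HH f 0 x = f x := by
  simp [HH]

/-- linear map in the derivative of `(r,y) ↦ y + r z`. -/
noncomputable def lz {n : ℕ} (z : EE n) : ℝ × EE n →L[ℝ] EE n :=
  ContinuousLinearMap.snd ℝ ℝ (EE n) + (ContinuousLinearMap.fst ℝ ℝ (EE n)).smulRight z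

lemma lz_apply {n : ℕ} (z : EE n) (a : ℝ) (v : EE n) : lz z (a, v) = v + a • z := by simp [lz]

lemma lz_norm {n : ℕ} (z : EE n) : ‖lz z‖ ≤ 1 + ‖z‖ := by
  refine ContinuousLinearMap.opNorm_le_bound _ (by positivity) fun p => ?_
  obtain ⟨a, v⟩ := p
  rw [lz_apply]
  have h1 := norm_fst_le (a, v)
  have h2 := norm_snd_le (a, v)
  simp only at h1 h2
  calc ‖v + a • z‖ ≤ ‖v‖ + ‖a‖ * ‖z‖ := (norm_add_le _ _).trans (by rw [norm_smul])
    _ ≤ ‖(a,v)‖ + ‖(a,v)‖ * ‖z‖ := by gcongr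
    _ = _ := by ring

lemma lz_cont {n : ℕ} : Continuous (fun z : EE n => lz z) := by
  unfold lz
  have : Continuous fun z : EE n => (ContinuousLinearMap.smulRightL ℝ (ℝ × EE n) (EE n) (ContinuousLinearMap.fst ℝ ℝ (EE n))) z := by fun_prop
  exact continuous_const.add this

lemma HH_hasFDerivAt {n : ℕ} {f : EE n → ℝ} (hf : B1 f) (r : ℝ) (y : EE n) :
    ∃ L : ℝ × EE n →L[ℝ] ℝ, HasFDerivAt (fun p : ℝ × EE n => HH f p.1 p.2) L (r, y) ∧
      ∀ a v, L (a, v) = (∑ k, v k * HH (DD k f) r y) + a * ∑ k, ∫ z, DD k f (y + r • z) * z k ∂(gam n) := by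
  obtain ⟨C, hC0, hC⟩ := hf.fderiv_bdd
  have hcf : Continuous (fderiv ℝ f) := hf.1.continuous_fderiv (by norm_num)
  let F' : ℝ × EE n → EE n → (ℝ × EE n →L[ℝ] ℝ) := fun p z => (fderiv ℝ f (p.2 + p.1 • z)).comp (lz z)
  have hF'm : ∀ p, AEStronglyMeasurable (F' p) (gam n) := by
    intro p
    refine Continuous.aestronglyMeasurable ?_
    exact (hcf.comp (by fun_prop : Continuous fun z : EE n => p.2 + p.1 • z)).clm_comp lz_cont
  have hF'b : ∀ z p, ‖F' p z‖ ≤ C * (1 + ‖z‖) := by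
    intro z p
    refine (ContinuousLinearMap.opNorm_comp_le _ _).trans ?_
    have := lz_norm z
    have := hC (p.2 + p.1 • z)
    gcongr
  have hF'i : ∀ p, Integrable (F' p) (gam n) := fun p =>
    Integrable.mono' ((gam_lin n).const_mul C) (hF'm p) (Filter.Eventually.of_forall fun z => hF'b z p)
  refine ⟨∫ z, F' (r, y) z ∂(gam n), ?_, ?_⟩
  · refine hasFDerivAt_integral_of_dominated_of_fderiv_le (s := Set.univ) (bound := fun z => C * (1 + ‖z‖))
      (F := fun p z => f (p.2 + p.1 • z))
      Filter.univ_mem (Filter.Eventually.of_forall fun p => hf.2.1.aesm _ _) (hf.2.1.integrable _ _) (hF'm _)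
      (Filter.Eventually.of_forall fun z p _ => hF'b z p) ((gam_lin n).const_mul C)
      (Filter.Eventually.of_forall fun z p _ => ?_)
    have h1 : HasFDerivAt f (fderiv ℝ f (p.2 + p.1 • z)) (p.2 + p.1 • z) :=
      (hf.1.differentiable (by norm_num)).differentiableAt.hasFDerivAt
    have h2 : HasFDerivAt (fun p : ℝ × EE n => p.2 + p.1 • z) (lz z) p := by
      have : (fun p : ℝ × EE n => p.2 + p.1 • z) = lz z := by
        ext1 q; rw [← lz_apply]
      rw [this]; exact (lz z).hasFDerivAt
    exact h1.comp p h2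
  · intro a v
    rw [ContinuousLinearMap.integral_apply (hF'i _)]
    have hpt : ∀ z, F' (r, y) z (a, v) = (∑ k, v k * DD k f (y + r • z)) + a * ∑ k, DD k f (y + r • z) * z k := by
      intro z
      simp only [F', ContinuousLinearMap.comp_apply, lz_apply]
      rw [fderiv_apply_sum, Finset.mul_sum, ← Finset.sum_add_distrib]
      refine Finset.sum_congr rfl fun k _ => ?_
      simp; ring
    simp_rw [hpt]
    have i1 : ∀ k, Integrable (fun z => DD k f (y + r • z) * z k) (gam n) := by
      intro k
      obtain ⟨K, hK⟩ := (hf.2.2 k).2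
      have := (hf.2.2 k).1
      refine integrable_lin_gam (C := K) (Continuous.aestronglyMeasurable (by fun_prop)) fun z => ?_
      rw [abs_mul]
      have h0 : 0 ≤ K := (abs_nonneg _).trans (hK 0)
      have := norm_coord_le z k
      gcongr
      · exact hK _
      · linarith
    rw [integral_add, integral_finsetSum, integral_const_mul, integral_finsetSum]
    · simp_rw [integral_const_mul]; rfl
    · intro k _; exact i1 k
    · intro k _; exact ((hf.2.2 k).integrable _ _).const_mul _
    · exact integrable_finsetSum _ fun k _ => ((hf.2.2 k).integrable _ _).const_mul _
    · exact (integrable_finsetSum _ fun k _ => i1 k).const_mul _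

lemma LD_of_B1 {n : ℕ} {f : EE n → ℝ} (hf : ContDiff ℝ 1 f) (k : Fin n) (x : EE n) : LD k f (DD k f x) x :=
  ld_of_fderiv (hf.differentiable (by norm_num)).differentiableAt.hasFDerivAt k rfl

lemma stein_shift {n : ℕ} {k : Fin n} {g g' : EE n → ℝ} {C : ℝ} (hgc : Continuous g) (hg'c : Continuous g')
    (hg : ∀ z, LD k g (g' z) z) (h1 : ∀ z, |g z| ≤ C) (h2 : ∀ z, |g' z| ≤ C) (y : EE n) (r : ℝ) :
    ∫ z, g (y + r • z) * z k ∂(gam n) = r * ∫ z, g' (y + r • z) ∂(gam n) := by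
  have hC : 0 ≤ C := (abs_nonneg _).trans (h1 0)
  rw [← integral_const_mul]
  refine stein (C := C * (1 + |r|)) (by fun_prop) (by fun_prop) ?_ ?_ ?_
  · intro z
    have h := hg (y + r • z)
    have h3 : HasDerivAt (fun h : ℝ => r * h) r 0 := by simpa using (hasDerivAt_id (0:ℝ)).const_mul r
    have h4 : HasDerivAt (fun h : ℝ => g (y + r • z + h • ee k)) (g' (y + r • z)) (r * 0) := by simpa using h
    have h5 := h4.comp 0 h3
    refine hd_congr h5 ?_ (mul_comm _ _)
    intro t
    change g (y + r • z + (r * t) • ee k) = g (y + r • (z + t • ee k))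
    congr 1
    rw [smul_add, smul_smul, add_assoc]
  · intro z; exact (h1 _).trans (by nlinarith [abs_nonneg r])
  · intro z
    rw [abs_mul]
    have := h2 (y + r • z)
    nlinarith [abs_nonneg r]

lemma HH_hasFDerivAt2 {n : ℕ} {f : EE n → ℝ} (hf : B2 f) (r : ℝ) (y : EE n) :
    ∃ L : ℝ × EE n →L[ℝ] ℝ, HasFDerivAt (fun p : ℝ × EE n => HH f p.1 p.2) L (r, y) ∧
      ∀ a v, L (a, v) = (∑ k, v k * HH (DD k f) r y) + a * (r * ∑ k, HH (DD k (DD k f)) r y) := by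
  obtain ⟨L, hL, hL'⟩ := HH_hasFDerivAt hf.1 r y
  refine ⟨L, hL, fun a v => ?_⟩
  have key : ∀ k, ∫ z, DD k f (y + r • z) * z k ∂(gam n) = r * HH (DD k (DD k f)) r y := ?_
  · rw [hL', Finset.sum_congr rfl fun k _ => key k, Finset.mul_sum Finset.univ _ r]
  intro k
  obtain ⟨h1, ⟨h2, C, hC⟩, h3⟩ := hf.2 k
  obtain ⟨h4, C', hC'⟩ := h3 k
  exact stein_shift (C := max C C') h2 h4 (fun z => LD_of_B1 h1 k z) (fun z => (hC z).trans (le_max_left _ _))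
    (fun z => (hC' z).trans (le_max_right _ _)) y r

lemma HH_LD {n : ℕ} {f : EE n → ℝ} (hf : B1 f) (k : Fin n) (s : ℝ) (x : EE n) :
    LD k (HH f s) (HH (DD k f) s x) x := by
  obtain ⟨L, hL, hL'⟩ := HH_hasFDerivAt hf s x
  have h1 : HasDerivAt (fun h : ℝ => ((s, x + h • ee k) : ℝ × EE n)) (0, ee k) 0 := by
    have : HasDerivAt (fun h : ℝ => x + h • ee k) (ee k) 0 := by
      simpa using ((hasDerivAt_id (0:ℝ)).smul_const (ee k)).const_add x
    exact (hasDerivAt_const _ _).prodMk this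
  have h2 : HasFDerivAt (fun p : ℝ × EE n => HH f p.1 p.2) L (s, x + (0:ℝ) • ee k) := by simpa using hL
  have h3 := h2.comp_hasDerivAt 0 h1
  have : L (0, ee k) = HH (DD k f) s x := by
    rw [hL']; simp
  rw [this] at h3
  exact h3

lemma HH_ds {n : ℕ} {f : EE n → ℝ} (hf : B2 f) (s : ℝ) (x : EE n) :
    HasDerivAt (fun s => HH f s x) (s * ∑ k, HH (DD k (DD k f)) s x) s := by
  obtain ⟨L, hL, hL'⟩ := HH_hasFDerivAt2 hf s x
  have h1 : HasDerivAt (fun h : ℝ => ((h, x) : ℝ × EE n)) (1, 0) s :=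
    (hasDerivAt_id _).prodMk (hasDerivAt_const _ _)
  have h3 := hL.comp_hasDerivAt s h1
  have : L (1, 0) = s * ∑ k, HH (DD k (DD k f)) s x := by
    rw [hL']; simp
  rw [this] at h3
  exact h3

end BmoAux

namespace BmoAux

/-- bounded continuous -/
def BC {X : Type*} [TopologicalSpace X] (f : X → ℝ) : Prop := Continuous f ∧ ∃ C, ∀ x, |f x| ≤ C

section BC
variable {X : Type*} [TopologicalSpace X] {f g : X → ℝ}

lemma BC.const (c : ℝ) : BC (fun _ : X => c) := ⟨continuous_const, |c|, fun _ => le_rfl⟩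

lemma BC.add (hf : BC f) (hg : BC g) : BC (fun x => f x + g x) := by
  obtain ⟨h1, C, hC⟩ := hf
  obtain ⟨h2, C', hC'⟩ := hg
  exact ⟨h1.add h2, C + C', fun x => (abs_add_le _ _).trans (add_le_add (hC x) (hC' x))⟩

lemma BC.mul (hf : BC f) (hg : BC g) : BC (fun x => f x * g x) := by
  obtain ⟨h1, C, hC⟩ := hf
  obtain ⟨h2, C', hC'⟩ := hg
  refine ⟨h1.mul h2, C * C', fun x => ?_⟩
  rw [abs_mul]
  exact mul_le_mul (hC x) (hC' x) (abs_nonneg _) ((abs_nonneg _).trans (hC x))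

lemma BC.neg (hf : BC f) : BC (fun x => - f x) := by
  obtain ⟨h1, C, hC⟩ := hf
  exact ⟨h1.neg, C, fun x => by rw [abs_neg]; exact hC x⟩

lemma BC.sub (hf : BC f) (hg : BC g) : BC (fun x => f x - g x) := by
  simpa [sub_eq_add_neg] using hf.add hg.neg

lemma BC.pow (hf : BC f) (m : ℕ) : BC (fun x => f x ^ m) := by
  obtain ⟨h1, C, hC⟩ := hf
  refine ⟨h1.pow m, C^m, fun x => ?_⟩
  rw [abs_pow]
  exact pow_le_pow_left₀ (abs_nonneg _) (hC x) m

lemma BC.sum {ι : Type*} [Fintype ι] {F : ι → X → ℝ} (h : ∀ i, BC (F i)) :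
    BC (fun x => ∑ i, F i x) := by
  choose C hC using fun i => (h i).2
  exact ⟨continuous_finsetSum _ fun i _ => (h i).1, ∑ i, C i, fun x =>
    (Finset.abs_sum_le_sum_abs _ _).trans (Finset.sum_le_sum fun i _ => hC i x)⟩

lemma BC.comp_cont {φ : ℝ → ℝ} (hφ : Continuous φ) (hf : BC f) : BC (fun x => φ (f x)) := by
  obtain ⟨h1, C, hC⟩ := hf
  obtain ⟨K, hK⟩ := (isCompact_Icc (a := -C) (b := C)).exists_bound_of_continuousOn hφ.continuousOn
  exact ⟨hφ.comp h1, K, fun x => hK _ (abs_le.1 (hC x))⟩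

lemma BC.comp {Y : Type*} [TopologicalSpace Y] (hf : BC f) {j : Y → X} (hj : Continuous j) :
    BC (fun y => f (j y)) := ⟨hf.1.comp hj, hf.2.imp fun _ h y => h (j y)⟩
end BC

lemma HH_BC {n : ℕ} {f : EE n → ℝ} (hf : B0 f) : BC (fun p : ℝ × EE n => HH f p.1 p.2) :=
  ⟨HH_cont hf, hf.2.imp fun _ h p => HH_bound h p.1 p.2⟩

lemma contDiff_DD_of {n : ℕ} {f : EE n → ℝ} (hf : ContDiff ℝ 1 f) (k : Fin n) : Continuous (DD k f) := by
  have := hf.continuous_fderiv (by norm_num)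
  unfold DD; fun_prop

lemma DD_mul {n : ℕ} {f g : EE n → ℝ} (hf : ContDiff ℝ 1 f) (hg : ContDiff ℝ 1 g) (k : Fin n) :
    DD k (fun x => f x * g x) = fun x => f x * DD k g x + g x * DD k f x := by
  ext x
  unfold DD
  rw [fderiv_fun_mul (hf.differentiable (by norm_num)).differentiableAt (hg.differentiable (by norm_num)).differentiableAt]
  simp

lemma DD_add {n : ℕ} {f g : EE n → ℝ} (hf : ContDiff ℝ 1 f) (hg : ContDiff ℝ 1 g) (k : Fin n) :
    DD k (fun x => f x + g x) = fun x => DD k f x + DD k g x := by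
  ext x
  unfold DD
  rw [fderiv_fun_add (hf.differentiable (by norm_num)).differentiableAt (hg.differentiable (by norm_num)).differentiableAt]
  simp

lemma B1.mul {n : ℕ} {f g : EE n → ℝ} (hf : B1 f) (hg : B1 g) : B1 (fun x => f x * g x) := by
  refine ⟨hf.1.mul hg.1, BC.mul hf.2.1 hg.2.1, fun k => ?_⟩
  rw [DD_mul hf.1 hg.1]
  exact BC.add (BC.mul hf.2.1 (hg.2.2 k)) (BC.mul hg.2.1 (hf.2.2 k))

lemma B1.add {n : ℕ} {f g : EE n → ℝ} (hf : B1 f) (hg : B1 g) : B1 (fun x => f x + g x) := by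
  refine ⟨hf.1.add hg.1, BC.add hf.2.1 hg.2.1, fun k => ?_⟩
  rw [DD_add hf.1 hg.1]
  exact BC.add (hf.2.2 k) (hg.2.2 k)

lemma B2.mul {n : ℕ} {f g : EE n → ℝ} (hf : B2 f) (hg : B2 g) : B2 (fun x => f x * g x) := by
  refine ⟨hf.1.mul hg.1, fun k => ?_⟩
  rw [DD_mul hf.1.1 hg.1.1]
  exact B1.add (hf.1.mul (hg.2 k)) (hg.1.mul (hf.2 k))

/-- variance -/
noncomputable def ww {n : ℕ} (b : EE n → ℝ) (r : ℝ) (y : EE n) : ℝ :=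
  HH (fun x => b x * b x) r y - (HH b r y)^2

/-- derivative of variance -/
noncomputable def wd {n : ℕ} (b : EE n → ℝ) (k : Fin n) (r : ℝ) (y : EE n) : ℝ :=
  HH (DD k (fun x => b x * b x)) r y - 2 * HH b r y * HH (DD k b) r y

lemma ww_nonneg {n : ℕ} {b : EE n → ℝ} (hb : B0 b) (r : ℝ) (y : EE n) : 0 ≤ ww b r y := by
  have i1 := hb.integrable r y
  have i2 : Integrable (fun z => b (y + r • z) * b (y + r • z)) (gam n) := B0.integrable (BC.mul hb hb) r y
  have h : 0 ≤ ∫ z, (b (y + r • z) - HH b r y)^2 ∂(gam n) := integral_nonneg fun z => sq_nonneg _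
  have h2 : ∫ z, (b (y + r • z) - HH b r y)^2 ∂(gam n) =
      ∫ z, (b (y + r • z) * b (y + r • z) - (2 * HH b r y) * b (y + r • z) + (HH b r y)^2) ∂(gam n) := by
    congr 1; ext z; ring
  have i3 : Integrable (fun z => b (y + r • z) * b (y + r • z) - (2 * HH b r y) * b (y + r • z)) (gam n) :=
    i2.sub (i1.const_mul _)
  rw [h2, integral_add i3 (integrable_const _), integral_sub i2 (i1.const_mul _), integral_const_mul] at h
  simp only [integral_const, probReal_univ, one_smul] at h
  unfold ww
  have e1 : ∫ z, b (y + r • z) ∂(gam n) = HH b r y := rfl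
  have e2 : ∫ z, b (y + r • z) * b (y + r • z) ∂(gam n) = HH (fun x => b x * b x) r y := rfl
  rw [e1, e2] at h
  nlinarith

lemma ww_LD {n : ℕ} {b : EE n → ℝ} (hb : B1 b) (k : Fin n) (r : ℝ) (y : EE n) :
    LD k (ww b r) (wd b k r y) y := by
  have h1 := HH_LD (hb.mul hb) k r y
  have h2 := HH_LD hb k r y
  refine hd_congr (h1.sub (h2.pow 2)) (fun t => rfl) ?_
  simp [wd]

/-- `1/sqrt(1+β²)` -/
noncomputable def pp (β : ℝ) : ℝ := (Real.sqrt (1 + β^2))⁻¹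

lemma pp_pos (β : ℝ) : 0 < pp β := by unfold pp; positivity
lemma pp_sq (β : ℝ) : pp β ^ 2 * (1 + β^2) = 1 := by
  unfold pp
  have : Real.sqrt (1 + β^2) ^ 2 = 1 + β^2 := Real.sq_sqrt (by positivity)
  rw [inv_pow, this, inv_mul_cancel₀ (by positivity)]
lemma pp_cont : Continuous pp := by
  unfold pp
  exact Continuous.inv₀ (by fun_prop) fun x => by positivity
lemma qq_deriv (β : ℝ) : HasDerivAt (fun β => Real.sqrt (1 + β^2)) (β * pp β) β := by
  have h1 : HasDerivAt (fun β : ℝ => 1 + β^2) (2 * β) β := by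
    simpa using ((hasDerivAt_id β).pow 2).const_add 1
  have := h1.sqrt (by positivity)
  refine hd_congr this (fun t => rfl) ?_
  unfold pp
  field_simp
lemma pp_deriv (β : ℝ) : HasDerivAt pp (-(β * pp β ^ 3)) β := by
  have := (qq_deriv β).inv (by positivity)
  refine hd_congr this (fun t => rfl) ?_
  unfold pp
  field_simp

/-- Bellman function and its derivatives -/
noncomputable def Ph (β w : ℝ) : ℝ := Real.sqrt (1 + β^2) + (1/20) * (w + w^2/2) * pp β ^ 3
/-- partial derivative -/
noncomputable def Pb (β w : ℝ) : ℝ := β * pp β - (3/20) * (w + w^2/2) * β * pp β ^ 5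
/-- partial derivative -/
noncomputable def Pw (β w : ℝ) : ℝ := (1/20) * (1 + w) * pp β ^ 3
/-- partial derivative -/
noncomputable def Pbb (β w : ℝ) : ℝ := pp β ^ 3 - (3/20) * (w + w^2/2) * (pp β ^ 5 - 5 * β^2 * pp β ^ 7)
/-- partial derivative -/
noncomputable def Pbw (β w : ℝ) : ℝ := -((3/20) * (1 + w) * β * pp β ^ 5)
/-- partial derivative -/
noncomputable def Pww (β _w : ℝ) : ℝ := (1/20) * pp β ^ 3

lemma Ph_deriv {β w : ℝ → ℝ} {β' w' t : ℝ} (hβ : HasDerivAt β β' t) (hw : HasDerivAt w w' t) :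
    HasDerivAt (fun t => Ph (β t) (w t)) (Pb (β t) (w t) * β' + Pw (β t) (w t) * w') t := by
  have h1 := (qq_deriv (β t)).comp t hβ
  have h2 := (pp_deriv (β t)).comp t hβ
  have h3 := h1.add (((hw.add ((hw.pow 2).div_const 2)).const_mul (1/20)).mul (h2.pow 3))
  refine hd_congr h3 (fun t => rfl) ?_
  simp [Pb, Pw, Function.comp]
  ring

lemma Pb_deriv {β w : ℝ → ℝ} {β' w' t : ℝ} (hβ : HasDerivAt β β' t) (hw : HasDerivAt w w' t) :
    HasDerivAt (fun t => Pb (β t) (w t)) (Pbb (β t) (w t) * β' + Pbw (β t) (w t) * w') t := by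
  have h2 := (pp_deriv (β t)).comp t hβ
  have h3 := (hβ.mul h2).sub ((((hw.add ((hw.pow 2).div_const 2)).const_mul (3/20)).mul hβ).mul (h2.pow 5))
  refine hd_congr h3 (fun t => rfl) ?_
  simp [Pbb, Pbw, Function.comp]
  have := pp_sq (β t)
  linear_combination (- β' * pp (β t)) * this

lemma Pw_deriv {β w : ℝ → ℝ} {β' w' t : ℝ} (hβ : HasDerivAt β β' t) (hw : HasDerivAt w w' t) :
    HasDerivAt (fun t => Pw (β t) (w t)) (Pbw (β t) (w t) * β' + Pww (β t) (w t) * w') t := by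
  have h2 := (pp_deriv (β t)).comp t hβ
  have h3 := ((hw.const_add 1).const_mul (1/20)).mul (h2.pow 3)
  refine hd_congr h3 (fun t => rfl) ?_
  simp [Pww, Pbw, Function.comp]
  ring

lemma P_convex (β w x y : ℝ) (h0 : 0 ≤ w) (h1 : w ≤ 1) :
    0 ≤ Pbb β w * x^2 + 2 * Pbw β w * x * y + Pww β w * y^2 - 2 * Pw β w * x^2 := by
  have hp := pp_pos β
  have hs := pp_sq β
  unfold Pbb Pbw Pww Pw
  set p := pp β
  have key : 0 ≤ (1 - (3/20) * (w + w^2/2) * (p^2 - 5 * β^2 * p^4) - (1/10) * (1 + w)) * x^2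
      - (6/20) * (1 + w) * β * p^2 * x * y + (1/20) * y^2 := by
    have h2 : β^2 * p^4 ≤ 1/4 := by
      have : β^2 * p^4 = p^2 * (1 - p^2) := by linear_combination p^2 * hs
      rw [this]; nlinarith [sq_nonneg (p^2 - 1/2)]
    have h3 : 0 ≤ β^2 * p^4 := by positivity
    have h4 : p^2 ≤ 1 := by nlinarith [sq_nonneg (β * p)]
    have e : (1/20) * (y - 3 * (1 + w) * β * p^2 * x)^2 =
      (1/20) * y^2 - (6/20) * (1 + w) * β * p^2 * x * y + (9/20) * (1+w)^2 * (β^2 * p^4) * x^2 := by ring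
    have hsq := sq_nonneg (y - 3 * (1 + w) * β * p^2 * x)
    have h5 : (1+w)^2 * (β^2 * p^4) ≤ 1 := by
      have : (1+w)^2 ≤ 4 := by nlinarith
      nlinarith
    have h6 : (w + w^2/2) * (p^2 - 5 * β^2 * p^4) ≤ 3/2 := by
      have h7 : w + w^2/2 ≤ 3/2 := by nlinarith
      have h8 : 0 ≤ w + w^2/2 := by positivity
      have h9 : p^2 - 5 * β^2 * p^4 ≤ 1 := by nlinarith
      nlinarith
    have h10 : 0 ≤ (1 - (3/20) * ((w + w^2/2) * (p^2 - 5 * β^2 * p^4)) - (1/10) * (1 + w) - (9/20) * ((1+w)^2 * (β^2 * p^4))) * x^2 := by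
      apply mul_nonneg _ (sq_nonneg x)
      linarith
    nlinarith
  have := mul_nonneg (pow_pos hp 3).le key
  nlinarith

end BmoAux

namespace BmoAux

/-- the vector field component -/
noncomputable def gk {n : ℕ} (b : EE n → ℝ) (c : ℝ) (k : Fin n) (r : ℝ) (y : EE n) : ℝ :=
  Pb (HH b r y - c) (ww b r y) * HH (DD k b) r y + Pw (HH b r y - c) (ww b r y) * wd b k r y

/-- derivative of `gk` -/
noncomputable def Gk {n : ℕ} (b : EE n → ℝ) (c : ℝ) (k : Fin n) (r : ℝ) (y : EE n) : ℝ :=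
  (Pbb (HH b r y - c) (ww b r y) * HH (DD k b) r y + Pbw (HH b r y - c) (ww b r y) * wd b k r y) * HH (DD k b) r y
  + Pb (HH b r y - c) (ww b r y) * HH (DD k (DD k b)) r y
  + ((Pbw (HH b r y - c) (ww b r y) * HH (DD k b) r y + Pww (HH b r y - c) (ww b r y) * wd b k r y) * wd b k r y
  + Pw (HH b r y - c) (ww b r y) * (HH (DD k (DD k (fun x => b x * b x))) r y
     - (2 * HH (DD k b) r y * HH (DD k b) r y + 2 * HH b r y * HH (DD k (DD k b)) r y)))

/-- time part -/
noncomputable def Xk {n : ℕ} (b : EE n → ℝ) (c : ℝ) (k : Fin n) (r : ℝ) (y : EE n) : ℝ :=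
  Pb (HH b r y - c) (ww b r y) * HH (DD k (DD k b)) r y +
  Pw (HH b r y - c) (ww b r y) * (HH (DD k (DD k (fun x => b x * b x))) r y - 2 * HH b r y * HH (DD k (DD k b)) r y)

lemma gk_LD {n : ℕ} {b : EE n → ℝ} (hb : B2 b) (c : ℝ) (k : Fin n) (r : ℝ) (y : EE n) :
    LD k (gk b c k r) (Gk b c k r y) y := by
  have h1 := (HH_LD hb.1 k r y)
  have h2 := ww_LD hb.1 k r y
  have h3 := HH_LD (hb.2 k) k r y
  have h4 := HH_LD ((hb.mul hb).2 k) k r y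
  have h5 := h4.sub ((h1.const_mul 2).mul h3)
  have h6 := ((Pb_deriv (h1.sub_const c) h2).mul h3).add ((Pw_deriv (h1.sub_const c) h2).mul h5)
  refine hd_congr h6 (fun t => rfl) ?_
  simp [Gk, wd]

section
variable {n : ℕ} {b : EE n → ℝ}

lemma ww_BC (hb : B0 b) : BC (fun p : ℝ × EE n => ww b p.1 p.2) :=
  (HH_BC (BC.mul hb hb)).sub ((HH_BC hb).pow 2)

lemma wd_BC (hb : B1 b) (k : Fin n) : BC (fun p : ℝ × EE n => wd b k p.1 p.2) :=
  (HH_BC ((hb.mul hb).2.2 k)).sub (((BC.const 2).mul (HH_BC hb.2.1)).mul (HH_BC (hb.2.2 k)))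

variable {X : Type*} [TopologicalSpace X] {f g : X → ℝ}
lemma BC.Ph (hf : BC f) (hg : BC g) : BC (fun x => Ph (f x) (g x)) :=
  (BC.comp_cont (φ := fun β => Real.sqrt (1 + β^2)) (by fun_prop) hf).add
    (((BC.const (1/20)).mul (hg.add ((BC.comp_cont (φ := fun w => w^2/2) (by fun_prop) hg)))).mul
      ((BC.comp_cont pp_cont hf).pow 3))
lemma BC.Pb (hf : BC f) (hg : BC g) : BC (fun x => Pb (f x) (g x)) :=
  (hf.mul (BC.comp_cont pp_cont hf)).sub
    ((((BC.const (3/20)).mul (hg.add ((BC.comp_cont (φ := fun w => w^2/2) (by fun_prop) hg)))).mul hf).mul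
      ((BC.comp_cont pp_cont hf).pow 5))
lemma BC.Pw (hf : BC f) (hg : BC g) : BC (fun x => Pw (f x) (g x)) :=
  ((BC.const (1/20)).mul ((BC.const 1).add hg)).mul ((BC.comp_cont pp_cont hf).pow 3)
lemma BC.Pww (hf : BC f) (hg : BC g) : BC (fun x => Pww (f x) (g x)) :=
  (BC.const (1/20)).mul ((BC.comp_cont pp_cont hf).pow 3)
lemma BC.Pbw (hf : BC f) (hg : BC g) : BC (fun x => Pbw (f x) (g x)) :=
  ((((BC.const (3/20)).mul ((BC.const 1).add hg)).mul hf).mul ((BC.comp_cont pp_cont hf).pow 5)).neg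
lemma BC.Pbb (hf : BC f) (hg : BC g) : BC (fun x => Pbb (f x) (g x)) :=
  ((BC.comp_cont pp_cont hf).pow 3).sub
    (((BC.const (3/20)).mul (hg.add ((BC.comp_cont (φ := fun w => w^2/2) (by fun_prop) hg)))).mul
      (((BC.comp_cont pp_cont hf).pow 5).sub (((BC.const 5).mul (hf.pow 2)).mul ((BC.comp_cont pp_cont hf).pow 7))))

lemma gk_BC (hb : B2 b) (c : ℝ) (k : Fin n) : BC (fun p : ℝ × EE n => gk b c k p.1 p.2) := by
  have hB := (HH_BC hb.1.2.1).sub (BC.const c)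
  have hw := ww_BC hb.1.2.1
  exact ((BC.Pb hB hw).mul (HH_BC (hb.1.2.2 k))).add ((BC.Pw hB hw).mul (wd_BC hb.1 k))

lemma Xk_BC (hb : B2 b) (c : ℝ) (k : Fin n) : BC (fun p : ℝ × EE n => Xk b c k p.1 p.2) := by
  have hB := (HH_BC hb.1.2.1).sub (BC.const c)
  have hw := ww_BC hb.1.2.1
  have hkk := HH_BC ((hb.2 k).2.2 k)
  have hqq := HH_BC (((hb.mul hb).2 k).2.2 k)
  exact ((BC.Pb hB hw).mul hkk).add ((BC.Pw hB hw).mul (hqq.sub (((BC.const 2).mul (HH_BC hb.1.2.1)).mul hkk)))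

lemma Gk_BC (hb : B2 b) (c : ℝ) (k : Fin n) : BC (fun p : ℝ × EE n => Gk b c k p.1 p.2) := by
  have hB := (HH_BC hb.1.2.1).sub (BC.const c)
  have hw := ww_BC hb.1.2.1
  have hk := HH_BC (hb.1.2.2 k)
  have hkk := HH_BC ((hb.2 k).2.2 k)
  have hqq := HH_BC (((hb.mul hb).2 k).2.2 k)
  have hwd := wd_BC hb.1 k
  exact ((((BC.Pbb hB hw).mul hk).add ((BC.Pbw hB hw).mul hwd)).mul hk).add ((BC.Pb hB hw).mul hkk) |>.add
    (((((BC.Pbw hB hw).mul hk).add ((BC.Pww hB hw).mul hwd)).mul hwd).add ((BC.Pw hB hw).mul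
      (hqq.sub ((((BC.const 2).mul hk).mul hk).add (((BC.const 2).mul (HH_BC hb.1.2.1)).mul hkk)))))
end

lemma Gk_sub_Xk {n : ℕ} {b : EE n → ℝ} (hb : B2 b) (hw : ∀ r y, ww b r y ≤ 1) (c : ℝ) (k : Fin n) (r : ℝ) (y : EE n) :
    0 ≤ Gk b c k r y - Xk b c k r y := by
  have := P_convex (HH b r y - c) (ww b r y) (HH (DD k b) r y) (wd b k r y) (ww_nonneg hb.1.2.1 r y) (hw r y)
  unfold Gk Xk
  linarith

/-- curve derivative of HH -/
lemma HH_curve {n : ℕ} {f : EE n → ℝ} (hf : B2 f) (R : ℝ) (x z : EE n) (θ : ℝ) :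
    HasDerivAt (fun θ => HH f (R * Real.cos θ) (x + (R * Real.sin θ) • z))
      (∑ k, (R * Real.cos θ * z k * HH (DD k f) (R * Real.cos θ) (x + (R * Real.sin θ) • z)
        - R^2 * Real.sin θ * Real.cos θ * HH (DD k (DD k f)) (R * Real.cos θ) (x + (R * Real.sin θ) • z))) θ := by
  obtain ⟨L, hL, hL'⟩ := HH_hasFDerivAt2 hf (R * Real.cos θ) (x + (R * Real.sin θ) • z)
  have h1 : HasDerivAt (fun θ : ℝ => ((R * Real.cos θ, x + (R * Real.sin θ) • z) : ℝ × EE n))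
      (R * (- Real.sin θ), (R * Real.cos θ) • z) θ :=
    ((Real.hasDerivAt_cos θ).const_mul R).prodMk
      ((((Real.hasDerivAt_sin θ).const_mul R).smul_const z).const_add x)
  have h3 := hL.comp_hasDerivAt θ h1
  refine hd_congr h3 (fun t => rfl) ?_
  rw [hL', Finset.mul_sum, Finset.mul_sum, ← Finset.sum_add_distrib]
  refine Finset.sum_congr rfl fun k _ => ?_
  simp
  ring

lemma chi_curve {n : ℕ} {b : EE n → ℝ} (hb : B2 b) (c R : ℝ) (x z : EE n) (θ : ℝ) :
    HasDerivAt (fun θ => Ph (HH b (R * Real.cos θ) (x + (R * Real.sin θ) • z) - c) (ww b (R * Real.cos θ) (x + (R * Real.sin θ) • z)))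
      (∑ k, (R * Real.cos θ * (gk b c k (R * Real.cos θ) (x + (R * Real.sin θ) • z) * z k)
        - R^2 * Real.sin θ * Real.cos θ * Xk b c k (R * Real.cos θ) (x + (R * Real.sin θ) • z))) θ := by
  have h1 := HH_curve hb R x z θ
  have h2 := HH_curve (hb.mul hb) R x z θ
  have h3 := Ph_deriv (h1.sub_const c) (h2.sub (h1.pow 2))
  refine hd_congr h3 (fun t => rfl) ?_
  simp only [Finset.mul_sum, ← Finset.sum_sub_distrib, ← Finset.sum_add_distrib]
  refine Finset.sum_congr rfl fun k _ => ?_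
  simp only [gk, Xk, wd, ww, Pi.sub_apply, Pi.pow_apply]
  push_cast
  ring

/-- the JN functional -/
noncomputable def KK {n : ℕ} (b : EE n → ℝ) (c R : ℝ) (x : EE n) (θ : ℝ) : ℝ :=
  ∫ z, Ph (HH b (R * Real.cos θ) (x + (R * Real.sin θ) • z) - c) (ww b (R * Real.cos θ) (x + (R * Real.sin θ) • z)) ∂(gam n)

lemma BC.integrable {n : ℕ} {f : EE n → ℝ} (hf : BC f) : Integrable f (gam n) := by
  obtain ⟨C, hC⟩ := hf.2
  exact integrable_bdd_gam hf.1.aestronglyMeasurable hC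

lemma BC.integrable_mul {n : ℕ} {f : EE n → ℝ} (hf : BC f) (k : Fin n) : Integrable (fun z => f z * z k) (gam n) := by
  obtain ⟨K, hK⟩ := hf.2
  have := hf.1
  refine integrable_lin_gam (C := K) (Continuous.aestronglyMeasurable (by fun_prop)) fun z => ?_
  rw [abs_mul]
  have h0 : 0 ≤ K := (abs_nonneg _).trans (hK 0)
  have := norm_coord_le z k
  gcongr
  · exact hK _
  · linarith

lemma isub {α : Type*} [MeasurableSpace α] {μ : Measure α} {f g : α → ℝ} (hf : Integrable f μ) (hg : Integrable g μ) :
    Integrable (fun x => f x - g x) μ := hf.sub hg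
lemma iadd {α : Type*} [MeasurableSpace α] {μ : Measure α} {f g : α → ℝ} (hf : Integrable f μ) (hg : Integrable g μ) :
    Integrable (fun x => f x + g x) μ := hf.add hg

lemma curve_deriv {n : ℕ} {χ : ℝ × EE n → ℝ} {g G X : Fin n → ℝ × EE n → ℝ} (hχ : BC χ)
    (hg : ∀ k, BC (g k)) (hG : ∀ k, BC (G k)) (hX : ∀ k, BC (X k)) (R : ℝ) (x : EE n)
    (hLD : ∀ k r y, LD k (fun y => g k (r, y)) (G k (r, y)) y)
    (hcurve : ∀ z θ, HasDerivAt (fun θ => χ (R * Real.cos θ, x + (R * Real.sin θ) • z))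
      (∑ k, (R * Real.cos θ * (g k (R * Real.cos θ, x + (R * Real.sin θ) • z) * z k)
        - R^2 * Real.sin θ * Real.cos θ * X k (R * Real.cos θ, x + (R * Real.sin θ) • z))) θ) (θ : ℝ) :
    HasDerivAt (fun θ => ∫ z, χ (R * Real.cos θ, x + (R * Real.sin θ) • z) ∂(gam n))
     (R^2 * Real.sin θ * Real.cos θ * ∫ z, ∑ k, (G k (R * Real.cos θ, x + (R * Real.sin θ) • z)
      - X k (R * Real.cos θ, x + (R * Real.sin θ) • z)) ∂(gam n)) θ := by
  have hj : ∀ θ : ℝ, Continuous (fun z : EE n => ((R * Real.cos θ, x + (R * Real.sin θ) • z) : ℝ × EE n)) := fun θ => by fun_prop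
  choose Cg hCg using fun k => (hg k).2
  choose CX hCX using fun k => (hX k).2
  have hCg0 : ∀ k, 0 ≤ Cg k := fun k => (abs_nonneg _).trans (hCg k 0)
  have hCX0 : ∀ k, 0 ≤ CX k := fun k => (abs_nonneg _).trans (hCX k 0)
  have hgc : ∀ (θ : ℝ) k, BC (fun z => g k (R * Real.cos θ, x + (R * Real.sin θ) • z)) := fun θ k => (hg k).comp (hj θ)
  have hXc : ∀ (θ : ℝ) k, BC (fun z => X k (R * Real.cos θ, x + (R * Real.sin θ) • z)) := fun θ k => (hX k).comp (hj θ)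
  have hGc : ∀ (θ : ℝ) k, BC (fun z => G k (R * Real.cos θ, x + (R * Real.sin θ) • z)) := fun θ k => (hG k).comp (hj θ)
  have key := hasDerivAt_integral_of_dominated_loc_of_deriv_le (μ := gam n) (𝕜 := ℝ)
    (F := fun θ z => χ (R * Real.cos θ, x + (R * Real.sin θ) • z))
    (F' := fun θ z => ∑ k, (R * Real.cos θ * (g k (R * Real.cos θ, x + (R * Real.sin θ) • z) * z k)
        - R^2 * Real.sin θ * Real.cos θ * X k (R * Real.cos θ, x + (R * Real.sin θ) • z)))
    (x₀ := θ) (s := Set.univ) (bound := fun z => (∑ k, (|R| * Cg k + R^2 * CX k)) * (1 + ‖z‖)) Filter.univ_mem ?_ ?_ ?_ ?_ ?_ ?_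
  · refine hd_congr key.2 (fun t => rfl) ?_
    have e1 : ∀ k, ∫ z, g k (R * Real.cos θ, x + (R * Real.sin θ) • z) * z k ∂(gam n) =
      (R * Real.sin θ) * ∫ z, G k (R * Real.cos θ, x + (R * Real.sin θ) • z) ∂(gam n) := by
      intro k
      have j : Continuous (fun y : EE n => ((R * Real.cos θ, y) : ℝ × EE n)) := by fun_prop
      obtain ⟨h2, C, hC⟩ := (hg k).comp j
      obtain ⟨h4, C', hC'⟩ := (hG k).comp j
      exact stein_shift (C := max C C') h2 h4 (fun z => hLD k _ z) (fun z => (hC z).trans (le_max_left _ _))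
        (fun z => (hC' z).trans (le_max_right _ _)) x (R * Real.sin θ)
    rw [integral_finsetSum _ fun k _ => isub (((hgc θ k).integrable_mul k).const_mul _) ((hXc θ k).integrable.const_mul _),
      integral_finsetSum _ fun k _ => isub (hGc θ k).integrable (hXc θ k).integrable, Finset.mul_sum]
    refine Finset.sum_congr rfl fun k _ => ?_
    rw [integral_sub (((hgc θ k).integrable_mul k).const_mul _) ((hXc θ k).integrable.const_mul _),
      integral_sub (hGc θ k).integrable (hXc θ k).integrable, integral_const_mul, integral_const_mul, e1]
    ring
  · exact Filter.Eventually.of_forall fun θ => (hχ.comp (hj θ)).1.aestronglyMeasurable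
  · exact (hχ.comp (hj θ)).integrable
  · refine Continuous.aestronglyMeasurable ?_
    refine continuous_finsetSum _ fun k _ => ?_
    exact (continuous_const.mul ((hgc θ k).1.mul (by fun_prop))).sub (continuous_const.mul (hXc θ k).1)
  · refine Filter.Eventually.of_forall fun z θ _ => ?_
    rw [Finset.sum_mul]
    refine (norm_sum_le _ _).trans (Finset.sum_le_sum fun k _ => ?_)
    rw [Real.norm_eq_abs]
    refine (abs_sub _ _).trans ?_
    have h1 : |R * Real.cos θ * (g k (R * Real.cos θ, x + (R * Real.sin θ) • z) * z k)| ≤ |R| * Cg k * (1 + ‖z‖) := by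
      rw [abs_mul, abs_mul, abs_mul]
      have a1 := Real.abs_cos_le_one θ
      have a2 := hCg k (R * Real.cos θ, x + (R * Real.sin θ) • z)
      have a3 : |z k| ≤ 1 + ‖z‖ := by linarith [norm_coord_le z k]
      have a4 := hCg0 k
      calc _ ≤ |R| * 1 * (Cg k * (1 + ‖z‖)) := by gcongr
        _ = _ := by ring
    have h2 : |R^2 * Real.sin θ * Real.cos θ * X k (R * Real.cos θ, x + (R * Real.sin θ) • z)| ≤ R^2 * CX k * (1 + ‖z‖) := by
      rw [abs_mul, abs_mul, abs_mul]
      have a1 := Real.abs_cos_le_one θ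
      have a0 := Real.abs_sin_le_one θ
      have a2 := hCX k (R * Real.cos θ, x + (R * Real.sin θ) • z)
      have a4 := hCX0 k
      rw [abs_of_nonneg (sq_nonneg R)]
      calc _ ≤ R^2 * 1 * 1 * CX k := by gcongr
        _ = R^2 * CX k * 1 := by ring
        _ ≤ R^2 * CX k * (1 + ‖z‖) := by gcongr; linarith [norm_nonneg z]
    linarith
  · exact (gam_lin n).const_mul _
  · exact Filter.Eventually.of_forall fun z θ _ => hcurve z θ

lemma KK_deriv {n : ℕ} {b : EE n → ℝ} (hb : B2 b) (c R : ℝ) (x : EE n) (θ : ℝ) :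
    HasDerivAt (KK b c R x) (R^2 * Real.sin θ * Real.cos θ * ∫ z, ∑ k, (Gk b c k (R * Real.cos θ) (x + (R * Real.sin θ) • z)
      - Xk b c k (R * Real.cos θ) (x + (R * Real.sin θ) • z)) ∂(gam n)) θ :=
  curve_deriv (χ := fun p => Ph (HH b p.1 p.2 - c) (ww b p.1 p.2)) (g := fun k p => gk b c k p.1 p.2)
    (G := fun k p => Gk b c k p.1 p.2) (X := fun k p => Xk b c k p.1 p.2)
    (BC.Ph ((HH_BC hb.1.2.1).sub (BC.const c)) (ww_BC hb.1.2.1)) (gk_BC hb c) (Gk_BC hb c) (Xk_BC hb c) R x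
    (fun k r y => gk_LD hb c k r y) (fun z θ => chi_curve hb c R x z θ) θ

lemma KK_mono {n : ℕ} {b : EE n → ℝ} (hb : B2 b) (hw : ∀ r y, ww b r y ≤ 1) (c R : ℝ) (x : EE n) :
    KK b c R x 0 ≤ KK b c R x (Real.pi / 2) := by
  have hp := Real.pi_pos
  have hm : MonotoneOn (KK b c R x) (Set.Icc 0 (Real.pi/2)) := by
    refine monotoneOn_of_deriv_nonneg (convex_Icc _ _) (fun θ _ => (KK_deriv hb c R x θ).continuousAt.continuousWithinAt)
      (fun θ _ => (KK_deriv hb c R x θ).differentiableAt.differentiableWithinAt) fun θ hθ => ?_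
    rw [interior_Icc] at hθ
    rw [(KK_deriv hb c R x θ).deriv]
    have h1 : 0 ≤ Real.sin θ := Real.sin_nonneg_of_nonneg_of_le_pi hθ.1.le (by linarith [hθ.2])
    have h2 : 0 ≤ Real.cos θ := Real.cos_nonneg_of_mem_Icc ⟨by linarith [hθ.1], hθ.2.le⟩
    have h3 : 0 ≤ ∫ z, ∑ k, (Gk b c k (R * Real.cos θ) (x + (R * Real.sin θ) • z)
      - Xk b c k (R * Real.cos θ) (x + (R * Real.sin θ) • z)) ∂(gam n) :=
      integral_nonneg fun z => Finset.sum_nonneg fun k _ => Gk_sub_Xk hb hw c k _ _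
    positivity
  exact hm ⟨le_rfl, by linarith⟩ ⟨by linarith, le_rfl⟩ (by linarith)

/-- heat oscillation bound -/
def PP {n : ℕ} (b : EE n → ℝ) (m : ℝ) : Prop := ∀ (s : ℝ) (x : EE n), ∫ z, |b (x + s • z) - HH b s x| ∂(gam n) ≤ m

lemma jn1 {n : ℕ} {b : EE n → ℝ} (hb : B2 b) (hw : ∀ r y, ww b r y ≤ 1) {m : ℝ} (hm : PP b m) (R : ℝ) (x : EE n) :
    ww b R x ≤ 20 * m := by
  have h := KK_mono hb hw (HH b R x) R x
  have h0 : KK b (HH b R x) R x 0 = 1 + (1/20) * (ww b R x + ww b R x ^2 / 2) := by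
    simp [KK, Ph, pp]
  have h1 : KK b (HH b R x) R x (Real.pi/2) ≤ 1 + m := by
    have e : KK b (HH b R x) R x (Real.pi/2) = ∫ z, Real.sqrt (1 + (b (x + R • z) - HH b R x)^2) ∂(gam n) := by
      simp [KK, HH_zero, Ph, ww, pow_two]
    have hbc : BC (fun z => b (x + R • z) - HH b R x) := BC.sub (BC.comp (f := b) hb.1.2.1 (by fun_prop)) (BC.const _)
    have habs : Integrable (fun z => |b (x + R • z) - HH b R x|) (gam n) := hbc.integrable.abs
    rw [e]
    calc _ ≤ ∫ z, (1 + |b (x + R • z) - HH b R x|) ∂(gam n) := by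
          refine integral_mono (BC.integrable (BC.comp_cont (φ := fun β => Real.sqrt (1 + β^2)) (by fun_prop) hbc))
            ((integrable_const 1).add habs) fun z => ?_
          refine Real.sqrt_le_iff.2 ⟨by positivity, ?_⟩
          nlinarith [sq_abs (b (x + R • z) - HH b R x), abs_nonneg (b (x + R • z) - HH b R x)]
      _ = 1 + ∫ z, |b (x + R • z) - HH b R x| ∂(gam n) := by
          rw [integral_add (integrable_const 1) habs]; simp
      _ ≤ _ := by linarith [hm R x]
  nlinarith [sq_nonneg (ww b R x)]

lemma HH_const_mul {n : ℕ} (b : EE n → ℝ) (c s : ℝ) (x : EE n) : HH (fun y => c * b y) s x = c * HH b s x := by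
  simp [HH, integral_const_mul]

lemma ww_const_mul {n : ℕ} (b : EE n → ℝ) (c s : ℝ) (x : EE n) : ww (fun y => c * b y) s x = c^2 * ww b s x := by
  unfold ww
  rw [HH_const_mul, show (fun y => c * b y * (c * b y)) = fun y => c^2 * (b y * b y) by ext y; ring, HH_const_mul]
  ring

lemma DD_const_mul {n : ℕ} {b : EE n → ℝ} (hb : ContDiff ℝ 1 b) (c : ℝ) (k : Fin n) : DD k (fun y => c * b y) = fun y => c * DD k b y := by
  ext x
  unfold DD
  rw [fderiv_const_mul (hb.differentiable (by norm_num)).differentiableAt]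
  simp

lemma B1.const_mul {n : ℕ} {b : EE n → ℝ} (hb : B1 b) (c : ℝ) : B1 (fun y => c * b y) := by
  refine ⟨contDiff_const.mul hb.1, BC.mul (BC.const c) hb.2.1, fun k => ?_⟩
  rw [DD_const_mul hb.1]
  exact BC.mul (BC.const c) (hb.2.2 k)

lemma B2.const_mul {n : ℕ} {b : EE n → ℝ} (hb : B2 b) (c : ℝ) : B2 (fun y => c * b y) := by
  refine ⟨hb.1.const_mul c, fun k => ?_⟩
  rw [DD_const_mul hb.1.1]
  exact (hb.2 k).const_mul c

lemma PP.const_mul {n : ℕ} {b : EE n → ℝ} {m : ℝ} (hb : PP b m) (c : ℝ) : PP (fun y => c * b y) (|c| * m) := by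
  intro s x
  simp only [HH_const_mul, ← mul_sub, abs_mul]
  rw [integral_const_mul]
  have := hb s x
  gcongr

lemma PP.nonneg {n : ℕ} {b : EE n → ℝ} {m : ℝ} (hb : PP b m) : 0 ≤ m :=
  (integral_nonneg fun z => abs_nonneg _).trans (hb 0 0)

lemma jn {n : ℕ} {b : EE n → ℝ} (hb : B2 b) {m : ℝ} (hm : PP b m) (R : ℝ) (x : EE n) :
    ww b R x ≤ 400 * m^2 := by
  obtain ⟨C, hC⟩ := (ww_BC hb.1.2.1).2
  have hbd : BddAbove (Set.range fun p : ℝ × EE n => ww b p.1 p.2) := ⟨C, by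
    rintro _ ⟨p, rfl⟩; exact (le_abs_self _).trans (hC p)⟩
  set W := ⨆ p : ℝ × EE n, ww b p.1 p.2 with hW
  have hle : ∀ r y, ww b r y ≤ W := fun r y => le_ciSup hbd (r, y)
  have hm0 := hm.nonneg
  by_cases hW0 : W ≤ 0
  · have := hle R x
    nlinarith
  push Not at hW0
  have hs : 0 < Real.sqrt W := Real.sqrt_pos.2 hW0
  have hsq : Real.sqrt W ^ 2 = W := Real.sq_sqrt hW0.le
  have hscale : ∀ r y, ww b r y ≤ 20 * m * Real.sqrt W := by
    intro r y
    have h := jn1 (hb.const_mul (Real.sqrt W)⁻¹) (fun r y => by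
      rw [ww_const_mul, inv_pow, hsq, inv_mul_le_iff₀ hW0]; simpa using hle r y) (hm.const_mul _) r y
    rw [ww_const_mul, inv_pow, hsq, abs_of_pos (inv_pos.2 hs), inv_mul_le_iff₀ hW0] at h
    have : W * (20 * ((Real.sqrt W)⁻¹ * m)) = 20 * m * Real.sqrt W := by
      nth_rewrite 1 [← hsq]
      field_simp
    linarith
  have hWle : W ≤ 20 * m * Real.sqrt W := ciSup_le fun p => hscale _ _
  have h2 : Real.sqrt W ≤ 20 * m := by
    by_contra hh
    push Not at hh
    nlinarith
  have := hle R x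
  nlinarith

end BmoAux

namespace BmoAux

/-- envelope -/
noncomputable def env {n : ℕ} (x : EE n) : ℝ := ((1 + ‖x‖)^(n+1))⁻¹

lemma env_pos {n : ℕ} (x : EE n) : 0 < env x := by unfold env; positivity
lemma env_integrable (n : ℕ) : Integrable (fun x : EE n => env x) := by
  have := integrable_one_add_norm (E := EE n) (μ := volume) (r := n + 1) (by simp)
  refine this.congr (Filter.Eventually.of_forall fun x => ?_)
  simp only [env]
  rw [Real.rpow_neg (by positivity)]
  congr 1
  exact_mod_cast Real.rpow_natCast _ (n+1)

/-- continuous, locally uniformly decaying -/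
def DC {n : ℕ} (F : ℝ × EE n → ℝ) : Prop :=
  Continuous F ∧ ∀ T : ℝ, ∃ C, 0 ≤ C ∧ ∀ s x, |s| ≤ T → |F (s, x)| ≤ C * env x

section
variable {n : ℕ} {f g : ℝ × EE n → ℝ}
lemma DC.mulr (hf : DC f) (hg : BC g) : DC (fun p => f p * g p) := by
  obtain ⟨hc, K, hK⟩ := hg
  refine ⟨hf.1.mul hc, fun T => ?_⟩
  obtain ⟨C, h0, hC⟩ := hf.2 T
  have hK0 : 0 ≤ K := (abs_nonneg _).trans (hK 0)
  refine ⟨C * K, by positivity, fun s x hs => ?_⟩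
  rw [abs_mul]
  calc _ ≤ (C * env x) * K := mul_le_mul (hC s x hs) (hK _) (abs_nonneg _) (mul_nonneg h0 (env_pos x).le)
    _ = _ := by ring
lemma DC.mull (hf : BC f) (hg : DC g) : DC (fun p => f p * g p) := by
  simpa only [mul_comm] using hg.mulr hf
lemma DC.add (hf : DC f) (hg : DC g) : DC (fun p => f p + g p) := by
  refine ⟨hf.1.add hg.1, fun T => ?_⟩
  obtain ⟨C, h0, hC⟩ := hf.2 T
  obtain ⟨C', h0', hC'⟩ := hg.2 T
  refine ⟨C + C', by positivity, fun s x hs => (abs_add_le _ _).trans ?_⟩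
  have := hC s x hs
  have := hC' s x hs
  linarith
lemma DC.neg (hf : DC f) : DC (fun p => - f p) := by
  simpa using DC.mull (BC.const (-1)) hf
lemma DC.sub (hf : DC f) (hg : DC g) : DC (fun p => f p - g p) := by
  simpa only [sub_eq_add_neg] using hf.add hg.neg
lemma DC.zero : DC (fun _ : ℝ × EE n => 0) := ⟨continuous_const, fun T => ⟨0, le_rfl, by simp⟩⟩
lemma DC.sum {ι : Type*} {F : ι → ℝ × EE n → ℝ} (s : Finset ι) (h : ∀ i, DC (F i)) :
    DC (fun p => ∑ i ∈ s, F i p) := by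
  classical
  induction s using Finset.induction_on with
  | empty => simpa using DC.zero
  | insert a s ha ih => simpa [Finset.sum_insert ha] using (h a).add ih
lemma DC.smul_fst (hf : DC f) : DC (fun p => p.1 * f p) := by
  refine ⟨continuous_fst.mul hf.1, fun T => ?_⟩
  obtain ⟨C, h0, hC⟩ := hf.2 T
  refine ⟨|T| * C, by positivity, fun s x hs => ?_⟩
  rw [abs_mul, mul_assoc]
  exact mul_le_mul (hs.trans (le_abs_self _)) (hC s x hs) (abs_nonneg _) (abs_nonneg _)
lemma DC.integrable (hf : DC f) (s : ℝ) : Integrable (fun x => f (s, x)) := by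
  obtain ⟨C, h0, hC⟩ := hf.2 |s|
  have hc := hf.1
  refine Integrable.mono' ((env_integrable n).const_mul C) (Continuous.aestronglyMeasurable (by fun_prop))
    (Filter.Eventually.of_forall fun x => hC s x le_rfl)

lemma DC.deriv {f' : ℝ × EE n → ℝ} (hf : DC f) (hf' : DC f')
    (h : ∀ s x, HasDerivAt (fun s => f (s, x)) (f' (s, x)) s) (s : ℝ) :
    HasDerivAt (fun s => ∫ x, f (s, x)) (∫ x, f' (s, x)) s := by
  obtain ⟨C, h0, hC⟩ := hf'.2 (|s| + 1)
  have key := hasDerivAt_integral_of_dominated_loc_of_deriv_le (μ := (volume : Measure (EE n))) (𝕜 := ℝ)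
    (F := fun s x => f (s, x)) (F' := fun s x => f' (s, x)) (x₀ := s) (s := ball s 1)
    (bound := fun x => C * env x) (ball_mem_nhds _ one_pos)
    (Filter.Eventually.of_forall fun s => (hf.integrable s).aestronglyMeasurable) (hf.integrable s)
    (hf'.integrable s).aestronglyMeasurable ?_ ((env_integrable n).const_mul C)
    (Filter.Eventually.of_forall fun x s _ => h s x)
  · exact key.2
  · refine Filter.Eventually.of_forall fun x t ht => hC t x ?_
    rw [mem_ball, Real.dist_eq] at ht
    have := abs_sub_abs_le_abs_sub t s
    linarith

lemma ibpP {k : Fin n} {f1 g1 : ℝ × EE n → ℝ} (s : ℝ)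
    (hf : ∀ x, LD k (fun x => f (s, x)) (f1 (s, x)) x) (hg : ∀ x, LD k (fun x => g (s, x)) (g1 (s, x)) x)
    (h1 : DC (fun p => f p * g1 p)) (h2 : DC (fun p => f1 p * g p)) (h3 : DC (fun p => f p * g p)) :
    ∫ x, f (s, x) * g1 (s, x) = - ∫ x, f1 (s, x) * g (s, x) :=
  ibp (k := k) (f := fun x => f (s, x)) (f' := fun x => f1 (s, x)) (g := fun x => g (s, x)) (g' := fun x => g1 (s, x))
    (h2.integrable s) (h1.integrable s) (h3.integrable s) hf hg
end

lemma peetre {n : ℕ} (x z : EE n) (s T : ℝ) (hs : |s| ≤ T) :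
    env (x + s • z) ≤ (1 + T)^(n+1) * (1 + ‖z‖)^(n+1) * env x := by
  have hT : 0 ≤ T := (abs_nonneg s).trans hs
  have h1 : 1 + ‖x‖ ≤ (1 + ‖x + s • z‖) * ((1 + T) * (1 + ‖z‖)) := by
    have h2 : ‖x‖ ≤ ‖x + s • z‖ + T * ‖z‖ := by
      have : x = (x + s • z) - s • z := by simp
      calc ‖x‖ = ‖(x + s • z) - s • z‖ := by rw [← this]
        _ ≤ ‖x + s • z‖ + ‖s • z‖ := norm_sub_le _ _
        _ ≤ _ := by rw [norm_smul]; gcongr; exact hs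
    have h3 := norm_nonneg (x + s • z)
    have h4 := norm_nonneg z
    have : 0 ≤ T * ‖z‖ := by positivity
    nlinarith [mul_nonneg h3 h4, mul_nonneg h3 hT, mul_nonneg h3 this]
  have h5 := pow_le_pow_left₀ (by positivity) h1 (n+1)
  rw [mul_pow, mul_pow] at h5
  unfold env
  rw [inv_le_iff_one_le_mul₀ (by positivity)]
  calc 1 = (1 + ‖x‖)^(n+1) * ((1 + ‖x‖)^(n+1))⁻¹ := (mul_inv_cancel₀ (by positivity)).symm
    _ ≤ ((1 + ‖x + s • z‖) ^ (n + 1) * ((1 + T) ^ (n + 1) * (1 + ‖z‖) ^ (n + 1))) * ((1 + ‖x‖)^(n+1))⁻¹ := by gcongr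
    _ = _ := by ring

lemma HH_DC {n : ℕ} {f : EE n → ℝ} (hf : Continuous f) (hs : HasCompactSupport f) : DC (fun p : ℝ × EE n => HH f p.1 p.2) := by
  have hb : B0 f := ⟨hf, (hf.bounded_above_of_compact_support hs)⟩
  refine ⟨HH_cont hb, fun T => ?_⟩
  obtain ⟨C, hC⟩ := (hf.mul (by fun_prop : Continuous fun x : EE n => (1 + ‖x‖)^(n+1))).bounded_above_of_compact_support hs.mul_right
  have hC0 : 0 ≤ C := (norm_nonneg _).trans (hC 0)
  have hfe : ∀ x, |f x| ≤ C * env x := by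
    intro x
    have := hC x
    rw [Pi.mul_apply, norm_mul, Real.norm_eq_abs, Real.norm_of_nonneg (by positivity)] at this
    unfold env
    rw [← div_eq_mul_inv, le_div_iff₀ (by positivity)]
    exact this
  refine ⟨C * ((1 + |T|)^(n+1) * ∫ z, (1 + ‖z‖)^(n+1) ∂(gam n)), by positivity, fun s x hs => ?_⟩
  have hs' : |s| ≤ |T| := hs.trans (le_abs_self _)
  have hb1 : ∀ z, ‖f (x + s • z)‖ ≤ C * ((1 + |T|)^(n+1) * env x) * (1 + ‖z‖)^(n+1) := by
    intro z
    refine (hfe _).trans ?_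
    have := peetre x z s |T| hs'
    calc _ ≤ C * ((1 + |T|)^(n+1) * (1 + ‖z‖)^(n+1) * env x) := by gcongr
      _ = _ := by ring
  refine (norm_integral_le_of_norm_le ((gam_moment n (n+1)).const_mul _) (Filter.Eventually.of_forall hb1)).trans ?_
  rw [integral_const_mul]
  apply le_of_eq
  ring

/-- smooth with compact support -/
def Sm {n : ℕ} (f : EE n → ℝ) : Prop := ContDiff ℝ (⊤ : ℕ∞) f ∧ HasCompactSupport f

lemma Sm.DD {n : ℕ} {f : EE n → ℝ} (hf : Sm f) (k : Fin n) : Sm (DD k f) := by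
  refine ⟨?_, ?_⟩
  · have := hf.1.fderiv_right (m := (⊤ : ℕ∞)) (by norm_num)
    exact this.clm_apply contDiff_const
  · exact hf.2.fderiv_apply ℝ (ee k)

lemma Sm.B0 {n : ℕ} {f : EE n → ℝ} (hf : Sm f) : B0 f := ⟨hf.1.continuous, hf.1.continuous.bounded_above_of_compact_support hf.2⟩
lemma Sm.B1 {n : ℕ} {f : EE n → ℝ} (hf : Sm f) : B1 f :=
  ⟨hf.1.of_le (by norm_num), hf.B0, fun k => (hf.DD k).B0⟩
lemma Sm.B2 {n : ℕ} {f : EE n → ℝ} (hf : Sm f) : B2 f := ⟨hf.B1, fun k => (hf.DD k).B1⟩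

lemma DD_comm {n : ℕ} {f : EE n → ℝ} (hf : Sm f) (i j : Fin n) : DD i (DD j f) = DD j (DD i f) := by
  ext x
  have h2 : ContDiff ℝ 2 f := hf.1.of_le (by norm_cast)
  have hd : DifferentiableAt ℝ (fderiv ℝ f) x :=
    ((h2.fderiv_right (m := 1) (by norm_num)).differentiable (by norm_num)).differentiableAt
  have h3 : ∀ v w, fderiv ℝ (fun y => fderiv ℝ f y v) x w = fderiv ℝ (fderiv ℝ f) x w v := by
    intro v w
    rw [fderiv_clm_apply hd (differentiableAt_const v)]
    simp
  have hsymm := h2.contDiffAt (x := x) |>.isSymmSndFDerivAt (by simp)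
  change fderiv ℝ (fun y => fderiv ℝ f y (ee j)) x (ee i) = fderiv ℝ (fun y => fderiv ℝ f y (ee i)) x (ee j)
  rw [h3, h3]
  exact hsymm _ _

/-- heat flow -/
structure HF {n : ℕ} (G : ℝ × EE n → ℝ) (G1 G2 : Fin n → ℝ × EE n → ℝ) : Prop where
  b0 : BC G
  b1 : ∀ k, BC (G1 k)
  b2 : ∀ k, BC (G2 k)
  l1 : ∀ k s x, LD k (fun x => G (s, x)) (G1 k (s, x)) x
  l2 : ∀ k s x, LD k (fun x => G1 k (s, x)) (G2 k (s, x)) x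
  ds : ∀ s x, HasDerivAt (fun s => G (s, x)) (s * ∑ k, G2 k (s, x)) s

/-- decaying heat flow -/
structure HFD {n : ℕ} (G : ℝ × EE n → ℝ) (G1 G2 : Fin n → ℝ × EE n → ℝ) : Prop extends HF G G1 G2 where
  d0 : DC G
  d1 : ∀ k, DC (G1 k)
  d2 : ∀ k, DC (G2 k)

/-- heat extension on pairs -/
noncomputable def Hp {n : ℕ} (f : EE n → ℝ) : ℝ × EE n → ℝ := fun p => HH f p.1 p.2

lemma HF_of {n : ℕ} {f : EE n → ℝ} (hf : B2 f) : HF (Hp f) (fun k => Hp (DD k f)) (fun k => Hp (DD k (DD k f))) where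
  b0 := HH_BC hf.1.2.1
  b1 k := HH_BC (hf.1.2.2 k)
  b2 k := HH_BC ((hf.2 k).2.2 k)
  l1 k s x := HH_LD hf.1 k s x
  l2 k s x := HH_LD (hf.2 k) k s x
  ds s x := HH_ds hf s x

lemma Sm.dc {n : ℕ} {f : EE n → ℝ} (hf : Sm f) : DC (Hp f) := HH_DC hf.1.continuous hf.2

lemma HFD_of {n : ℕ} {f : EE n → ℝ} (hf : Sm f) : HFD (Hp f) (fun k => Hp (DD k f)) (fun k => Hp (DD k (DD k f))) where
  toHF := HF_of hf.B2
  d0 := hf.dc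
  d1 k := (hf.DD k).dc
  d2 k := ((hf.DD k).DD k).dc

end BmoAux

namespace BmoAux

lemma energy_abs {n : ℕ} {G : ℝ × EE n → ℝ} {G1 G2 : Fin n → ℝ × EE n → ℝ} (hG : HFD G G1 G2)
    {v : ℝ × EE n → ℝ} {w1 w2 c : Fin n → ℝ × EE n → ℝ} (hv : BC v) (hw1 : ∀ k, BC (w1 k)) (hw2 : ∀ k, BC (w2 k))
    (hc : ∀ k, BC (c k)) (hvl : ∀ k s x, LD k (fun x => v (s, x)) (-(v (s, x) ^ 2 * w1 k (s, x))) x)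
    (hwl : ∀ k s x, LD k (fun x => w1 k (s, x)) (w2 k (s, x)) x)
    (hvs : ∀ s x, HasDerivAt (fun s => v (s, x)) (-(v (s, x)^2 * (s * ∑ k, (w2 k (s, x) + 2 * c k (s, x)^2)))) s)
    (hv0 : ∀ p, 1/2 ≤ v p) (s : ℝ) :
    ∃ e, HasDerivAt (fun s => ∫ x, G (s, x)^2 * (1 + v (s, x))) e s ∧
      (0 ≤ s → e ≤ - (s * ∑ k, ∫ x, (2 * G1 k (s, x)^2 + 1/2 * c k (s, x)^2 * G (s, x)^2))) := by
  have hd0 := hG.d0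
  have hb0 := hG.b0
  have d1v : BC (fun p => 1 + v p) := (BC.const 1).add hv
  have d2 : DC (fun p => G p ^ 2) := by simpa only [pow_two] using hd0.mulr hb0
  have dF : DC (fun p => G p ^ 2 * (1 + v p)) := d2.mulr d1v
  have dα : DC (fun p => 2 * G p * (1 + v p)) := (DC.mull (BC.const 2) hd0).mulr d1v
  have dβ : DC (fun p => -(G p ^ 2 * v p ^ 2)) := (d2.mulr (hv.pow 2)).neg
  have t1 : ∀ k, DC (fun p => (2 * G p * (1 + v p)) * G2 k p) := fun k => dα.mulr (hG.b2 k)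
  have t2 : ∀ k, DC (fun p => -(G p ^ 2 * v p ^ 2) * w2 k p) := fun k => dβ.mulr (hw2 k)
  have t3 : ∀ k, DC (fun p => -(G p ^ 2 * v p ^ 2) * (2 * c k p ^ 2)) := fun k => dβ.mulr ((BC.const 2).mul ((hc k).pow 2))
  have dα1 : ∀ k, DC (fun p => 2 * G1 k p * (1 + v p) + 2 * G p * (-(v p ^ 2 * w1 k p))) := fun k =>
    ((DC.mull (BC.const 2) (hG.d1 k)).mulr d1v).add ((DC.mull (BC.const 2) hd0).mulr (((hv.pow 2).mul (hw1 k)).neg))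
  have dβ1 : ∀ k, DC (fun p => -(2 * G p * G1 k p * v p ^ 2 + G p ^ 2 * (2 * v p * (-(v p ^ 2 * w1 k p))))) := fun k =>
    ((((DC.mull (BC.const 2) hd0).mulr (hG.b1 k)).mulr (hv.pow 2)).add
      (d2.mulr (((BC.const 2).mul hv).mul (((hv.pow 2).mul (hw1 k)).neg)))).neg
  have dF' : DC (fun p => p.1 * ∑ k, ((2 * G p * (1 + v p)) * G2 k p + -(G p ^ 2 * v p ^ 2) * w2 k p + -(G p ^ 2 * v p ^ 2) * (2 * c k p ^ 2))) :=
    (DC.sum _ fun k => ((t1 k).add (t2 k)).add (t3 k)).smul_fst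
  have hderiv := DC.deriv dF dF' (fun s x => by
    have h1 := ((hG.ds s x).pow 2).mul ((hvs s x).const_add 1)
    refine hd_congr h1 (fun t => rfl) ?_
    simp only [Finset.mul_sum, Pi.pow_apply, ← Finset.sum_neg_distrib, Finset.sum_mul, ← Finset.sum_add_distrib]
    refine Finset.sum_congr rfl fun k _ => ?_
    push_cast
    ring) s
  refine ⟨_, hderiv, fun hs => ?_⟩
  rw [integral_const_mul, integral_finsetSum _ fun k _ => (((t1 k).add (t2 k)).add (t3 k)).integrable s, ← mul_neg,
    ← Finset.sum_neg_distrib]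
  refine mul_le_mul_of_nonneg_left (Finset.sum_le_sum fun k _ => ?_) hs
  have e1 := ibpP (k := k) s (f := fun p => 2 * G p * (1 + v p)) (g := G1 k)
    (f1 := fun p => 2 * G1 k p * (1 + v p) + 2 * G p * (-(v p ^ 2 * w1 k p))) (g1 := G2 k) (fun x => by
      refine hd_congr (((hG.l1 k s x).const_mul 2).mul ((hvl k s x).const_add 1)) (fun t => rfl) ?_
      simp) (fun x => hG.l2 k s x) (t1 k) ((dα1 k).mulr (hG.b1 k)) (dα.mulr (hG.b1 k))
  have e2 := ibpP (k := k) s (f := fun p => -(G p ^ 2 * v p ^ 2)) (g := w1 k)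
    (f1 := fun p => -(2 * G p * G1 k p * v p ^ 2 + G p ^ 2 * (2 * v p * (-(v p ^ 2 * w1 k p))))) (g1 := w2 k) (fun x => by
      refine hd_congr ((((hG.l1 k s x).pow 2).mul ((hvl k s x).pow 2)).neg) (fun t => rfl) ?_
      simp) (fun x => hwl k s x) (t2 k) ((dβ1 k).mulr (hw1 k)) (dβ.mulr (hw1 k))
  have i12 := ((t1 k).add (t2 k)).integrable s
  rw [integral_add i12 ((t3 k).integrable s), integral_add ((t1 k).integrable s) ((t2 k).integrable s), e1, e2,
    ← neg_add, ← integral_add (((dα1 k).mulr (hG.b1 k)).integrable s) (((dβ1 k).mulr (hw1 k)).integrable s)]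
  rw [← integral_neg, ← integral_neg, ← integral_add]
  · refine integral_mono ?_ ?_ fun x => ?_
    · exact ((((dα1 k).mulr (hG.b1 k)).add ((dβ1 k).mulr (hw1 k))).neg.add (t3 k)).integrable s
    · have dq : DC (fun p => -(2 * G1 k p ^ 2 + 1/2 * c k p ^ 2 * G p ^ 2)) :=
        ((DC.mull (BC.const 2) (by simpa only [pow_two] using (hG.d1 k).mulr (hG.b1 k))).add
          (DC.mull ((BC.const (1/2)).mul ((hc k).pow 2)) d2)).neg
      exact dq.integrable s
    · have hvx := hv0 (s, x)
      have h1 : 0 ≤ v (s, x) * (G1 k (s, x) - G (s, x) * v (s, x) * w1 k (s, x))^2 := by positivity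
      have h2 : 1/4 ≤ v (s, x)^2 := by nlinarith
      have h3 : 0 ≤ (v (s, x)^2 - 1/4) * (c k (s, x) ^ 2 * G (s, x) ^ 2) := mul_nonneg (by linarith) (by positivity)
      simp only
      nlinarith
  · exact (((dα1 k).mulr (hG.b1 k)).add ((dβ1 k).mulr (hw1 k))).neg.integrable s
  · exact (t3 k).integrable s

lemma energy {n : ℕ} {f b : EE n → ℝ} (hf : Sm f) (hb : B2 b) (hw : ∀ r y, ww b r y ≤ 1) (s : ℝ) :
    ∃ e, HasDerivAt (fun s => ∫ x, Hp f (s, x)^2 * (1 + (1 + ww b s x)⁻¹)) e s ∧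
      (0 ≤ s → e ≤ - (s * ∑ k, ∫ x, (2 * Hp (DD k f) (s, x)^2 + 1/2 * Hp (DD k b) (s, x)^2 * Hp f (s, x)^2))) := by
  have hw0 := fun r y => ww_nonneg hb.1.2.1 r y
  have hwb := ww_BC hb.1.2.1
  have hq := hb.mul hb
  refine energy_abs (HFD_of hf) (v := fun p => (1 + ww b p.1 p.2)⁻¹) (w1 := fun k p => wd b k p.1 p.2)
    (w2 := fun k p => HH (DD k (DD k (fun x => b x * b x))) p.1 p.2
     - (2 * HH (DD k b) p.1 p.2 * HH (DD k b) p.1 p.2 + 2 * HH b p.1 p.2 * HH (DD k (DD k b)) p.1 p.2))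
    (c := fun k => Hp (DD k b)) ?_ (wd_BC hb.1) (fun k => ?_) (fun k => HH_BC (hb.1.2.2 k)) ?_ ?_ ?_ ?_ s
  · have hne : ∀ p : ℝ × EE n, 1 + ww b p.1 p.2 ≠ 0 := fun p => by have := hw0 p.1 p.2; exact ne_of_gt (by linarith)
    refine ⟨(continuous_const.add hwb.1).inv₀ hne, 1, fun p => ?_⟩
    have := hw0 p.1 p.2
    rw [abs_of_nonneg (by positivity)]
    exact inv_le_one_of_one_le₀ (by linarith)
  · exact (HH_BC ((hq.2 k).2.2 k)).sub ((((BC.const 2).mul (HH_BC (hb.1.2.2 k))).mul (HH_BC (hb.1.2.2 k))).add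
      (((BC.const 2).mul (HH_BC hb.1.2.1)).mul (HH_BC ((hb.2 k).2.2 k))))
  · intro k s x
    have h := ((ww_LD hb.1 k s x).const_add 1).inv (by have := hw0 s x; simp; positivity)
    refine hd_congr h (fun t => rfl) ?_
    simp
    ring
  · intro k s x
    refine hd_congr ((HH_LD (hq.2 k) k s x).sub (((HH_LD hb.1 k s x).const_mul 2).mul (HH_LD (hb.2 k) k s x))) (fun t => rfl) ?_
    simp
  · intro s x
    have h := (((HH_ds hq s x).sub ((HH_ds hb s x).pow 2)).const_add 1).inv (by
      have := hw0 s x; unfold ww at this; simp; positivity)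
    refine hd_congr h (fun t => rfl) ?_
    simp only [Pi.sub_apply, Pi.pow_apply]
    have e : (1 + ww b s x) = (1 + (HH (fun x => b x * b x) s x - HH b s x ^ 2)) := rfl
    rw [e]
    rw [inv_pow, neg_div, div_eq_mul_inv, mul_comm]
    congr 2
    simp only [Hp, Finset.mul_sum, ← Finset.sum_sub_distrib]
    refine Finset.sum_congr rfl fun k _ => ?_
    push_cast
    ring
  · intro p
    have h0 := hw0 p.1 p.2
    have h1 := hw p.1 p.2
    rw [one_div]
    gcongr
    linarith

lemma tri {n : ℕ} {B G K : ℝ × EE n → ℝ} {B1 B2' G1 G2 K1 K2 : Fin n → ℝ × EE n → ℝ} (hB : HF B B1 B2')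
    (hG : HFD G G1 G2) (hK : HFD K K1 K2) (s : ℝ) :
    HasDerivAt (fun s => ∫ x, B (s, x) * G (s, x) * K (s, x))
      (- (2 * s * ∑ k, ∫ x, (B1 k (s, x) * G1 k (s, x) * K (s, x) + B1 k (s, x) * G (s, x) * K1 k (s, x)
        + B (s, x) * G1 k (s, x) * K1 k (s, x)))) s := by
  have t0 : DC (fun p => B p * G p * K p) := (DC.mull hB.b0 hG.d0).mulr hK.b0
  have t1 : ∀ k, DC (fun p => (G p * K p) * B2' k p) := fun k => (hG.d0.mulr hK.b0).mulr (hB.b2 k)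
  have t2 : ∀ k, DC (fun p => (B p * K p) * G2 k p) := fun k => DC.mull (hB.b0.mul hK.b0) (hG.d2 k)
  have t3 : ∀ k, DC (fun p => (B p * G p) * K2 k p) := fun k => DC.mull (hB.b0.mul hG.b0) (hK.d2 k)
  have hderiv := DC.deriv t0 (f' := fun p => p.1 * ∑ k, ((G p * K p) * B2' k p + (B p * K p) * G2 k p + (B p * G p) * K2 k p))
    (DC.sum _ fun k => ((t1 k).add (t2 k)).add (t3 k)).smul_fst (fun s x => by
    refine hd_congr (((hB.ds s x).mul (hG.ds s x)).mul (hK.ds s x)) (fun t => rfl) ?_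
    simp only [Finset.mul_sum, Pi.mul_apply, Finset.sum_mul, ← Finset.sum_add_distrib]
    refine Finset.sum_congr rfl fun k _ => ?_
    ring) s
  refine hd_congr hderiv (fun t => rfl) ?_
  rw [integral_const_mul, integral_finsetSum _ fun k _ => (((t1 k).add (t2 k)).add (t3 k)).integrable s,
    show ∀ z, -(2 * s * z) = s * (-2 * z) by intro z; ring, Finset.mul_sum _ _ (-2)]
  congr 1
  refine Finset.sum_congr rfl fun k _ => ?_
  have u1 : DC (fun p => B1 k p * G1 k p * K p) := DC.mull ((hB.b1 k).mul (hG.b1 k)) hK.d0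
  have u2 : DC (fun p => B1 k p * G p * K1 k p) := DC.mull ((hB.b1 k).mul hG.b0) (hK.d1 k)
  have u3 : DC (fun p => B p * G1 k p * K1 k p) := DC.mull (hB.b0.mul (hG.b1 k)) (hK.d1 k)
  have gk : DC (fun p => G1 k p * K p + G p * K1 k p) := ((hG.d1 k).mulr hK.b0).add (hG.d0.mulr (hK.b1 k))
  have bk : DC (fun p => B1 k p * K p + B p * K1 k p) := (DC.mull (hB.b1 k) hK.d0).add (DC.mull hB.b0 (hK.d1 k))
  have bg : DC (fun p => B1 k p * G p + B p * G1 k p) := (DC.mull (hB.b1 k) hG.d0).add (DC.mull hB.b0 (hG.d1 k))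
  have e1 := ibpP (k := k) s (f := fun p => G p * K p) (g := B1 k)
    (f1 := fun p => G1 k p * K p + G p * K1 k p) (g1 := B2' k) (fun x => by
      refine hd_congr ((hG.l1 k s x).mul (hK.l1 k s x)) (fun t => rfl) ?_
      simp) (fun x => hB.l2 k s x) (t1 k) (gk.mulr (hB.b1 k)) ((hG.d0.mulr hK.b0).mulr (hB.b1 k))
  have e2 := ibpP (k := k) s (f := fun p => B p * K p) (g := G1 k)
    (f1 := fun p => B1 k p * K p + B p * K1 k p) (g1 := G2 k) (fun x => by
      refine hd_congr ((hB.l1 k s x).mul (hK.l1 k s x)) (fun t => rfl) ?_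
      simp) (fun x => hG.l2 k s x) (t2 k) (bk.mulr (hG.b1 k)) ((DC.mull hB.b0 hK.d0).mulr (hG.b1 k))
  have e3 := ibpP (k := k) s (f := fun p => B p * G p) (g := K1 k)
    (f1 := fun p => B1 k p * G p + B p * G1 k p) (g1 := K2 k) (fun x => by
      refine hd_congr ((hB.l1 k s x).mul (hG.l1 k s x)) (fun t => rfl) ?_
      simp) (fun x => hK.l2 k s x) (t3 k) (bg.mulr (hK.b1 k)) ((DC.mull hB.b0 hG.d0).mulr (hK.b1 k))
  have i12 := ((t1 k).add (t2 k)).integrable s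
  rw [integral_add i12 ((t3 k).integrable s), integral_add ((t1 k).integrable s) ((t2 k).integrable s), e1, e2, e3]
  have i := (gk.mulr (hB.b1 k)).integrable s
  have j := (bk.mulr (hG.b1 k)).integrable s
  have l := (bg.mulr (hK.b1 k)).integrable s
  rw [← neg_add, ← integral_add i j, ← neg_add, ← integral_add (iadd i j) l, ← integral_const_mul, ← integral_neg]
  congr 1
  ext x
  ring

end BmoAux

namespace BmoAux

lemma null_form {n : ℕ} {u ψ b : EE n → ℝ} (hu : Sm u) (hψ : Sm ψ) (hb : B2 b) (i j k : Fin n) (s : ℝ) :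
    (∫ x, Hp b (s, x) * Hp (DD k (DD j u)) (s, x) * Hp (DD k (DD i ψ)) (s, x)) -
    (∫ x, Hp b (s, x) * Hp (DD k (DD i u)) (s, x) * Hp (DD k (DD j ψ)) (s, x)) =
    - ∫ x, (Hp (DD k u) (s, x) * Hp (DD j b) (s, x) * Hp (DD k (DD i ψ)) (s, x)
      - Hp (DD k u) (s, x) * Hp (DD i b) (s, x) * Hp (DD k (DD j ψ)) (s, x)) := by
  have bB : BC (Hp b) := HH_BC hb.1.2.1
  have bB1 : ∀ j, BC (Hp (DD j b)) := fun j => HH_BC (hb.1.2.2 j)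
  have dS : ∀ {f : EE n → ℝ}, Sm f → DC (Hp f) := fun hf => hf.dc
  have bS : ∀ {f : EE n → ℝ}, Sm f → BC (Hp f) := fun hf => HH_BC hf.B0
  have key : ∀ i j, ∫ x, Hp b (s, x) * Hp (DD k (DD j u)) (s, x) * Hp (DD k (DD i ψ)) (s, x) =
      - ∫ x, (Hp (DD j b) (s, x) * Hp (DD k (DD i ψ)) (s, x) + Hp b (s, x) * Hp (DD j (DD k (DD i ψ))) (s, x)) * Hp (DD k u) (s, x) := by
    intro i j
    have hψ' := (hψ.DD i).DD k
    have h := ibpP (k := j) s (f := fun p => Hp b p * Hp (DD k (DD i ψ)) p) (g := Hp (DD k u))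
      (f1 := fun p => Hp (DD j b) p * Hp (DD k (DD i ψ)) p + Hp b p * Hp (DD j (DD k (DD i ψ))) p)
      (g1 := Hp (DD j (DD k u))) (fun x => by
        refine hd_congr ((HH_LD hb.1 j s x).mul (HH_LD hψ'.B1 j s x)) (fun t => rfl) ?_
        simp [Hp]) (fun x => HH_LD (hu.DD k).B1 j s x)
        (DC.mull (bB.mul (bS hψ')) (dS ((hu.DD k).DD j)))
        (DC.mull (((bB1 j).mul (bS hψ')).add (bB.mul (bS (hψ'.DD j)))) (dS (hu.DD k)))
        (DC.mull (bB.mul (bS hψ')) (dS (hu.DD k)))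
    rw [← h]
    congr 1
    ext x
    rw [DD_comm hu j k]
    ring
  rw [key i j, key j i, sub_neg_eq_add, neg_add_eq_sub]
  have hsm : DD i (DD k (DD j ψ)) = DD j (DD k (DD i ψ)) := by
    rw [DD_comm (hψ.DD j) i k, DD_comm (hψ.DD i) j k, DD_comm hψ i j]
  rw [hsm]
  have I : ∀ i j, DC (fun p => (Hp (DD j b) p * Hp (DD k (DD i ψ)) p + Hp b p * Hp (DD j (DD k (DD i ψ))) p) * Hp (DD k u) p) :=
    fun i j => DC.mull (((bB1 j).mul (bS ((hψ.DD i).DD k))).add (bB.mul (bS (((hψ.DD i).DD k).DD j)))) (dS (hu.DD k))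
  have I2 := I j i
  rw [hsm] at I2
  rw [← integral_sub (I2.integrable s) ((I i j).integrable s), ← integral_neg]
  congr 1
  ext x
  ring

/-- the bilinear flow functional -/
noncomputable def QQ {n : ℕ} (b u ψ : EE n → ℝ) (i j : Fin n) (s : ℝ) : ℝ :=
  (∫ x, Hp b (s, x) * Hp (DD j u) (s, x) * Hp (DD i ψ) (s, x)) - ∫ x, Hp b (s, x) * Hp (DD i u) (s, x) * Hp (DD j ψ) (s, x)

/-- energy density -/
noncomputable def zd {n : ℕ} (b u : EE n → ℝ) (d k : Fin n) (p : ℝ × EE n) : ℝ :=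
  2 * Hp (DD k (DD d u)) p ^2 + 1/2 * Hp (DD k b) p ^2 * Hp (DD d u) p ^2

lemma zd_DC {n : ℕ} {b u : EE n → ℝ} (hu : Sm u) (hb : B2 b) (d k : Fin n) : DC (zd b u d k) := by
  have h : ∀ {f : EE n → ℝ}, Sm f → DC (fun p => Hp f p ^ 2) := fun {f} hf => by
    have h1 : BC (Hp f) := HH_BC hf.B0
    simpa only [pow_two] using hf.dc.mulr h1
  exact (DC.mull (BC.const 2) (h ((hu.DD d).DD k))).add
    (DC.mull ((BC.const (1/2)).mul ((HH_BC (hb.1.2.2 k)).pow 2)) (h (hu.DD d)))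

lemma zd_nonneg {n : ℕ} (b u : EE n → ℝ) (d k : Fin n) (p : ℝ × EE n) : 0 ≤ zd b u d k p := by
  unfold zd; positivity

lemma zd_le {n : ℕ} (b u : EE n → ℝ) (d k : Fin n) (p : ℝ × EE n) : zd b u d k p ≤ ∑ d, ∑ k, zd b u d k p :=
  (Finset.single_le_sum (f := fun k => zd b u d k p) (fun k _ => zd_nonneg b u d k p) (Finset.mem_univ k)).trans
    (Finset.single_le_sum (f := fun d => ∑ k, zd b u d k p) (fun d _ => Finset.sum_nonneg fun k _ => zd_nonneg b u d k p) (Finset.mem_univ d))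

lemma am1 (a b c : ℝ) : |a * b * c| ≤ 1/2 * (2 * b^2 + 1/2 * a^2 * c^2) := by
  rw [abs_le]; constructor <;> nlinarith [sq_nonneg (2 * b - a * c), sq_nonneg (2 * b + a * c)]

lemma QQ_deriv {n : ℕ} {u ψ b : EE n → ℝ} (hu : Sm u) (hψ : Sm ψ) (hb : B2 b) (i j : Fin n) (s : ℝ) :
    ∃ e, HasDerivAt (QQ b u ψ i j) e s ∧ (0 ≤ s → e ≤ 6 * n * (s * ((∑ d, ∑ k, ∫ x, zd b u d k (s, x)) + ∑ d, ∑ k, ∫ x, zd b ψ d k (s, x)))) := by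
  have h1 := tri (HF_of hb) (HFD_of (hu.DD j)) (HFD_of (hψ.DD i)) s
  have h2 := tri (HF_of hb) (HFD_of (hu.DD i)) (HFD_of (hψ.DD j)) s
  refine ⟨_, h1.sub h2, fun hs => ?_⟩
  have bB : BC (Hp b) := HH_BC hb.1.2.1
  have bB1 : ∀ j, BC (Hp (DD j b)) := fun j => HH_BC (hb.1.2.2 j)
  have dS : ∀ {f : EE n → ℝ}, Sm f → DC (Hp f) := fun hf => hf.dc
  have bS : ∀ {f : EE n → ℝ}, Sm f → BC (Hp f) := fun hf => HH_BC hf.B0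
  have dU : ∀ d, DC (Hp (DD d u)) := fun d => dS (hu.DD d)
  have dV : ∀ d, DC (Hp (DD d ψ)) := fun d => dS (hψ.DD d)
  have bU : ∀ d, BC (Hp (DD d u)) := fun d => bS (hu.DD d)
  have bU2 : ∀ k d, BC (Hp (DD k (DD d u))) := fun k d => bS ((hu.DD d).DD k)
  have dV2 : ∀ k d, DC (Hp (DD k (DD d ψ))) := fun k d => dS ((hψ.DD d).DD k)
  have a1 : ∀ i j k, DC (fun p => Hp (DD k b) p * Hp (DD k (DD j u)) p * Hp (DD i ψ) p) := fun i j k =>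
    DC.mull ((bB1 k).mul (bU2 k j)) (dV i)
  have a2 : ∀ i j k, DC (fun p => Hp (DD k b) p * Hp (DD j u) p * Hp (DD k (DD i ψ)) p) := fun i j k =>
    DC.mull ((bB1 k).mul (bU j)) (dV2 k i)
  have a3 : ∀ i j k, DC (fun p => Hp b p * Hp (DD k (DD j u)) p * Hp (DD k (DD i ψ)) p) := fun i j k =>
    DC.mull (bB.mul (bU2 k j)) (dV2 k i)
  have a4 : ∀ i j k, DC (fun p => Hp (DD k u) p * Hp (DD j b) p * Hp (DD k (DD i ψ)) p) := fun i j k =>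
    DC.mull ((bU k).mul (bB1 j)) (dV2 k i)
  let Z : ℝ × EE n → ℝ := fun p => (∑ d, ∑ k, zd b u d k p) + ∑ d, ∑ k, zd b ψ d k p
  have dZ1 : DC (fun p => ∑ d, ∑ k, zd b u d k p) := DC.sum _ fun d => DC.sum _ fun k => zd_DC hu hb d k
  have dZ2 : DC (fun p => ∑ d, ∑ k, zd b ψ d k p) := DC.sum _ fun d => DC.sum _ fun k => zd_DC hψ hb d k
  have hZ : (∑ d, ∑ k, ∫ x, zd b u d k (s, x)) + ∑ d, ∑ k, ∫ x, zd b ψ d k (s, x) = ∫ x, Z (s, x) := by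
    rw [integral_add (dZ1.integrable s) (dZ2.integrable s)]
    congr 1
    · rw [integral_finsetSum _ fun d _ => (DC.sum _ fun k => zd_DC hu hb d k).integrable s]
      exact Finset.sum_congr rfl fun d _ => (integral_finsetSum _ fun k _ => (zd_DC hu hb d k).integrable s).symm
    · rw [integral_finsetSum _ fun d _ => (DC.sum _ fun k => zd_DC hψ hb d k).integrable s]
      exact Finset.sum_congr rfl fun d _ => (integral_finsetSum _ fun k _ => (zd_DC hψ hb d k).integrable s).symm
  rw [hZ]
  have hk : ∀ k, (∫ x, (Hp (DD k b) (s, x) * Hp (DD k (DD i u)) (s, x) * Hp (DD j ψ) (s, x) +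
        Hp (DD k b) (s, x) * Hp (DD i u) (s, x) * Hp (DD k (DD j ψ)) (s, x) +
        Hp b (s, x) * Hp (DD k (DD i u)) (s, x) * Hp (DD k (DD j ψ)) (s, x)))
      - (∫ x, (Hp (DD k b) (s, x) * Hp (DD k (DD j u)) (s, x) * Hp (DD i ψ) (s, x) +
        Hp (DD k b) (s, x) * Hp (DD j u) (s, x) * Hp (DD k (DD i ψ)) (s, x) +
        Hp b (s, x) * Hp (DD k (DD j u)) (s, x) * Hp (DD k (DD i ψ)) (s, x))) ≤ 3 * ∫ x, Z (s, x) := by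
    intro k
    have split : ∀ i j, ∫ x, (Hp (DD k b) (s, x) * Hp (DD k (DD i u)) (s, x) * Hp (DD j ψ) (s, x) +
        Hp (DD k b) (s, x) * Hp (DD i u) (s, x) * Hp (DD k (DD j ψ)) (s, x) +
        Hp b (s, x) * Hp (DD k (DD i u)) (s, x) * Hp (DD k (DD j ψ)) (s, x)) =
        (∫ x, (Hp (DD k b) (s, x) * Hp (DD k (DD i u)) (s, x) * Hp (DD j ψ) (s, x) +
        Hp (DD k b) (s, x) * Hp (DD i u) (s, x) * Hp (DD k (DD j ψ)) (s, x))) +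
        ∫ x, Hp b (s, x) * Hp (DD k (DD i u)) (s, x) * Hp (DD k (DD j ψ)) (s, x) := fun i j =>
      integral_add (((a1 j i k).add (a2 j i k)).integrable s) ((a3 j i k).integrable s)
    rw [split i j, split j i]
    have hnull := null_form hu hψ hb i j k s
    have e1 : ∀ P Q R S N : ℝ, R - S = - N → P + S - (Q + R) = P - Q + N := by intro P Q R S N h; linarith
    rw [e1 _ _ _ _ _ hnull]
    have i12 := ((a1 j i k).add (a2 j i k)).integrable s
    have i34 := ((a1 i j k).add (a2 i j k)).integrable s
    have i56 := ((a4 i j k).sub (a4 j i k)).integrable s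
    rw [← integral_sub i12 i34, ← integral_add (isub i12 i34) i56, ← integral_const_mul]
    refine integral_mono (iadd (isub i12 i34) i56) (((dZ1.add dZ2).integrable s).const_mul 3) fun x => ?_
    have m1 := abs_le.1 (am1 (Hp (DD k b) (s, x)) (Hp (DD k (DD i u)) (s, x)) (Hp (DD j ψ) (s, x)))
    have m2 := abs_le.1 (am1 (Hp (DD k b) (s, x)) (Hp (DD k (DD j ψ)) (s, x)) (Hp (DD i u) (s, x)))
    have m3 := abs_le.1 (am1 (Hp (DD k b) (s, x)) (Hp (DD k (DD j u)) (s, x)) (Hp (DD i ψ) (s, x)))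
    have m4 := abs_le.1 (am1 (Hp (DD k b) (s, x)) (Hp (DD k (DD i ψ)) (s, x)) (Hp (DD j u) (s, x)))
    have m5 := abs_le.1 (am1 (Hp (DD j b) (s, x)) (Hp (DD k (DD i ψ)) (s, x)) (Hp (DD k u) (s, x)))
    have m6 := abs_le.1 (am1 (Hp (DD i b) (s, x)) (Hp (DD k (DD j ψ)) (s, x)) (Hp (DD k u) (s, x)))
    have z : ∀ d k, 2 * Hp (DD k (DD d u)) (s, x) ^2 ≤ ∑ d, ∑ k, zd b u d k (s, x) := fun d k => by
      refine le_trans ?_ (zd_le b u d k (s, x)); unfold zd; simp; positivity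
    have z' : ∀ d k, 1/2 * Hp (DD k b) (s, x) ^2 * Hp (DD d u) (s, x) ^2 ≤ ∑ d, ∑ k, zd b u d k (s, x) := fun d k => by
      refine le_trans ?_ (zd_le b u d k (s, x)); unfold zd; simp; positivity
    have y : ∀ d k, 2 * Hp (DD k (DD d ψ)) (s, x) ^2 ≤ ∑ d, ∑ k, zd b ψ d k (s, x) := fun d k => by
      refine le_trans ?_ (zd_le b ψ d k (s, x)); unfold zd; simp; positivity
    have y' : ∀ d k, 1/2 * Hp (DD k b) (s, x) ^2 * Hp (DD d ψ) (s, x) ^2 ≤ ∑ d, ∑ k, zd b ψ d k (s, x) := fun d k => by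
      refine le_trans ?_ (zd_le b ψ d k (s, x)); unfold zd; simp; positivity
    have eZ : Z (s, x) = (∑ d, ∑ k, zd b u d k (s, x)) + ∑ d, ∑ k, zd b ψ d k (s, x) := rfl
    simp only [eZ]
    have := z i k
    have := z j k
    have := y i k
    have := y j k
    have := z' i k
    have := z' j k
    have := z' k j
    have := z' k i
    have := y' i k
    have := y' j k
    linarith [m1.1, m1.2, m2.1, m2.2, m3.1, m3.2, m4.1, m4.2, m5.1, m5.2, m6.1, m6.2]
  have hsum := Finset.sum_le_sum fun k (_ : k ∈ Finset.univ) => hk k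
  rw [Finset.sum_sub_distrib, Finset.sum_const, Finset.card_univ, Fintype.card_fin, nsmul_eq_mul] at hsum
  have h2s : 0 ≤ 2 * s := by positivity
  have := mul_le_mul_of_nonneg_left hsum h2s
  linarith

lemma Hp_L1 {n : ℕ} {f : EE n → ℝ} (hf : Sm f) (s : ℝ) : ∫ x, |Hp f (s, x)| ≤ ∫ x, |f x| := by
  have hi : Integrable f := hf.1.continuous.integrable_of_hasCompactSupport hf.2
  have h1 := integral_norm_eq_lintegral_enorm (hf.dc.integrable s).aestronglyMeasurable
  have h2 := integral_norm_eq_lintegral_enorm hi.aestronglyMeasurable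
  simp only [Real.norm_eq_abs] at h1 h2
  rw [h1, h2]
  refine ENNReal.toReal_mono hi.2.ne ?_
  have hc := hf.1.continuous
  calc ∫⁻ x, ‖Hp f (s, x)‖ₑ ≤ ∫⁻ x, ∫⁻ z, ‖f (x + s • z)‖ₑ ∂(gam n) :=
        lintegral_mono fun x => enorm_integral_le_lintegral_enorm _
    _ = ∫⁻ z, ∫⁻ x, ‖f (x + s • z)‖ₑ ∂volume ∂(gam n) := by
        refine lintegral_lintegral_swap (Continuous.aemeasurable ?_)
        exact (hc.comp (by fun_prop : Continuous fun p : EE n × EE n => p.1 + s • p.2)).enorm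
    _ = ∫⁻ z, ∫⁻ x, ‖f x‖ₑ ∂volume ∂(gam n) := by
        congr 1; ext z
        exact lintegral_add_right_eq_self (fun x => ‖f x‖ₑ) (s • z)
    _ = ∫⁻ x, ‖f x‖ₑ := by simp

lemma Hp_decay {n : ℕ} {ψ : EE n → ℝ} (hψ : Sm ψ) (i : Fin n) : ∃ C, ∀ s x, 0 < s → |Hp (DD i ψ) (s, x)| ≤ C / s := by
  obtain ⟨K, hK⟩ := hψ.B0.2
  obtain ⟨K', hK'⟩ := (hψ.DD i).B0.2
  refine ⟨K * ∫ z, (1 + ‖z‖) ∂(gam n), fun s x hs => ?_⟩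
  have h := stein_shift (C := max K K') hψ.B0.1 (hψ.DD i).B0.1 (fun z => LD_of_B1 hψ.B1.1 i z)
    (fun z => (hK z).trans (le_max_left _ _)) (fun z => (hK' z).trans (le_max_right _ _)) x s
  have h2 : |∫ z, ψ (x + s • z) * z i ∂(gam n)| ≤ K * ∫ z, (1 + ‖z‖) ∂(gam n) := by
    rw [← integral_const_mul]
    rw [← Real.norm_eq_abs]
    refine norm_integral_le_of_norm_le ((gam_lin n).const_mul K) (Filter.Eventually.of_forall fun z => ?_)
    rw [norm_mul]
    have := hK (x + s • z)
    have := norm_coord_le z i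
    have h0 : 0 ≤ K := (abs_nonneg _).trans (hK 0)
    simp only [Real.norm_eq_abs]
    gcongr
    linarith
  rw [h, abs_mul, abs_of_pos hs] at h2
  rw [le_div_iff₀ hs, mul_comm]
  exact h2

lemma tri_decay {n : ℕ} {f ψ b : EE n → ℝ} (hf : Sm f) (hψ : Sm ψ) (hb : B0 b) (i : Fin n) :
    ∃ C, ∀ s, 0 < s → |∫ x, Hp b (s, x) * Hp f (s, x) * Hp (DD i ψ) (s, x)| ≤ C / s := by
  obtain ⟨C, hC⟩ := Hp_decay hψ i
  obtain ⟨K, hK⟩ := (HH_BC hb).2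
  refine ⟨K * C * ∫ x, |f x|, fun s hs => ?_⟩
  have hK0 : 0 ≤ K := (abs_nonneg _).trans (hK 0)
  have hCs : 0 ≤ C / s := (abs_nonneg _).trans (hC s 0 hs)
  calc |∫ x, Hp b (s, x) * Hp f (s, x) * Hp (DD i ψ) (s, x)| ≤ ∫ x, (K * (C / s)) * |Hp f (s, x)| := by
        rw [← Real.norm_eq_abs]
        refine norm_integral_le_of_norm_le ((hf.dc.integrable s).abs.const_mul _) (Filter.Eventually.of_forall fun x => ?_)
        rw [Real.norm_eq_abs, abs_mul, abs_mul]
        have h1 : |Hp b (s, x)| ≤ K := hK (s, x)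
        have h2 := hC s x hs
        calc _ ≤ K * |Hp f (s, x)| * (C / s) := by gcongr
          _ = _ := by ring
    _ = K * (C / s) * ∫ x, |Hp f (s, x)| := integral_const_mul _ _
    _ ≤ K * (C / s) * ∫ x, |f x| := mul_le_mul_of_nonneg_left (Hp_L1 hf s) (by positivity)
    _ = _ := by ring

lemma QQ_tendsto {n : ℕ} {u ψ b : EE n → ℝ} (hu : Sm u) (hψ : Sm ψ) (hb : B0 b) (i j : Fin n) :
    Filter.Tendsto (QQ b u ψ i j) Filter.atTop (nhds 0) := by
  have : ∀ i j, Filter.Tendsto (fun s => ∫ x, Hp b (s, x) * Hp (DD j u) (s, x) * Hp (DD i ψ) (s, x)) Filter.atTop (nhds 0) := by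
    intro i j
    obtain ⟨C, hC⟩ := tri_decay (hu.DD j) hψ hb i
    refine squeeze_zero_norm' (a := fun s => C / s) ?_ (Filter.Tendsto.const_div_atTop Filter.tendsto_id C)
    filter_upwards [Filter.eventually_gt_atTop 0] with s hs using hC s hs
  have h := (this i j).sub (this j i)
  rw [sub_zero] at h
  exact h

lemma core1 {n : ℕ} {u ψ b : EE n → ℝ} (hu : Sm u) (hψ : Sm ψ) (hb : B2 b) (hw : ∀ r y, ww b r y ≤ 1) (i j : Fin n) :
    - ((∫ x, b x * DD j u x * DD i ψ x) - ∫ x, b x * DD i u x * DD j ψ x) ≤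
      12 * n * ((∑ d, ∫ x, DD d u x ^ 2) + ∑ d, ∫ x, DD d ψ x ^ 2) := by
  let En : (EE n → ℝ) → ℝ → ℝ := fun f s => ∫ x, Hp f (s, x)^2 * (1 + (1 + ww b s x)⁻¹)
  have hEn : ∀ f s, 0 ≤ En f s := fun f s => integral_nonneg fun x => by
    have := ww_nonneg hb.1.2.1 s x
    positivity
  choose eu heu heu' using fun d s => energy (hu.DD d) hb hw s
  choose ev hev hev' using fun d s => energy (hψ.DD d) hb hw s
  choose eq heq heq' using fun s => QQ_deriv hu hψ hb i j s
  let E : ℝ → ℝ := fun s => 6 * n * ((∑ d, En (DD d u) s) + ∑ d, En (DD d ψ) s) + QQ b u ψ i j s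
  have hE : ∀ s, HasDerivAt E (6 * n * ((∑ d, eu d s) + ∑ d, ev d s) + eq s) s := fun s =>
    (((HasDerivAt.fun_sum fun d _ => heu d s).add (HasDerivAt.fun_sum fun d _ => hev d s)).const_mul (6 * n : ℝ)).add (heq s)
  have hanti : AntitoneOn E (Set.Ici 0) := by
    refine antitoneOn_of_deriv_nonpos (convex_Ici _) (fun θ _ => (hE θ).continuousAt.continuousWithinAt)
      (fun θ _ => (hE θ).differentiableAt.differentiableWithinAt) fun s hs => ?_
    rw [interior_Ici] at hs
    have hs0 : 0 ≤ s := le_of_lt hs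
    rw [(hE s).deriv]
    have h1 := Finset.sum_le_sum fun d (_ : d ∈ Finset.univ) => heu' d s hs0
    have h2 := Finset.sum_le_sum fun d (_ : d ∈ Finset.univ) => hev' d s hs0
    have h3 := heq' s hs0
    rw [Finset.sum_neg_distrib, ← Finset.mul_sum] at h1 h2
    simp only [zd] at h3
    have h4 := mul_le_mul_of_nonneg_left (add_le_add h1 h2) (by positivity : (0:ℝ) ≤ 6 * n)
    linarith
  have h0 : 0 ≤ E 0 := by
    refine le_of_tendsto (QQ_tendsto hu hψ hb.1.2.1 i j) ?_
    filter_upwards [Filter.eventually_ge_atTop 0] with s hs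
    have h1 : E s ≤ E 0 := hanti (Set.mem_Ici.2 le_rfl) hs hs
    have h2 : QQ b u ψ i j s ≤ E s := by
      have : 0 ≤ 6 * n * ((∑ d, En (DD d u) s) + ∑ d, En (DD d ψ) s) :=
        mul_nonneg (by positivity) (add_nonneg (Finset.sum_nonneg fun d _ => hEn _ _) (Finset.sum_nonneg fun d _ => hEn _ _))
      simp only [E]
      linarith
    linarith
  have z : ∀ f, En f 0 = 2 * ∫ x, f x ^ 2 := by
    intro f
    simp only [En]
    rw [← integral_const_mul]
    congr 1
    ext x
    simp [Hp, HH_zero, ww, pow_two]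
    ring
  have q : QQ b u ψ i j 0 = (∫ x, b x * DD j u x * DD i ψ x) - ∫ x, b x * DD i u x * DD j ψ x := by
    simp [QQ, Hp, HH_zero]
  simp only [E, z, q, ← Finset.mul_sum] at h0
  linarith

/-- the bilinear form -/
noncomputable def JJ {n : ℕ} (u ψ : EE n → ℝ) (i j : Fin n) (x : EE n) : ℝ := DD j u x * DD i ψ x - DD i u x * DD j ψ x

/-- Dirichlet energy -/
noncomputable def Di {n : ℕ} (u : EE n → ℝ) : ℝ := ∑ d, ∫ x, DD d u x ^ 2

lemma core2 {n : ℕ} {u ψ b : EE n → ℝ} (hu : Sm u) (hψ : Sm ψ) (hb : B2 b) {m : ℝ} (hm0 : 0 < m) (hm : PP b m) (i j : Fin n) :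
    |∫ x, b x * JJ u ψ i j x| ≤ 240 * n * m * (Di u + Di ψ) := by
  have main : ∀ c : ℝ, c ^ 2 * (400 * m^2) ≤ 1 → - (c * ∫ x, b x * JJ u ψ i j x) ≤ 12 * n * (Di u + Di ψ) := by
    intro c hc
    have h := core1 hu hψ (hb.const_mul c) (fun r y => by
      rw [ww_const_mul]
      have := jn hb hm r y
      exact (mul_le_mul_of_nonneg_left this (sq_nonneg c)).trans hc) i j
    have I : ∀ i j, Integrable (fun x => c * b x * DD j u x * DD i ψ x) := fun i j =>
      Continuous.integrable_of_hasCompactSupport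
        (((continuous_const.mul hb.1.1.continuous).mul (hu.DD j).1.continuous).mul (hψ.DD i).1.continuous)
        (HasCompactSupport.mul_left (f := fun x => c * b x * DD j u x) (hψ.DD i).2)
    rw [← integral_sub (I i j) (I j i)] at h
    rw [← integral_const_mul]
    refine le_trans (le_of_eq ?_) h
    congr 2
    ext x
    simp only [JJ]
    ring
  have h1 := main (1/(20*m)) (by field_simp; norm_num)
  have h2 := main (-(1/(20*m))) (by field_simp; norm_num)
  set I := ∫ x, b x * JJ u ψ i j x
  set D := Di u + Di ψ
  have e : I = (20 * m) * (1/(20*m) * I) := by field_simp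
  rw [abs_le]
  constructor <;> nlinarith

end BmoAux

namespace BmoAux

/-- mollification -/
noncomputable def mo {n : ℕ} (φ f : EE n → ℝ) : EE n → ℝ :=
  convolution φ f (ContinuousLinearMap.lsmul ℝ ℝ) volume

lemma mo_apply {n : ℕ} (φ f : EE n → ℝ) (x : EE n) : mo φ f x = ∫ t, φ t * f (x - t) := rfl

lemma li_of_bdd {n : ℕ} {b : EE n → ℝ} {N : ℝ} (hb : Measurable b) (hN : ∀ x, |b x| ≤ N) :
    LocallyIntegrable b := by
  refine (locallyIntegrable_const N).mono hb.aestronglyMeasurable (Filter.Eventually.of_forall fun x => ?_)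
  exact (hN x).trans (le_abs_self N)

lemma mo_bound {n : ℕ} {φ b : EE n → ℝ} {N : ℝ} (hφ : Integrable φ) (hN : ∀ x, |b x| ≤ N) (x : EE n) :
    |mo φ b x| ≤ N * ∫ t, |φ t| := by
  rw [mo_apply, ← Real.norm_eq_abs, ← integral_const_mul]
  refine norm_integral_le_of_norm_le (hφ.abs.const_mul N) (Filter.Eventually.of_forall fun t => ?_)
  rw [norm_mul, Real.norm_eq_abs, Real.norm_eq_abs, mul_comm]
  exact mul_le_mul_of_nonneg_right (hN _) (abs_nonneg _)

lemma mo_DD_left {n : ℕ} {φ b : EE n → ℝ} (hφ : Sm φ) (hb : LocallyIntegrable b) (k : Fin n) :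
    DD k (mo φ b) = mo (DD k φ) b := by
  ext x
  have h := hφ.2.hasFDerivAt_convolution_left (ContinuousLinearMap.lsmul ℝ ℝ) (hφ.1.of_le (by norm_num)) hb x
  have e : DD k (mo φ b) x = ((convolution (fderiv ℝ φ) b ((ContinuousLinearMap.lsmul ℝ ℝ).precompL (EE n)) volume) x) (ee k) := by
    unfold DD mo; rw [h.fderiv]
  rw [e, convolution_def, ContinuousLinearMap.integral_apply]
  · rfl
  · have hc : HasCompactSupport (fderiv ℝ φ) := hφ.2.fderiv ℝ
    exact hc.convolutionExists_left _ (hφ.1.continuous_fderiv (by norm_num)) hb x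

lemma mo_DD_right {n : ℕ} {φ u : EE n → ℝ} (hφ : Sm φ) (hu : ContDiff ℝ 1 u) (hu' : HasCompactSupport u) (k : Fin n) :
    DD k (mo φ u) = mo φ (DD k u) := by
  ext x
  have hl : LocallyIntegrable φ := hφ.1.continuous.locallyIntegrable
  have h := hu'.hasFDerivAt_convolution_right (ContinuousLinearMap.lsmul ℝ ℝ) hl hu x
  have e : DD k (mo φ u) x = ((convolution φ (fderiv ℝ u) ((ContinuousLinearMap.lsmul ℝ ℝ).precompR (EE n)) volume) x) (ee k) := by
    unfold DD mo; rw [h.fderiv]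
  rw [e, convolution_def, ContinuousLinearMap.integral_apply]
  · rfl
  · have hc : HasCompactSupport (fderiv ℝ u) := hu'.fderiv ℝ
    exact hc.convolutionExists_right _ hl (hu.continuous_fderiv (by norm_num)) x

lemma mo_smooth {n : ℕ} {φ b : EE n → ℝ} (hφ : Sm φ) (hb : LocallyIntegrable b) :
    ContDiff ℝ (⊤ : ℕ∞) (mo φ b) := hφ.2.contDiff_convolution_left _ hφ.1 hb

lemma Sm.integrable {n : ℕ} {φ : EE n → ℝ} (hφ : Sm φ) : Integrable φ :=
  hφ.1.continuous.integrable_of_hasCompactSupport hφ.2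

lemma mo_B0 {n : ℕ} {φ b : EE n → ℝ} {N : ℝ} (hφ : Sm φ) (hb : Measurable b) (hN : ∀ x, |b x| ≤ N) : B0 (mo φ b) :=
  ⟨(mo_smooth hφ (li_of_bdd hb hN)).continuous, _, mo_bound hφ.integrable hN⟩

lemma mo_B1 {n : ℕ} {φ b : EE n → ℝ} {N : ℝ} (hφ : Sm φ) (hb : Measurable b) (hN : ∀ x, |b x| ≤ N) : B1 (mo φ b) :=
  ⟨(mo_smooth hφ (li_of_bdd hb hN)).of_le (by norm_num), mo_B0 hφ hb hN, fun k => by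
    rw [mo_DD_left hφ (li_of_bdd hb hN)]; exact mo_B0 (hφ.DD k) hb hN⟩

lemma mo_B2 {n : ℕ} {φ b : EE n → ℝ} {N : ℝ} (hφ : Sm φ) (hb : Measurable b) (hN : ∀ x, |b x| ≤ N) : B2 (mo φ b) :=
  ⟨mo_B1 hφ hb hN, fun k => by rw [mo_DD_left hφ (li_of_bdd hb hN)]; exact mo_B1 (hφ.DD k) hb hN⟩

lemma mo_Sm {n : ℕ} {φ u : EE n → ℝ} (hφ : Sm φ) (hu : Continuous u) (hu' : HasCompactSupport u) : Sm (mo φ u) :=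
  ⟨mo_smooth hφ hu.locallyIntegrable, HasCompactSupport.convolution _ hφ.2 hu'⟩

lemma prod_int {n : ℕ} {φ : EE n → ℝ} (hφ : Integrable φ) {G : EE n × EE n → ℝ} {K : ℝ} (hG : Measurable G) (hK : ∀ p, |G p| ≤ K) :
    Integrable (fun p : EE n × EE n => φ p.2 * G p) ((gam n).prod volume) := by
  have h : Integrable (fun p : EE n × EE n => φ p.2) ((gam n).prod volume) := hφ.comp_snd (gam n)
  have := h.bdd_mul (c := K) hG.aestronglyMeasurable (Filter.Eventually.of_forall hK)
  simpa only [mul_comm] using this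

lemma mo_PP {n : ℕ} {φ b : EE n → ℝ} {N m : ℝ} (hφ : Sm φ) (hφ0 : ∀ x, 0 ≤ φ x) (hφ1 : ∫ x, φ x = 1)
    (hb : Measurable b) (hN : ∀ x, |b x| ≤ N) (hm : PP b m) : PP (mo φ b) m := by
  intro s x
  have hφi := hφ.integrable
  have mH : Measurable fun y => HH b s y := by
    have : StronglyMeasurable fun p : EE n × EE n => b (p.1 + s • p.2) :=
      (hb.comp (by fun_prop)).stronglyMeasurable
    exact (this.integral_prod_right (ν := gam n)).measurable
  let G0 : EE n × EE n → ℝ := fun p => b (x + s • p.1 - p.2)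
  let G : EE n × EE n → ℝ := fun p => b (x + s • p.1 - p.2) - HH b s (x - p.2)
  have mG0 : Measurable G0 := hb.comp (by fun_prop)
  have mG : Measurable G := mG0.sub (mH.comp (by fun_prop))
  have kG : ∀ p, |G p| ≤ N + N := fun p => (abs_sub _ _).trans (add_le_add (hN _) (HH_bound hN _ _))
  have I0 := prod_int hφi mG0 (fun p => hN _)
  have I := prod_int hφi mG kG
  have Ia := prod_int hφi mG.abs (K := N + N) (fun p => by rw [abs_abs]; exact kG p)
  have e : HH (mo φ b) s x = ∫ t, φ t * HH b s (x - t) := by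
    have := integral_integral_swap (f := fun z t => φ t * b (x + s • z - t)) I0
    simp only [integral_const_mul] at this
    simp only [HH, mo_apply]
    rw [this]
    congr 1; ext t; congr 2; ext z
    congr 1; abel
  have i2 : Integrable fun t => φ t * HH b s (x - t) := by
    have := hφi.bdd_mul (c := N) (mH.comp (by fun_prop : Measurable fun t : EE n => x - t)).aestronglyMeasurable
      (Filter.Eventually.of_forall fun t => HH_bound hN _ _)
    simpa only [mul_comm, Function.comp_apply] using this
  have i1 : ∀ y, Integrable fun t => φ t * b (y - t) := fun y => by
    have := hφi.bdd_mul (c := N) (hb.comp (by fun_prop : Measurable fun t : EE n => y - t)).aestronglyMeasurable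
      (Filter.Eventually.of_forall fun t => hN _)
    simpa only [mul_comm, Function.comp_apply] using this
  have h1 : ∀ z, |mo φ b (x + s • z) - HH (mo φ b) s x| ≤ ∫ t, φ t * |G (z, t)| := by
    intro z
    rw [e, mo_apply, ← integral_sub (i1 _) i2]
    refine (abs_integral_le_integral_abs).trans (le_of_eq ?_)
    congr 1; ext t
    rw [← mul_sub, abs_mul, abs_of_nonneg (hφ0 t)]
  have i3 : Integrable (fun z => ∫ t, φ t * |G (z, t)|) (gam n) := Ia.integral_prod_left
  calc ∫ z, |mo φ b (x + s • z) - HH (mo φ b) s x| ∂(gam n)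
      ≤ ∫ z, ∫ t, φ t * |G (z, t)| ∂volume ∂(gam n) :=
        integral_mono_of_nonneg (Filter.Eventually.of_forall fun z => abs_nonneg _) i3 (Filter.Eventually.of_forall h1)
    _ = ∫ t, ∫ z, φ t * |G (z, t)| ∂(gam n) := integral_integral_swap (f := fun z t => φ t * |G (z, t)|) Ia
    _ ≤ ∫ t, φ t * m := by
        refine integral_mono_of_nonneg (Filter.Eventually.of_forall fun t => integral_nonneg fun z => mul_nonneg (hφ0 t) (abs_nonneg _))
          (hφi.mul_const m) (Filter.Eventually.of_forall fun t => ?_)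
        simp only
        rw [integral_const_mul]
        refine mul_le_mul_of_nonneg_left (le_trans (le_of_eq ?_) (hm s (x - t))) (hφ0 t)
        congr 1; ext z
        simp only [G]
        congr 3; abel
    _ = m := by rw [integral_mul_const, hφ1, one_mul]

/-- standard mollifier -/
noncomputable def bu (n k : ℕ) : ContDiffBump (0 : EE n) where
  rIn := 1 / (k + 1 : ℝ) / 2
  rOut := 1 / (k + 1 : ℝ)
  rIn_pos := by positivity
  rIn_lt_rOut := half_lt_self (by positivity)

/-- normalised mollifier -/
noncomputable def bn (n k : ℕ) : EE n → ℝ := (bu n k).normed volume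

lemma bn_Sm (n k : ℕ) : Sm (bn n k) := ⟨(bu n k).contDiff_normed, (bu n k).hasCompactSupport_normed⟩
lemma bn_nonneg (n k : ℕ) (x : EE n) : 0 ≤ bn n k x := (bu n k).nonneg_normed x
lemma bn_int (n k : ℕ) : ∫ x, bn n k x = 1 := (bu n k).integral_normed
lemma bu_tendsto (n : ℕ) : Filter.Tendsto (fun k => (bu n k).rOut) Filter.atTop (nhds 0) :=
  tendsto_one_div_add_atTop_nhds_zero_nat

lemma mo_tendsto {n : ℕ} {g : EE n → ℝ} (hg : Continuous g) (x : EE n) :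
    Filter.Tendsto (fun k => mo (bn n k) g x) Filter.atTop (nhds (g x)) :=
  ContDiffBump.convolution_tendsto_right_of_continuous (bu_tendsto n) hg x

lemma mo_tendsto_ae {n : ℕ} {g : EE n → ℝ} (hg : LocallyIntegrable g) :
    ∀ᵐ x, Filter.Tendsto (fun k => mo (bn n k) g x) Filter.atTop (nhds (g x)) :=
  ContDiffBump.ae_convolution_tendsto_right_of_locallyIntegrable (K := 2) (bu_tendsto n)
    (Filter.Eventually.of_forall fun k => by simp only [bu]; linarith) hg

lemma bn_bound {n : ℕ} {b : EE n → ℝ} {N : ℝ} (hN : ∀ x, |b x| ≤ N) (k : ℕ) (x : EE n) : |mo (bn n k) b x| ≤ N := by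
  have := mo_bound (bn_Sm n k).integrable hN x
  simp only [abs_of_nonneg (bn_nonneg n k _), bn_int, mul_one] at this
  exact this

open Pointwise in
lemma bn_supp {n : ℕ} {g : EE n → ℝ} (hg : HasCompactSupport g) : ∃ S : Set (EE n), IsCompact S ∧ ∀ k x, x ∉ S → mo (bn n k) g x = 0 := by
  refine ⟨closedBall 0 1 + tsupport g, (isCompact_closedBall 0 1).add hg, fun k x hx => ?_⟩
  by_contra h
  refine hx ?_
  have h1 := support_convolution_subset (ContinuousLinearMap.lsmul ℝ ℝ) (μ := volume) (f := bn n k) (g := g) h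
  refine Set.add_subset_add ?_ subset_closure h1
  unfold bn
  rw [ContDiffBump.support_normed_eq]
  refine (ball_subset_closedBall).trans (closedBall_subset_closedBall ?_)
  simp only [bu]
  rw [div_le_one (by positivity)]
  have : (0:ℝ) ≤ k := Nat.cast_nonneg k
  linarith

lemma bdd_cs {n : ℕ} {g : EE n → ℝ} (hg : Continuous g) (hg' : HasCompactSupport g) : ∃ C, ∀ x, |g x| ≤ C :=
  hg.bounded_above_of_compact_support hg'

lemma DD_cs {n : ℕ} {u : EE n → ℝ} (hu : HasCompactSupport u) (k : Fin n) : HasCompactSupport (DD k u) := by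
  have := hu.fderiv ℝ
  exact this.comp_left (g := fun L : EE n →L[ℝ] ℝ => L (ee k)) rfl

/-- limit of trilinear integrals -/
lemma mo_lim {n : ℕ} {b f g : EE n → ℝ} {N : ℝ} (hb : Measurable b) (hN : ∀ x, |b x| ≤ N)
    (hf : Continuous f) (hf' : HasCompactSupport f) (hg : Continuous g) (hg' : HasCompactSupport g) :
    Filter.Tendsto (fun k => ∫ x, mo (bn n k) b x * (mo (bn n k) f x * mo (bn n k) g x)) Filter.atTop
      (nhds (∫ x, b x * (f x * g x))) := by
  obtain ⟨S, hS, hS'⟩ := bn_supp hf'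
  obtain ⟨A, hA⟩ := bdd_cs hf hf'
  obtain ⟨B, hB⟩ := bdd_cs hg hg'
  have hl := li_of_bdd hb hN
  have hN0 : 0 ≤ N := (abs_nonneg _).trans (hN 0)
  have hA0 : 0 ≤ A := (abs_nonneg _).trans (hA 0)
  refine tendsto_integral_of_dominated_convergence (S.indicator fun _ => N * (A * B)) ?_ ?_ ?_ ?_
  · intro k
    have h1 := (mo_smooth (bn_Sm n k) hl).continuous
    have h2 := (mo_smooth (bn_Sm n k) hf.locallyIntegrable).continuous
    have h3 := (mo_smooth (bn_Sm n k) hg.locallyIntegrable).continuous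
    exact (h1.mul (h2.mul h3)).aestronglyMeasurable
  · rw [integrable_indicator_iff hS.measurableSet]
    exact integrableOn_const hS.measure_lt_top.ne
  · refine fun k => Filter.Eventually.of_forall fun x => ?_
    by_cases hx : x ∈ S
    · rw [Set.indicator_of_mem hx, norm_mul, norm_mul]
      exact mul_le_mul (bn_bound hN k x) (mul_le_mul (bn_bound hA k x) (bn_bound hB k x) (norm_nonneg _) hA0) (by positivity) hN0
    · rw [Set.indicator_of_notMem hx, hS' k x hx]; simp
  · filter_upwards [mo_tendsto_ae hl] with x hx
    exact hx.mul ((mo_tendsto hf x).mul (mo_tendsto hg x))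

lemma Di_lim {n : ℕ} {u : EE n → ℝ} (hu : ContDiff ℝ 1 u) (hu' : HasCompactSupport u) :
    Filter.Tendsto (fun k => Di (mo (bn n k) u)) Filter.atTop (nhds (Di u)) := by
  unfold Di
  refine tendsto_finsetSum _ fun d _ => ?_
  have hc := contDiff_DD_of hu d
  obtain ⟨S, hS, hS'⟩ := bn_supp (DD_cs hu' d)
  obtain ⟨A, hA⟩ := bdd_cs hc (DD_cs hu' d)
  simp only [mo_DD_right (bn_Sm n _) hu hu' d]
  refine tendsto_integral_of_dominated_convergence (S.indicator fun _ => A ^ 2) ?_ ?_ ?_ ?_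
  · intro k
    exact ((mo_smooth (bn_Sm n k) hc.locallyIntegrable).continuous.pow 2).aestronglyMeasurable
  · rw [integrable_indicator_iff hS.measurableSet]
    exact integrableOn_const hS.measure_lt_top.ne
  · refine fun k => Filter.Eventually.of_forall fun x => ?_
    by_cases hx : x ∈ S
    · rw [Set.indicator_of_mem hx, norm_pow]
      exact pow_le_pow_left₀ (norm_nonneg _) (bn_bound hA k x) 2
    · rw [Set.indicator_of_notMem hx, hS' k x hx]; simp
  · exact Filter.Eventually.of_forall fun x => (mo_tendsto hc x).pow 2

lemma li_mul {n : ℕ} {b g : EE n → ℝ} (hb : LocallyIntegrable b) (hg : Continuous g) (hg' : HasCompactSupport g) :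
    Integrable (fun x => b x * g x) := by
  have := hb.integrable_smul_right_of_hasCompactSupport hg hg'
  simpa only [smul_eq_mul, mul_comm] using this

lemma JJ_int {n : ℕ} {b u ψ : EE n → ℝ} (hb : LocallyIntegrable b) (hu : ContDiff ℝ 1 u) (hψ : ContDiff ℝ 1 ψ)
    (hψ' : HasCompactSupport ψ) (i j : Fin n) : Integrable (fun x => b x * (DD j u x * DD i ψ x)) :=
  li_mul hb ((contDiff_DD_of hu j).mul (contDiff_DD_of hψ i)) (HasCompactSupport.mul_left (f := DD j u) (DD_cs hψ' i))

lemma JJ_split {n : ℕ} {b u ψ : EE n → ℝ} (hb : LocallyIntegrable b) (hu : ContDiff ℝ 1 u) (hψ : ContDiff ℝ 1 ψ)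
    (hψ' : HasCompactSupport ψ) (i j : Fin n) :
    ∫ x, b x * JJ u ψ i j x = (∫ x, b x * (DD j u x * DD i ψ x)) - ∫ x, b x * (DD i u x * DD j ψ x) := by
  rw [← integral_sub (JJ_int hb hu hψ hψ' i j) (JJ_int hb hu hψ hψ' j i)]
  simp only [JJ, mul_sub]

lemma core3 {n : ℕ} {u ψ b : EE n → ℝ} {N : ℝ} (hu : ContDiff ℝ 1 u) (hu' : HasCompactSupport u)
    (hψ : ContDiff ℝ 1 ψ) (hψ' : HasCompactSupport ψ) (hb : Measurable b) (hN : ∀ x, |b x| ≤ N)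
    {m : ℝ} (hm0 : 0 < m) (hm : PP b m) (i j : Fin n) :
    |∫ x, b x * JJ u ψ i j x| ≤ 240 * n * m * (Di u + Di ψ) := by
  have hl := li_of_bdd hb hN
  have c := fun k => contDiff_DD_of hu k
  have d := fun k => contDiff_DD_of hψ k
  have L : Filter.Tendsto (fun k => ∫ x, mo (bn n k) b x * JJ (mo (bn n k) u) (mo (bn n k) ψ) i j x) Filter.atTop
      (nhds (∫ x, b x * JJ u ψ i j x)) := by
    have e : ∀ k, ∫ x, mo (bn n k) b x * JJ (mo (bn n k) u) (mo (bn n k) ψ) i j x =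
        (∫ x, mo (bn n k) b x * (mo (bn n k) (DD j u) x * mo (bn n k) (DD i ψ) x)) -
        ∫ x, mo (bn n k) b x * (mo (bn n k) (DD i u) x * mo (bn n k) (DD j ψ) x) := by
      intro k
      have h1 := mo_Sm (bn_Sm n k) hu.continuous hu'
      have h2 := mo_Sm (bn_Sm n k) hψ.continuous hψ'
      rw [JJ_split (mo_B0 (bn_Sm n k) hb hN).1.locallyIntegrable h1.B1.1 h2.B1.1 h2.2]
      simp only [mo_DD_right (bn_Sm n k) hu hu', mo_DD_right (bn_Sm n k) hψ hψ']
    simp only [e]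
    rw [JJ_split hl hu hψ hψ']
    exact (mo_lim hb hN (c j) (DD_cs hu' j) (d i) (DD_cs hψ' i)).sub (mo_lim hb hN (c i) (DD_cs hu' i) (d j) (DD_cs hψ' j))
  refine le_of_tendsto_of_tendsto' L.abs (((Di_lim hu hu').add (Di_lim hψ hψ')).const_mul (240 * n * m)) fun k => ?_
  exact core2 (mo_Sm (bn_Sm n k) hu.continuous hu') (mo_Sm (bn_Sm n k) hψ.continuous hψ') (mo_B2 (bn_Sm n k) hb hN) hm0
    (mo_PP (bn_Sm n k) (bn_nonneg n k) (bn_int n k) hb hN hm) i j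

/-- Gaussian oscillation bound -/
def OO {n : ℕ} (b : EE n → ℝ) (m : ℝ) : Prop :=
  ∀ (s : ℝ) (x : EE n), ∃ c : ℝ, ∫⁻ z, ‖b (x + s • z) - c‖ₑ ∂(gam n) ≤ ENNReal.ofReal m

/-- truncation -/
noncomputable def tr (N y : ℝ) : ℝ := max (-N) (min N y)

lemma tr_abs {N : ℝ} (hN : 0 ≤ N) (y : ℝ) : |tr N y| ≤ N := by
  unfold tr
  rw [abs_le]
  exact ⟨le_max_left _ _, max_le (by linarith) (min_le_left _ _)⟩

lemma tr_lip (N y c : ℝ) : |tr N y - tr N c| ≤ |y - c| := by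
  unfold tr
  have h1 := abs_max_sub_max_le_abs (min N y) (min N c) (-N)
  have h2 := abs_min_sub_min_le_max N y N c
  rw [max_comm (-N), max_comm (-N)]
  refine h1.trans (h2.trans ?_)
  simp

lemma tr_eq {N y : ℝ} (h : |y| ≤ N) : tr N y = y := by
  rw [abs_le] at h
  unfold tr
  rw [min_eq_right h.2, max_eq_right h.1]

lemma tr_le {N : ℝ} (hN : 0 ≤ N) (y : ℝ) : |tr N y| ≤ |y| := by
  have := tr_lip N y 0
  rwa [sub_zero, tr_eq (y := 0) (by simpa using hN), sub_zero] at this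

lemma tr_PP {n : ℕ} {b : EE n → ℝ} {N m : ℝ} (hN : 0 ≤ N) (hb : Measurable b) (hm0 : 0 ≤ m) (hm : OO b m) :
    PP (fun x => tr N (b x)) (2 * m) := by
  intro s x
  obtain ⟨c, hc⟩ := hm s x
  have mt : Measurable (fun x => tr N (b x)) := by unfold tr; fun_prop
  have it : Integrable (fun z => tr N (b (x + s • z))) (gam n) :=
    integrable_bdd_gam (mt.comp (by fun_prop : Measurable fun z : EE n => x + s • z)).aestronglyMeasurable fun z => tr_abs hN _
  have i1 : Integrable (fun z => tr N (b (x + s • z)) - tr N c) (gam n) := isub it (integrable_const _)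
  have h1 : ∫ z, |tr N (b (x + s • z)) - tr N c| ∂(gam n) ≤ m := by
    have e := ofReal_integral_norm_eq_lintegral_enorm i1
    have : ENNReal.ofReal (∫ z, ‖tr N (b (x + s • z)) - tr N c‖ ∂(gam n)) ≤ ENNReal.ofReal m := by
      rw [e]
      refine le_trans (lintegral_mono fun z => ?_) hc
      exact enorm_le_iff_norm_le.2 (tr_lip _ _ _)
    exact (ENNReal.ofReal_le_ofReal_iff hm0).1 this
  have h2 : |tr N c - HH (fun x => tr N (b x)) s x| ≤ m := by
    have : HH (fun x => tr N (b x)) s x - tr N c = ∫ z, (tr N (b (x + s • z)) - tr N c) ∂(gam n) := by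
      rw [integral_sub it (integrable_const _)]; simp [HH]
    rw [abs_sub_comm, this]
    exact abs_integral_le_integral_abs.trans h1
  calc ∫ z, |tr N (b (x + s • z)) - HH (fun x => tr N (b x)) s x| ∂(gam n)
      ≤ ∫ z, (|tr N (b (x + s • z)) - tr N c| + |tr N c - HH (fun x => tr N (b x)) s x|) ∂(gam n) := by
        refine integral_mono (isub it (integrable_const _)).abs (iadd i1.abs (integrable_const _)) fun z => ?_
        exact abs_sub_le _ _ _
    _ = (∫ z, |tr N (b (x + s • z)) - tr N c| ∂(gam n)) + |tr N c - HH (fun x => tr N (b x)) s x| := by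
        rw [integral_add i1.abs (integrable_const _)]; simp
    _ ≤ 2 * m := by linarith

lemma core4 {n : ℕ} {u ψ b : EE n → ℝ} (hu : ContDiff ℝ 1 u) (hu' : HasCompactSupport u)
    (hψ : ContDiff ℝ 1 ψ) (hψ' : HasCompactSupport ψ) (hb : Measurable b) (hl : LocallyIntegrable b)
    {m : ℝ} (hm0 : 0 < m) (hm : OO b m) (i j : Fin n) :
    |∫ x, b x * JJ u ψ i j x| ≤ 480 * n * m * (Di u + Di ψ) := by
  have iJ : Integrable fun x => b x * JJ u ψ i j x := by
    have := isub (JJ_int hl hu hψ hψ' i j) (JJ_int hl hu hψ hψ' j i)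
    simpa only [JJ, mul_sub] using this
  have cJ : Continuous fun x => JJ u ψ i j x := by
    unfold JJ
    exact ((contDiff_DD_of hu j).mul (contDiff_DD_of hψ i)).sub ((contDiff_DD_of hu i).mul (contDiff_DD_of hψ j))
  have L : Filter.Tendsto (fun k : ℕ => ∫ x, tr k (b x) * JJ u ψ i j x) Filter.atTop (nhds (∫ x, b x * JJ u ψ i j x)) := by
    refine tendsto_integral_of_dominated_convergence (fun x => |b x * JJ u ψ i j x|) ?_ iJ.abs ?_ ?_
    · intro k
      have mt : Measurable (fun x => tr k (b x)) := by unfold tr; fun_prop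
      exact (mt.mul cJ.measurable).aestronglyMeasurable
    · refine fun k => Filter.Eventually.of_forall fun x => ?_
      rw [Real.norm_eq_abs, abs_mul, abs_mul]
      exact mul_le_mul_of_nonneg_right (tr_le (Nat.cast_nonneg k) _) (abs_nonneg _)
    · refine Filter.Eventually.of_forall fun x => ?_
      refine Filter.Tendsto.mul_const _ ?_
      refine tendsto_const_nhds.congr' ?_
      obtain ⟨k0, hk0⟩ := exists_nat_ge |b x|
      filter_upwards [Filter.eventually_ge_atTop k0] with k hk
      exact (tr_eq (hk0.trans (by exact_mod_cast hk))).symm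
  refine le_of_tendsto' L.abs fun k => ?_
  have mt : Measurable (fun x => tr k (b x)) := by unfold tr; fun_prop
  have := core3 hu hu' hψ hψ' mt (fun x => tr_abs (Nat.cast_nonneg k) _) (by linarith : 0 < 2 * m)
    (tr_PP (Nat.cast_nonneg k) hb hm0.le hm) i j
  refine this.trans (le_of_eq ?_)
  ring

end BmoAux

namespace BmoAux

/-- affine homeomorphism -/
noncomputable def af {n : ℕ} (x : EE n) {s : ℝ} (hs : s ≠ 0) : EE n ≃ₜ EE n :=
  (Homeomorph.smulOfNeZero s hs).trans (Homeomorph.addLeft x)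

lemma af_apply {n : ℕ} (x : EE n) {s : ℝ} (hs : s ≠ 0) (z : EE n) : af x hs z = x + s • z := rfl

/-- scaling constant -/
noncomputable def kap (n : ℕ) (s : ℝ) : ℝ := |(s ^ n)⁻¹|

lemma kap_pos (n : ℕ) {s : ℝ} (hs : s ≠ 0) : 0 < kap n s := by unfold kap; positivity

lemma af_map {n : ℕ} (x : EE n) {s : ℝ} (hs : s ≠ 0) :
    Measure.map (af x hs) volume = ENNReal.ofReal (kap n s) • (volume : Measure (EE n)) := by
  have h1 := Measure.map_addHaar_smul (volume : Measure (EE n)) hs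
  have h2 : Measure.map (af x hs) volume = Measure.map (fun y => x + y) (Measure.map (fun z : EE n => s • z) volume) := by
    rw [Measure.map_map (by fun_prop) (by fun_prop)]; rfl
  have h3 : Measure.map (fun z : EE n => s • z) volume = ENNReal.ofReal (kap n s) • (volume : Measure (EE n)) := by
    refine h1.trans ?_
    simp [kap]
  rw [h2, h3, Measure.map_smul, map_add_left_eq_self]

lemma af_li {n : ℕ} (x : EE n) {s : ℝ} (hs : s ≠ 0) {f : EE n → ℝ} (hf : LocallyIntegrable f) :
    LocallyIntegrable (fun z => f (x + s • z)) := by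
  refine (locallyIntegrable_map_homeomorph (af x hs) (f := f) (μ := volume)).1 ?_
  rw [af_map]
  intro y
  obtain ⟨U, hU, hU'⟩ := hf y
  refine ⟨U, hU, ?_⟩
  rw [IntegrableOn, Measure.restrict_smul]
  exact Integrable.smul_measure hU' ENNReal.ofReal_ne_top

lemma af_ball {n : ℕ} (x : EE n) {s : ℝ} (hs : s ≠ 0) (y : EE n) (r : ℝ) :
    ball y r = (af x hs) ⁻¹' (ball (x + s • y) (|s| * r)) := by
  ext z
  rw [Set.mem_preimage, mem_ball, mem_ball, af_apply, dist_add_left, dist_smul₀, Real.norm_eq_abs,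
    mul_lt_mul_iff_right₀ (abs_pos.2 hs)]

lemma af_int {n : ℕ} (x : EE n) {s : ℝ} (hs : s ≠ 0) (f : EE n → ℝ) (y : EE n) (r : ℝ) :
    ∫ z in ball y r, f (x + s • z) = kap n s * ∫ w in ball (x + s • y) (|s| * r), f w := by
  have h := (af x hs).measurableEmbedding.setIntegral_map (μ := volume) f (ball (x + s • y) (|s| * r))
  rw [af_map, ← af_ball, Measure.restrict_smul, integral_smul_measure, ENNReal.toReal_ofReal (kap_pos n hs).le] at h
  exact h.symm

lemma af_avg {n : ℕ} (x : EE n) {s : ℝ} (hs : s ≠ 0) (f : EE n → ℝ) (y : EE n) (r : ℝ) :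
    ⨍ z in ball y r, f (x + s • z) = ⨍ w in ball (x + s • y) (|s| * r), f w := by
  have h1 := af_int x hs (fun _ => (1:ℝ)) y r
  simp only [setIntegral_const, smul_eq_mul, mul_one] at h1
  have := kap_pos n hs
  rw [setAverage_eq, setAverage_eq, af_int x hs, h1, smul_eq_mul, smul_eq_mul]
  field_simp

lemma af_bmo {n : ℕ} (x : EE n) {s : ℝ} (hs : s ≠ 0) {f : EE n → ℝ} {M : ℝ} (hf : IsBMOBound f M) :
    IsBMOBound (fun z => f (x + s • z)) M := by
  intro y r hr
  rw [af_avg x hs f, af_avg x hs (fun w => |f w - ⨍ z in ball (x + s • y) (|s| * r), f z|)]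
  exact hf _ _ (by positivity)

lemma bmo_nonneg {n : ℕ} {f : EE n → ℝ} {M : ℝ} (hf : IsBMOBound f M) : 0 ≤ M := by
  refine le_trans ?_ (hf 0 1 one_pos)
  rw [setAverage_eq]
  exact smul_nonneg (by positivity) (integral_nonneg fun _ => abs_nonneg _)

/-- dyadic ball -/
abbrev Bk (n k : ℕ) : Set (EE n) := ball 0 (2 ^ k)
/-- volume of dyadic ball -/
noncomputable def Vk (n k : ℕ) : ℝ := volume.real (Bk n k)

lemma Vk_pos (n k : ℕ) : 0 < Vk n k :=
  ENNReal.toReal_pos (measure_ball_pos volume 0 (by positivity)).ne' measure_ball_lt_top.ne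

lemma Vk_eq (n k : ℕ) : Vk n k = (2 ^ k) ^ n * Vk n 0 := by
  have h := af_int (0 : EE n) (s := 2 ^ k) (by positivity) (fun _ => (1:ℝ)) 0 1
  simp only [setIntegral_const, smul_eq_mul, mul_one, smul_zero, add_zero, kap] at h
  have h0 : (0:ℝ) < 2 ^ k := by positivity
  rw [abs_of_pos h0, abs_of_pos (by positivity)] at h
  unfold Vk Bk
  rw [pow_zero, h]
  field_simp

lemma Bk_int {n : ℕ} {f : EE n → ℝ} (hf : LocallyIntegrable f) (k : ℕ) : IntegrableOn f (Bk n k) :=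
  (hf.integrableOn_isCompact (isCompact_closedBall (0 : EE n) (2 ^ k))).mono_set ball_subset_closedBall

lemma Bk_int_c {n : ℕ} {f : EE n → ℝ} (hf : LocallyIntegrable f) (k : ℕ) (c : ℝ) : IntegrableOn (fun x => f x - c) (Bk n k) :=
  isub (Bk_int hf k) (integrableOn_const measure_ball_lt_top.ne)

lemma osc {n : ℕ} {f : EE n → ℝ} {M : ℝ} (hf : LocallyIntegrable f) (hM : IsBMOBound f M) :
    ∃ c : ℝ, ∀ k : ℕ, ∫ x in Bk n k, |f x - c| ≤ (1 + k) * 2 ^ n * M * Vk n k := by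
  have M0 := bmo_nonneg hM
  let c : ℕ → ℝ := fun k => ⨍ x in Bk n k, f x
  have hc : ∀ k, c k * Vk n k = ∫ x in Bk n k, f x := by
    intro k
    have := Vk_pos n k
    simp only [c]
    rw [setAverage_eq, smul_eq_mul]
    change (Vk n k)⁻¹ * _ * _ = _
    field_simp
  have h1 : ∀ k, ∫ x in Bk n k, |f x - c k| ≤ M * Vk n k := by
    intro k
    have h := hM 0 (2 ^ k) (by positivity)
    have := Vk_pos n k
    rw [setAverage_eq, smul_eq_mul] at h
    change (Vk n k)⁻¹ * (∫ x in Bk n k, |f x - c k|) ≤ M at h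
    rwa [inv_mul_le_iff₀ this, mul_comm] at h
  have h2 : ∀ k, |c k - c (k+1)| ≤ 2 ^ n * M := by
    intro k
    have hV := Vk_pos n k
    have e : (c k - c (k+1)) * Vk n k = ∫ x in Bk n k, (f x - c (k+1)) := by
      rw [integral_sub (Bk_int hf k) (integrableOn_const measure_ball_lt_top.ne), sub_mul, hc, setIntegral_const, smul_eq_mul, mul_comm (c (k+1))]
      rfl
    have e2 : |c k - c (k+1)| * Vk n k ≤ 2 ^ n * M * Vk n k := by
      calc |c k - c (k+1)| * Vk n k = |∫ x in Bk n k, (f x - c (k+1))| := by rw [← e, abs_mul, abs_of_pos hV]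
        _ ≤ ∫ x in Bk n k, |f x - c (k+1)| := abs_integral_le_integral_abs
        _ ≤ ∫ x in Bk n (k+1), |f x - c (k+1)| := by
            refine setIntegral_mono_set (Bk_int_c hf (k+1) _).abs (Filter.Eventually.of_forall fun _ => abs_nonneg _)
              (LE.le.eventuallyLE (ball_subset_ball ?_))
            exact pow_le_pow_right₀ (by norm_num) (by omega)
        _ ≤ M * Vk n (k+1) := h1 _
        _ = 2 ^ n * M * Vk n k := by rw [Vk_eq n (k+1), Vk_eq n k, pow_succ, mul_pow]; ring
    exact le_of_mul_le_mul_right e2 hV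
  have h3 : ∀ k : ℕ, |c k - c 0| ≤ k * (2 ^ n * M) := by
    intro k
    induction k with
    | zero => simp
    | succ k ih =>
      have := abs_sub_le (c (k+1)) (c k) (c 0)
      have := h2 k
      rw [abs_sub_comm] at this
      push_cast
      linarith
  refine ⟨c 0, fun k => ?_⟩
  have hV := Vk_pos n k
  have i1 := (Bk_int_c hf k (c k)).abs
  have i2 : IntegrableOn (fun _ : EE n => |c k - c 0|) (Bk n k) := integrableOn_const measure_ball_lt_top.ne
  calc ∫ x in Bk n k, |f x - c 0| ≤ ∫ x in Bk n k, (|f x - c k| + |c k - c 0|) :=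
        integral_mono (Bk_int_c hf k (c 0)).abs (iadd i1 i2) fun x => abs_sub_le _ _ _
    _ = (∫ x in Bk n k, |f x - c k|) + |c k - c 0| * Vk n k := by
        rw [integral_add i1 i2, setIntegral_const, smul_eq_mul, mul_comm |c k - c 0|]; rfl
    _ ≤ M * Vk n k + k * (2 ^ n * M) * Vk n k := add_le_add (h1 k) (mul_le_mul_of_nonneg_right (h3 k) hV.le)
    _ ≤ (1 + k) * 2 ^ n * M * Vk n k := by
        have h2n : (1:ℝ) ≤ 2 ^ n := one_le_pow₀ (by norm_num)
        have : 0 ≤ (2 ^ n - 1) * (M * Vk n k) := by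
          apply mul_nonneg (by linarith) (by positivity)
        linarith

lemma dy {r : ℝ} (hr : 0 ≤ r) : ∃ k : ℕ, r < 2 ^ k ∧ (2:ℝ) ^ k ≤ 2 * (1 + r) := by
  have h : ∃ k : ℕ, r < 2 ^ k := pow_unbounded_of_one_lt r (by norm_num)
  classical
  refine ⟨Nat.find h, Nat.find_spec h, ?_⟩
  rcases hk : Nat.find h with _ | j
  · simp; linarith
  · have := Nat.find_min h (m := j) (by omega)
    rw [pow_succ]
    linarith

lemma rho_bound (n : ℕ) : ∃ K : ℝ, 0 < K ∧ ∀ z : EE n, ∃ k : ℕ, z ∈ Bk n k ∧ rho z ≤ K * ((1/2) ^ k) ^ (n+1) := by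
  obtain ⟨C, hC⟩ := pow_mul_exp_bound (n+1)
  have hR := inv_pos.2 (gau_int_pos n)
  set R := (∫ y : EE n, gau y)⁻¹ with hRd
  have hC1 : 0 < C := by
    have := hC 0 le_rfl
    simp at this
    linarith
  refine ⟨R * C * 2 ^ (n+1), by positivity, fun z => ?_⟩
  obtain ⟨k, hk, hk'⟩ := dy (norm_nonneg z)
  refine ⟨k, by simpa using hk, ?_⟩
  have h1 := hC ‖z‖ (norm_nonneg z)
  have h2 : C * Real.exp (-(1/4) * ‖z‖^2) ≤ C := by
    have : Real.exp (-(1/4) * ‖z‖^2) ≤ 1 := Real.exp_le_one_iff.2 (by nlinarith [sq_nonneg ‖z‖])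
    nlinarith
  have h3 : (1 + ‖z‖) ^ (n+1) * gau z ≤ C := h1.trans h2
  have h4 : ((2:ℝ) ^ k) ^ (n+1) ≤ 2 ^ (n+1) * (1 + ‖z‖) ^ (n+1) := by
    rw [← mul_pow]
    exact pow_le_pow_left₀ (by positivity) hk' _
  have hg := gau_pos z
  have h5 : ((2:ℝ) ^ k) ^ (n+1) * gau z ≤ 2 ^ (n+1) * C := by
    calc _ ≤ (2 ^ (n+1) * (1 + ‖z‖) ^ (n+1)) * gau z := mul_le_mul_of_nonneg_right h4 hg.le
      _ = 2 ^ (n+1) * ((1 + ‖z‖) ^ (n+1) * gau z) := by ring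
      _ ≤ _ := mul_le_mul_of_nonneg_left h3 (by positivity)
  have h6 : gau z ≤ 2 ^ (n+1) * C * ((1/2) ^ k) ^ (n+1) := by
    rw [one_div, inv_pow, inv_pow, ← div_eq_mul_inv, le_div_iff₀ (by positivity), mul_comm]
    exact h5
  calc rho z = R * gau z := rfl
    _ ≤ R * (2 ^ (n+1) * C * ((1/2) ^ k) ^ (n+1)) := mul_le_mul_of_nonneg_left h6 hR.le
    _ = _ := by ring

lemma summ : Summable fun k : ℕ => (1 + (k:ℝ)) * (1/2) ^ k := by
  have h1 : Summable fun k : ℕ => ((1:ℝ)/2) ^ k := summable_geometric_of_lt_one (by norm_num) (by norm_num)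
  have h2 : Summable fun k : ℕ => (k:ℝ) * (1/2) ^ k := by
    have := summable_pow_mul_geometric_of_norm_lt_one 1 (r := (1/2 : ℝ)) (by norm_num)
    simpa using this
  refine (h1.add h2).congr fun k => ?_
  ring

lemma bmo_unit (n : ℕ) : ∃ C : ℝ, 0 < C ∧ ∀ (f : EE n → ℝ) (M : ℝ), Measurable f → LocallyIntegrable f → IsBMOBound f M →
    ∃ c : ℝ, ∫⁻ z, ‖f z - c‖ₑ ∂(gam n) ≤ ENNReal.ofReal (C * M) := by
  obtain ⟨K, hK, hK'⟩ := rho_bound n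
  have hS : 0 < ∑' k : ℕ, (1 + (k:ℝ)) * (1/2) ^ k := summ.tsum_pos (fun k => by positivity) 0 (by simp)
  have hV := Vk_pos n 0
  refine ⟨K * 2 ^ n * Vk n 0 * ∑' k : ℕ, (1 + (k:ℝ)) * (1/2) ^ k, by positivity, fun f M hfm hf hM => ?_⟩
  have M0 := bmo_nonneg hM
  obtain ⟨c, hc⟩ := osc hf hM
  refine ⟨c, ?_⟩
  let w : ℕ → ℝ := fun k => K * ((1/2) ^ k) ^ (n+1)
  have w0 : ∀ k, 0 ≤ w k := fun k => by simp only [w]; positivity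
  have mg : Measurable fun z => ‖f z - c‖ₑ := (hfm.sub_const c).enorm
  calc ∫⁻ z, ‖f z - c‖ₑ ∂(gam n) = ∫⁻ z, ENNReal.ofReal (rho z) * ‖f z - c‖ₑ := by
        have hr : Measurable fun z : EE n => ENNReal.ofReal (rho z) := rho_cont.measurable.ennreal_ofReal
        rw [gam, lintegral_withDensity_eq_lintegral_mul _ hr mg]
        rfl
    _ ≤ ∫⁻ z, ∑' k, (Bk n k).indicator (fun z => ENNReal.ofReal (w k) * ‖f z - c‖ₑ) z := by
        refine lintegral_mono fun z => ?_
        obtain ⟨k, hk, hk'⟩ := hK' z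
        refine le_trans ?_ (ENNReal.le_tsum k)
        rw [Set.indicator_of_mem hk]
        gcongr
    _ = ∑' k, ∫⁻ z, (Bk n k).indicator (fun z => ENNReal.ofReal (w k) * ‖f z - c‖ₑ) z :=
        lintegral_tsum fun k => ((mg.const_mul _).indicator measurableSet_ball).aemeasurable
    _ = ∑' k, ENNReal.ofReal (w k) * ENNReal.ofReal (∫ z in Bk n k, |f z - c|) := by
        congr 1; ext k
        rw [lintegral_indicator measurableSet_ball, lintegral_const_mul _ mg]
        congr 1
        exact (ofReal_integral_norm_eq_lintegral_enorm (Bk_int_c hf k c)).symm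
    _ ≤ ∑' k : ℕ, ENNReal.ofReal (K * 2 ^ n * Vk n 0 * M * ((1 + (k:ℝ)) * (1/2) ^ k)) := by
        refine ENNReal.tsum_le_tsum fun k => ?_
        rw [← ENNReal.ofReal_mul (w0 k)]
        refine ENNReal.ofReal_le_ofReal ?_
        calc w k * ∫ z in Bk n k, |f z - c| ≤ w k * ((1 + k) * 2 ^ n * M * Vk n k) := mul_le_mul_of_nonneg_left (hc k) (w0 k)
          _ = K * 2 ^ n * Vk n 0 * M * ((1 + (k:ℝ)) * (1/2) ^ k) * ((1/2) ^ k * 2 ^ k) ^ n := by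
              simp only [w]; rw [Vk_eq, mul_pow]; ring
          _ = _ := by rw [← mul_pow]; norm_num
    _ = ENNReal.ofReal (K * 2 ^ n * Vk n 0 * (∑' k : ℕ, (1 + (k:ℝ)) * (1/2) ^ k) * M) := by
        rw [← ENNReal.ofReal_tsum_of_nonneg (fun k => by positivity) (summ.mul_left _), tsum_mul_left]
        congr 1; ring

lemma bmo_OO (n : ℕ) : ∃ C : ℝ, 0 < C ∧ ∀ (f : EE n → ℝ) (M : ℝ), Measurable f → LocallyIntegrable f → IsBMOBound f M →
    OO f (C * M) := by
  obtain ⟨C, hC, h⟩ := bmo_unit n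
  refine ⟨C, hC, fun f M hfm hf hM s x => ?_⟩
  by_cases hs : s = 0
  · exact ⟨f x, by simp [hs]⟩
  · exact h _ M (hfm.comp (by fun_prop)) (af_li x hs hf) (af_bmo x hs hM)

/-- the BMO commutator bound in additive form -/
lemma core5 (n : ℕ) : ∃ C : ℝ, 0 < C ∧ ∀ (b u ψ : EE n → ℝ) (M : ℝ), LocallyIntegrable b → IsBMOBound b M →
    ContDiff ℝ 1 u → HasCompactSupport u → ContDiff ℝ 1 ψ → HasCompactSupport ψ → ∀ i j,
    |∫ x, b x * JJ u ψ i j x| ≤ C * M * (Di u + Di ψ) := by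
  obtain ⟨C, hC, h⟩ := bmo_OO n
  refine ⟨480 * (n + 1) * C, by positivity, fun b u ψ M hb hM hu hu' hψ hψ' i j => ?_⟩
  have M0 := bmo_nonneg hM
  have hD : ∀ u : EE n → ℝ, 0 ≤ Di u := fun u => Finset.sum_nonneg fun d _ => integral_nonneg fun x => sq_nonneg _
  have hae := hb.aestronglyMeasurable
  let b' := hae.mk b
  have e : b =ᵐ[volume] b' := hae.ae_eq_mk
  have mb : Measurable b' := hae.stronglyMeasurable_mk.measurable
  have lb : LocallyIntegrable b' := hb.congr e
  have bM : IsBMOBound b' M := by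
    intro x r hr
    have e1 : ∀ x r, ⨍ z in ball x r, b' z = ⨍ z in ball x r, b z := fun x r => by
      rw [setAverage_eq, setAverage_eq, setIntegral_congr_ae measurableSet_ball (e.mono fun z hz _ => hz)]
    have := hM x r hr
    rw [e1]
    refine le_trans (le_of_eq ?_) this
    generalize (⨍ z in ball x r, b z) = c
    have e3 : ∫ y in ball x r, |b' y - c| = ∫ y in ball x r, |b y - c| :=
      setIntegral_congr_ae measurableSet_ball (e.mono fun z hz _ => by rw [hz])
    rw [setAverage_eq, setAverage_eq]
    rw [e3]
  have e2 : ∫ x, b x * JJ u ψ i j x = ∫ x, b' x * JJ u ψ i j x :=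
    integral_congr_ae (e.mono fun z hz => by simp only; rw [hz])
  rw [e2]
  have key : ∀ ε : ℝ, 0 < ε → |∫ x, b' x * JJ u ψ i j x| ≤ 480 * n * (C * M + ε) * (Di u + Di ψ) := by
    intro ε hε
    refine core4 hu hu' hψ hψ' mb lb (by positivity) ?_ i j
    intro s x
    obtain ⟨c, hc⟩ := h b' M mb lb bM s x
    exact ⟨c, hc.trans (ENNReal.ofReal_le_ofReal (by linarith))⟩
  have lim : |∫ x, b' x * JJ u ψ i j x| ≤ 480 * n * (C * M + 0) * (Di u + Di ψ) := by
    refine ge_of_tendsto (x := nhdsWithin (0:ℝ) (Set.Ioi 0)) (f := fun ε => 480 * n * (C * M + ε) * (Di u + Di ψ)) ?_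
      (by filter_upwards [self_mem_nhdsWithin] with ε hε using key ε hε)
    have : Continuous fun ε : ℝ => 480 * n * (C * M + ε) * (Di u + Di ψ) := by fun_prop
    exact (this.tendsto 0).mono_left nhdsWithin_le_nhds
  refine lim.trans ?_
  have := hD u
  have := hD ψ
  rw [add_zero, mul_assoc (480 * ((n:ℝ) + 1))]
  gcongr
  linarith

end BmoAux

namespace BmoAux

lemma opt {I K x y : ℝ} (hK : 0 ≤ K) (hx : 0 ≤ x) (hy : 0 ≤ y) (h : ∀ t : ℝ, 0 < t → I ≤ K * (t ^ 2 * x ^ 2 + (t⁻¹) ^ 2 * y ^ 2)) :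
    I ≤ 2 * K * x * y := by
  have key : ∀ ε : ℝ, 0 < ε → I ≤ K * ((y + ε) * x + (x + ε) * y) := by
    intro ε hε
    have hx' : 0 < x + ε := by linarith
    have hy' : 0 < y + ε := by linarith
    refine (h (√((y + ε) / (x + ε))) (by positivity)).trans ?_
    rw [inv_pow, Real.sq_sqrt (by positivity)]
    refine mul_le_mul_of_nonneg_left (add_le_add ?_ ?_) hK
    · rw [div_mul_eq_mul_div, div_le_iff₀ hx']
      have : 0 ≤ (y + ε) * x * ε := by positivity
      nlinarith
    · rw [inv_div, div_mul_eq_mul_div, div_le_iff₀ hy']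
      have : 0 ≤ (x + ε) * y * ε := by positivity
      nlinarith
  have lim : I ≤ K * ((y + 0) * x + (x + 0) * y) := by
    refine ge_of_tendsto (x := nhdsWithin (0:ℝ) (Set.Ioi 0)) (f := fun ε => K * ((y + ε) * x + (x + ε) * y)) ?_
      (by filter_upwards [self_mem_nhdsWithin] with ε hε using key ε hε)
    have : Continuous fun ε : ℝ => K * ((y + ε) * x + (x + ε) * y) := by fun_prop
    exact (this.tendsto 0).mono_left nhdsWithin_le_nhds
  linarith

lemma Di_nonneg {n : ℕ} (u : EE n → ℝ) : 0 ≤ Di u := Finset.sum_nonneg fun d _ => integral_nonneg fun x => sq_nonneg _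

lemma DD_smul {n : ℕ} {u : EE n → ℝ} (hu : ContDiff ℝ 1 u) (c : ℝ) (k : Fin n) (x : EE n) :
    DD k (fun y => c * u y) x = c * DD k u x := by
  unfold DD
  rw [fderiv_const_mul (hu.differentiable (by norm_num)).differentiableAt]
  rfl

lemma Di_smul {n : ℕ} {u : EE n → ℝ} (hu : ContDiff ℝ 1 u) (c : ℝ) : Di (fun y => c * u y) = c ^ 2 * Di u := by
  unfold Di
  rw [Finset.mul_sum]
  refine Finset.sum_congr rfl fun d _ => ?_
  rw [← integral_const_mul]
  congr 1; ext x
  rw [DD_smul hu, mul_pow]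

lemma grad_le {n : ℕ} (u : EE n → ℝ) (x : EE n) : ∑ d, DD d u x ^ 2 ≤ ‖fderiv ℝ u x‖ ^ 2 := by
  let v : EE n := WithLp.toLp 2 fun d => DD d u x
  have hv : ‖v‖ ^ 2 = ∑ d, DD d u x ^ 2 := by
    rw [EuclideanSpace.norm_sq_eq]
    simp [v]
  have h1 : fderiv ℝ u x v = ‖v‖ ^ 2 := by
    rw [fderiv_apply_sum, hv]
    simp [v, pow_two]
  have h2 : ‖v‖ ^ 2 ≤ ‖fderiv ℝ u x‖ * ‖v‖ := by
    rw [← h1]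
    exact (le_abs_self _).trans ((fderiv ℝ u x).le_opNorm v)
  rw [← hv]
  have h3 : ‖v‖ ≤ ‖fderiv ℝ u x‖ := by
    by_contra h
    push Not at h
    nlinarith [norm_nonneg v, norm_nonneg (fderiv ℝ u x)]
  exact pow_le_pow_left₀ (norm_nonneg _) h3 2

lemma DD_sq_int {n : ℕ} {u : EE n → ℝ} (hu : ContDiff ℝ 1 u) (hu' : HasCompactSupport u) (d : Fin n) :
    Integrable fun x => DD d u x ^ 2 := by
  have := ((contDiff_DD_of hu d).mul (contDiff_DD_of hu d)).integrable_of_hasCompactSupport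
    (HasCompactSupport.mul_left (f := DD d u) (DD_cs hu' d)) (μ := volume)
  simp only [pow_two]
  exact this

lemma Di_le {n : ℕ} {u : EE n → ℝ} (hu : ContDiff ℝ 1 u) (hu' : HasCompactSupport u) :
    Di u ≤ (eLpNorm (fun x => ‖fderiv ℝ u x‖) 2 volume).toReal ^ 2 := by
  have hc : Continuous fun x => ‖fderiv ℝ u x‖ := (hu.continuous_fderiv (by norm_num)).norm
  have hs : HasCompactSupport fun x => ‖fderiv ℝ u x‖ := (hu'.fderiv ℝ).norm
  have hm : MemLp (fun x => ‖fderiv ℝ u x‖) 2 volume := hc.memLp_of_hasCompactSupport hs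
  have hi : Integrable fun x => ‖fderiv ℝ u x‖ ^ 2 := by
    have := (hc.mul hc).integrable_of_hasCompactSupport (HasCompactSupport.mul_left (f := fun x => ‖fderiv ℝ u x‖) hs) (μ := volume)
    simp only [pow_two]
    exact this
  have h0 : 0 ≤ ∫ x, ‖fderiv ℝ u x‖ ^ 2 := integral_nonneg fun x => sq_nonneg _
  have e : (eLpNorm (fun x => ‖fderiv ℝ u x‖) 2 volume).toReal ^ 2 = ∫ x, ‖fderiv ℝ u x‖ ^ 2 := by
    rw [hm.eLpNorm_eq_integral_rpow_norm (by norm_num) (by norm_num)]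
    simp only [ENNReal.toReal_ofNat, norm_norm, Real.rpow_two]
    rw [ENNReal.toReal_ofReal (Real.rpow_nonneg h0 _), ← Real.rpow_natCast, ← Real.rpow_mul h0]
    norm_num
  rw [e]
  unfold Di
  rw [← integral_finsetSum _ fun d _ => DD_sq_int hu hu' d]
  exact integral_mono (integrable_finsetSum _ fun d _ => DD_sq_int hu hu' d) hi fun x => grad_le u x

lemma quad {n : ℕ} {A : Fin n → Fin n → ℝ} {lam : ℝ} (hlam : 0 < lam) (hs : ∀ i j, A i j = A j i)
    (hA : ∀ ξ : Fin n → ℝ, lam * (∑ i, ξ i ^ 2) ≤ ∑ i, ∑ j, A i j * ξ i * ξ j ∧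
        ∑ i, ∑ j, A i j * ξ i * ξ j ≤ lam⁻¹ * (∑ i, ξ i ^ 2)) (p q : Fin n → ℝ) :
    |∑ i, ∑ j, A i j * p j * q i| ≤ lam⁻¹ / 2 * ((∑ i, p i ^ 2) + ∑ i, q i ^ 2) := by
  have hl : 0 < lam⁻¹ := inv_pos.2 hlam
  have sw : ∑ i, ∑ j, A i j * p i * q j = ∑ i, ∑ j, A i j * p j * q i := by
    rw [Finset.sum_comm]
    refine Finset.sum_congr rfl fun i _ => Finset.sum_congr rfl fun j _ => ?_
    rw [hs]
  have ex : ∀ ε : ℝ, ∑ i, ∑ j, A i j * (p i + ε * q i) * (p j + ε * q j) =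
      (∑ i, ∑ j, A i j * p i * p j) + 2 * ε * (∑ i, ∑ j, A i j * p j * q i) + ε ^ 2 * ∑ i, ∑ j, A i j * q i * q j := by
    intro ε
    have : 2 * ε * (∑ i, ∑ j, A i j * p j * q i) = ε * (∑ i, ∑ j, A i j * p j * q i) + ε * ∑ i, ∑ j, A i j * p i * q j := by
      rw [sw]; ring
    rw [this]
    simp only [Finset.mul_sum, ← Finset.sum_add_distrib]
    refine Finset.sum_congr rfl fun i _ => Finset.sum_congr rfl fun j _ => ?_
    ring
  have sq : ∀ ε : ℝ, ∑ i, (p i + ε * q i) ^ 2 = (∑ i, p i ^ 2) + 2 * ε * (∑ i, p i * q i) + ε ^ 2 * ∑ i, q i ^ 2 := by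
    intro ε
    simp only [Finset.mul_sum, ← Finset.sum_add_distrib]
    refine Finset.sum_congr rfl fun i _ => ?_
    ring
  have up := fun ε : ℝ => (hA fun i => p i + ε * q i).2
  have lo : ∀ ε : ℝ, 0 ≤ ∑ i, ∑ j, A i j * (p i + ε * q i) * (p j + ε * q j) := fun ε =>
    le_trans (mul_nonneg hlam.le (Finset.sum_nonneg fun i _ => sq_nonneg _)) (hA fun i => p i + ε * q i).1
  have n1 : 0 ≤ ∑ i, (p i + 1 * q i) ^ 2 := Finset.sum_nonneg fun i _ => sq_nonneg _
  have n2 : 0 ≤ ∑ i, (p i + (-1) * q i) ^ 2 := Finset.sum_nonneg fun i _ => sq_nonneg _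
  have u1 := up 1
  have u2 := up (-1)
  have l1 := lo 1
  have l2 := lo (-1)
  simp only [ex] at u1 u2 l1 l2
  rw [sq] at u1 u2 n1 n2
  set X := ∑ i, ∑ j, A i j * p j * q i
  set P := ∑ i, p i ^ 2
  set Q := ∑ i, q i ^ 2
  set R := ∑ i, p i * q i
  have a1 : 2 * R ≤ P + Q := by linarith
  have a2 : -(2 * R) ≤ P + Q := by linarith
  have b1 := mul_le_mul_of_nonneg_left a1 hl.le
  have b2 := mul_le_mul_of_nonneg_left a2 hl.le
  rw [abs_le]
  constructor <;> nlinarith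

lemma a_part {n : ℕ} {a : EE n → Fin n → Fin n → ℝ} {lam : ℝ} (hlam : 0 < lam) (hs : ∀ x i j, a x i j = a x j i)
    (hA : ∀ x, ∀ ξ : Fin n → ℝ, lam * (∑ i, ξ i ^ 2) ≤ ∑ i, ∑ j, a x i j * ξ i * ξ j ∧
        ∑ i, ∑ j, a x i j * ξ i * ξ j ≤ lam⁻¹ * (∑ i, ξ i ^ 2))
    {u ψ : EE n → ℝ} (hu : ContDiff ℝ 1 u) (hu' : HasCompactSupport u)
    (hψ : ContDiff ℝ 1 ψ) (hψ' : HasCompactSupport ψ) :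
    |∫ x, ∑ i, ∑ j, a x i j * DD j u x * DD i ψ x| ≤ lam⁻¹ / 2 * (Di u + Di ψ) := by
  have iu : Integrable fun x => ∑ d, DD d u x ^ 2 := integrable_finsetSum _ fun d _ => DD_sq_int hu hu' d
  have iψ : Integrable fun x => ∑ d, DD d ψ x ^ 2 := integrable_finsetSum _ fun d _ => DD_sq_int hψ hψ' d
  have e : lam⁻¹ / 2 * (Di u + Di ψ) = ∫ x, lam⁻¹ / 2 * ((∑ d, DD d u x ^ 2) + ∑ d, DD d ψ x ^ 2) := by
    rw [integral_const_mul, integral_add iu iψ, integral_finsetSum _ fun d _ => DD_sq_int hu hu' d,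
      integral_finsetSum _ fun d _ => DD_sq_int hψ hψ' d]
    rfl
  rw [e, ← Real.norm_eq_abs]
  exact norm_integral_le_of_norm_le ((iadd iu iψ).const_mul _) (Filter.Eventually.of_forall fun x => quad hlam (hs x) (hA x) _ _)

lemma b_int {n : ℕ} {b : EE n → Fin n → Fin n → ℝ} (hb : ∀ i j, LocallyIntegrable fun x => b x i j)
    {u ψ : EE n → ℝ} (hu : ContDiff ℝ 1 u) (hψ : ContDiff ℝ 1 ψ) (hψ' : HasCompactSupport ψ) (i j : Fin n) :
    Integrable fun x => b x i j * DD j u x * DD i ψ x := by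
  have := JJ_int (hb i j) hu hψ hψ' i j
  simpa only [mul_assoc] using this

lemma b_part (n : ℕ) : ∃ C : ℝ, 0 < C ∧ ∀ (b : EE n → Fin n → Fin n → ℝ) (M : Fin n → Fin n → ℝ),
    (∀ i j, LocallyIntegrable fun x => b x i j) → (∀ x i j, b x i j = - b x j i) → (∀ i j, IsBMOBound (fun x => b x i j) (M i j)) →
    ∀ (u ψ : EE n → ℝ), ContDiff ℝ 1 u → HasCompactSupport u → ContDiff ℝ 1 ψ → HasCompactSupport ψ →
    |∫ x, ∑ i, ∑ j, b x i j * DD j u x * DD i ψ x| ≤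
      C * √(∑ i, ∑ j, if i < j then M i j ^ 2 else 0) * (Di u + Di ψ) := by
  obtain ⟨C, hC, h⟩ := core5 n
  refine ⟨(n * n + 1) * C, by positivity, fun b M hb hs hM u ψ hu hu' hψ hψ' => ?_⟩
  set R := √(∑ i, ∑ j, if i < j then M i j ^ 2 else 0) with hR
  have D0 : 0 ≤ Di u + Di ψ := add_nonneg (Di_nonneg u) (Di_nonneg ψ)
  have I := b_int hb hu hψ hψ'
  let T : Fin n → Fin n → ℝ := fun i j => ∫ x, b x i j * DD j u x * DD i ψ x
  have e : ∫ x, ∑ i, ∑ j, b x i j * DD j u x * DD i ψ x = ∑ i, ∑ j, T i j := by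
    rw [integral_finsetSum _ fun i _ => integrable_finsetSum _ fun j _ => I i j]
    exact Finset.sum_congr rfl fun i _ => integral_finsetSum _ fun j _ => I i j
  have hMR : ∀ i j, i < j → M i j ≤ R := by
    intro i j hij
    refine Real.le_sqrt_of_sq_le ?_
    have h0 : ∀ i j, 0 ≤ (if i < j then M i j ^ 2 else 0) := fun i j => by split_ifs <;> positivity
    calc M i j ^ 2 = if i < j then M i j ^ 2 else 0 := by rw [if_pos hij]
      _ ≤ ∑ j, if i < j then M i j ^ 2 else 0 :=
        Finset.single_le_sum (f := fun j => if i < j then M i j ^ 2 else 0) (fun j _ => h0 i j) (Finset.mem_univ j)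
      _ ≤ _ := Finset.single_le_sum (f := fun i => ∑ j, if i < j then M i j ^ 2 else 0)
        (fun i _ => Finset.sum_nonneg fun j _ => h0 i j) (Finset.mem_univ i)
  have R0 : 0 ≤ R := Real.sqrt_nonneg _
  have h1 : ∀ i j, i < j → |T i j + T j i| ≤ C * R * (Di u + Di ψ) := by
    intro i j hij
    have e1 : T i j + T j i = ∫ x, b x i j * JJ u ψ i j x := by
      simp only [T]
      rw [← integral_add (I i j) (I j i)]
      congr 1; ext x
      rw [hs x j i]
      simp only [JJ]
      ring
    rw [e1]
    refine (h (fun x => b x i j) u ψ (M i j) (hb i j) (hM i j) hu hu' hψ hψ' i j).trans ?_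
    refine mul_le_mul_of_nonneg_right (mul_le_mul_of_nonneg_left (hMR i j hij) hC.le) D0
  have h2 : ∀ i j, |T i j + T j i| ≤ C * R * (Di u + Di ψ) := by
    intro i j
    rcases lt_trichotomy i j with hij | hij | hij
    · exact h1 i j hij
    · subst hij
      have : ∀ x, b x i i = 0 := fun x => by have := hs x i i; linarith
      simp only [T, this, zero_mul, integral_zero, add_zero, abs_zero]
      positivity
    · rw [add_comm]; exact h1 j i hij
  have e2 : 2 * ∑ i, ∑ j, T i j = ∑ i, ∑ j, (T i j + T j i) := by
    simp only [Finset.sum_add_distrib]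
    rw [Finset.sum_comm (f := fun i j => T j i)]
    ring
  have h3 : |∑ i, ∑ j, (T i j + T j i)| ≤ n * (n * (C * R * (Di u + Di ψ))) := by
    refine (Finset.abs_sum_le_sum_abs _ _).trans ?_
    refine (Finset.sum_le_card_nsmul _ _ (n * (C * R * (Di u + Di ψ))) fun i _ => ?_).trans (le_of_eq (by simp))
    refine (Finset.abs_sum_le_sum_abs _ _).trans ?_
    exact (Finset.sum_le_card_nsmul _ _ (C * R * (Di u + Di ψ)) fun j _ => h2 i j).trans (le_of_eq (by simp))
  rw [e]
  rw [← e2, abs_mul, abs_of_pos (by norm_num : (0:ℝ) < 2)] at h3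
  have h4 : 0 ≤ C * R * (Di u + Di ψ) := by positivity
  have h5 : (0:ℝ) ≤ n * (n * (C * R * (Di u + Di ψ))) := by positivity
  have h6 : 0 ≤ |∑ i, ∑ j, T i j| := abs_nonneg _
  linarith

end BmoAux

/-- The functional `F_t(ψ) = ∫ ⟨A∇u, ∇ψ⟩`, with `A = a + b`, `a` symmetric
uniformly elliptic and `b` skew-symmetric with entries in BMO, is bounded on `H¹`:
`|F_t(ψ)| ≤ (λ⁻¹ + C B) ‖∇u‖₂ ‖∇ψ‖₂`, where `C = C(n)` and
`B = sup_t ‖b(·,t)‖_BMO`. -/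
theorem bounded_functional_of_elliptic_bmo (n : ℕ) :
    ∃ C > (0 : ℝ), ∀ (lam : ℝ), 0 < lam →
      ∀ (a b : ℝ → EuclideanSpace ℝ (Fin n) → Fin n → Fin n → ℝ)
        (M : Fin n → Fin n → ℝ),
      -- a symmetric, uniformly elliptic
      (∀ t x i j, a t x i j = a t x j i) →
      (∀ (t : ℝ) (x : EuclideanSpace ℝ (Fin n)) (ξ : Fin n → ℝ),
        lam * (∑ i, ξ i ^ 2) ≤ ∑ i, ∑ j, a t x i j * ξ i * ξ j ∧
        ∑ i, ∑ j, a t x i j * ξ i * ξ j ≤ lam⁻¹ * (∑ i, ξ i ^ 2)) →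
      -- b skew-symmetric, entries in BMO uniformly in t
      (∀ t i j, LocallyIntegrable (fun x => b t x i j) volume) →
      (∀ t x i j, b t x i j = -(b t x j i)) →
      (∀ t i j, IsBMOBound (fun x => b t x i j) (M i j)) →
      ∀ (t : ℝ) (u ψ : EuclideanSpace ℝ (Fin n) → ℝ),
        ContDiff ℝ 1 u → HasCompactSupport u →
        ContDiff ℝ 1 ψ → HasCompactSupport ψ →
        |∫ x, ∑ i, ∑ j, (a t x i j + b t x i j)
            * fderiv ℝ u x (EuclideanSpace.single j 1)
            * fderiv ℝ ψ x (EuclideanSpace.single i 1)| ≤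
          (lam⁻¹ + C * Real.sqrt (∑ i, ∑ j, if i < j then M i j ^ 2 else 0))
            * (eLpNorm (fun x => ‖fderiv ℝ u x‖) 2 volume).toReal
            * (eLpNorm (fun x => ‖fderiv ℝ ψ x‖) 2 volume).toReal := by
  obtain ⟨C, hC, hb0⟩ := BmoAux.b_part n
  refine ⟨2 * C, by positivity, ?_⟩
  intro lam hlam a b M has hae hbl hbs hbM t u ψ hu hu' hψ hψ'
  have hl : 0 < lam⁻¹ := inv_pos.2 hlam
  set R := Real.sqrt (∑ i, ∑ j, if i < j then M i j ^ 2 else 0) with hR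
  have R0 : 0 ≤ R := Real.sqrt_nonneg _
  have main : ∀ u ψ : EuclideanSpace ℝ (Fin n) → ℝ, ContDiff ℝ 1 u → HasCompactSupport u → ContDiff ℝ 1 ψ → HasCompactSupport ψ →
      |∫ x, ∑ i, ∑ j, (a t x i j + b t x i j) * BmoAux.DD j u x * BmoAux.DD i ψ x| ≤
        (lam⁻¹ / 2 + C * R) * (BmoAux.Di u + BmoAux.Di ψ) := by
    intro u ψ hu hu' hψ hψ'
    have D0 : 0 ≤ BmoAux.Di u + BmoAux.Di ψ := add_nonneg (BmoAux.Di_nonneg u) (BmoAux.Di_nonneg ψ)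
    by_cases hi : Integrable (fun x => ∑ i, ∑ j, (a t x i j + b t x i j) * BmoAux.DD j u x * BmoAux.DD i ψ x)
    · have hB : Integrable (fun x => ∑ i, ∑ j, b t x i j * BmoAux.DD j u x * BmoAux.DD i ψ x) :=
        integrable_finsetSum _ fun i _ => integrable_finsetSum _ fun j _ => BmoAux.b_int (hbl t) hu hψ hψ' i j
      have e : ∀ x, ∑ i, ∑ j, (a t x i j + b t x i j) * BmoAux.DD j u x * BmoAux.DD i ψ x =
          (∑ i, ∑ j, a t x i j * BmoAux.DD j u x * BmoAux.DD i ψ x) + ∑ i, ∑ j, b t x i j * BmoAux.DD j u x * BmoAux.DD i ψ x := by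
        intro x
        simp only [← Finset.sum_add_distrib, add_mul]
      have hA : Integrable (fun x => ∑ i, ∑ j, a t x i j * BmoAux.DD j u x * BmoAux.DD i ψ x) := by
        have := BmoAux.isub hi hB
        refine this.congr (Filter.Eventually.of_forall fun x => ?_)
        simp only [e]
        ring
      simp only [e]
      rw [integral_add hA hB]
      refine (abs_add_le _ _).trans ?_
      rw [add_mul]
      exact add_le_add (BmoAux.a_part hlam (has t) (hae t) hu hu' hψ hψ')
        (hb0 (b t) M (hbl t) (hbs t) (hbM t) u ψ hu hu' hψ hψ')
    · rw [integral_undef hi, abs_zero]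
      positivity
  have hu2 := BmoAux.Di_le hu hu'
  have hψ2 := BmoAux.Di_le hψ hψ'
  have K0 : 0 ≤ lam⁻¹ / 2 + C * R := by positivity
  change |∫ x, ∑ i, ∑ j, (a t x i j + b t x i j) * BmoAux.DD j u x * BmoAux.DD i ψ x| ≤ _
  set U := (eLpNorm (fun x => ‖fderiv ℝ u x‖) 2 volume).toReal
  set V := (eLpNorm (fun x => ‖fderiv ℝ ψ x‖) 2 volume).toReal
  have fin := BmoAux.opt (I := |∫ x, ∑ i, ∑ j, (a t x i j + b t x i j) * BmoAux.DD j u x * BmoAux.DD i ψ x|)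
    K0 (x := U) (y := V) ENNReal.toReal_nonneg ENNReal.toReal_nonneg (fun s hs => by
      have h := main (fun y => s * u y) (fun y => s⁻¹ * ψ y) (contDiff_const.mul hu) (hu'.mul_left (f := fun _ => s))
        (contDiff_const.mul hψ) (hψ'.mul_left (f := fun _ => s⁻¹))
      rw [BmoAux.Di_smul hu, BmoAux.Di_smul hψ] at h
      have e : ∀ x, ∑ i, ∑ j, (a t x i j + b t x i j) * BmoAux.DD j (fun y => s * u y) x * BmoAux.DD i (fun y => s⁻¹ * ψ y) x =
          ∑ i, ∑ j, (a t x i j + b t x i j) * BmoAux.DD j u x * BmoAux.DD i ψ x := by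
        intro x
        refine Finset.sum_congr rfl fun i _ => Finset.sum_congr rfl fun j _ => ?_
        rw [BmoAux.DD_smul hu, BmoAux.DD_smul hψ]
        field_simp
      simp only [e] at h
      refine h.trans (mul_le_mul_of_nonneg_left (add_le_add ?_ ?_) K0)
      · exact mul_le_mul_of_nonneg_left hu2 (sq_nonneg _)
      · exact mul_le_mul_of_nonneg_left hψ2 (sq_nonneg _))
  refine fin.trans (le_of_eq ?_)
  ring
end

section
/- Let f ∈ BMO(ℝⁿ) and B(0,r), B(0,1) the balls of radius r ≥ 1 and 1 centered at the origin. Then the averages satisfy |f_{B(0,r)} − f_{B(0,1)}| ≤ rⁿ ‖f‖_BMO, and consequently f ∈ L^p_loc(ℝⁿ) for every 1 ≤ p < ∞ with, for every ball B(0,r), (1/|B(0,r)|)∫_{B(0,r)} |f − f_{B(0,r)}|^p dx ≤ C_p ‖f‖_BMO^p for a constant C_p depending only on n and p. -/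
open MeasureTheory Metric

section helpers

variable {n : ℕ}

lemma jn_vol (x : EuclideanSpace ℝ (Fin n)) {r : ℝ} (hr : 0 < r) :
    volume (ball x r) =
      ENNReal.ofReal (r ^ n) * volume (ball (0 : EuclideanSpace ℝ (Fin n)) 1) := by
  have := Measure.addHaar_ball_of_pos volume x hr
  simpa using this

lemma jn_vol_scale (x y : EuclideanSpace ℝ (Fin n)) {r a : ℝ} (hr : 0 < r) (ha : 0 < a) :
    volume (ball x (a * r)) = ENNReal.ofReal (a ^ n) * volume (ball y r) := by
  rw [jn_vol x (mul_pos ha hr), jn_vol y hr, mul_pow, ENNReal.ofReal_mul (by positivity), mul_assoc]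

lemma jn_volr_scale (x y : EuclideanSpace ℝ (Fin n)) {r a : ℝ} (hr : 0 < r) (ha : 0 < a) :
    volume.real (ball x (a * r)) = a ^ n * volume.real (ball y r) := by
  rw [measureReal_def, jn_vol_scale x y hr ha, ENNReal.toReal_mul,
    ENNReal.toReal_ofReal (by positivity), measureReal_def]

lemma jn_volr_pos (x : EuclideanSpace ℝ (Fin n)) {r : ℝ} (hr : 0 < r) :
    0 < volume.real (ball x r) :=
  ENNReal.toReal_pos (measure_ball_pos volume x hr).ne' measure_ball_lt_top.ne

lemma jn_intOn {f : EuclideanSpace ℝ (Fin n) → ℝ} (hf : LocallyIntegrable f volume)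
    (x : EuclideanSpace ℝ (Fin n)) (r : ℝ) : IntegrableOn f (ball x r) volume :=
  (hf.integrableOn_isCompact (isCompact_closedBall x r)).mono_set ball_subset_closedBall

lemma jn_locInt {f : EuclideanSpace ℝ (Fin n) → ℝ} (hf : LocallyIntegrable f volume) (c : ℝ) :
    LocallyIntegrable (fun y => |f y - c|) volume :=
  fun x => ((hf.sub (locallyIntegrable_const c)) x).norm

/-- integral form of a bound on an average -/
lemma jn_avg_mul (g : EuclideanSpace ℝ (Fin n) → ℝ) (x : EuclideanSpace ℝ (Fin n)) {r : ℝ}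
    (hr : 0 < r) :
    (⨍ y in ball x r, g y) * volume.real (ball x r) = ∫ y in ball x r, g y := by
  have := jn_volr_pos x hr
  rw [setAverage_eq, smul_eq_mul]
  field_simp

lemma jn_avg_sub {f : EuclideanSpace ℝ (Fin n) → ℝ} (hf : LocallyIntegrable f volume)
    (x : EuclideanSpace ℝ (Fin n)) {r : ℝ} (hr : 0 < r) (c : ℝ) :
    |(⨍ y in ball x r, f y) - c| ≤ ⨍ y in ball x r, |f y - c| := by
  have hv := jn_volr_pos x hr
  have h1 : ((⨍ y in ball x r, f y) - c) * volume.real (ball x r)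
      = ∫ y in ball x r, (f y - c) := by
    rw [integral_sub (jn_intOn hf x r) (integrableOn_const measure_ball_lt_top.ne), sub_mul, jn_avg_mul f x hr]
    simp [mul_comm]
  refine le_of_mul_le_mul_right ?_ hv
  rw [jn_avg_mul _ x hr]
  calc |(⨍ y in ball x r, f y) - c| * volume.real (ball x r)
      = |((⨍ y in ball x r, f y) - c) * volume.real (ball x r)| := by
        rw [abs_mul, abs_of_pos hv]
    _ ≤ _ := by rw [h1]; exact abs_integral_le_integral_abs

lemma jn_avg_sub_mono {f : EuclideanSpace ℝ (Fin n) → ℝ} (hf : LocallyIntegrable f volume)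
    (x y : EuclideanSpace ℝ (Fin n)) {r a : ℝ} (hr : 0 < r) (ha : 0 < a)
    (hs : ball y r ⊆ ball x (a * r)) (c : ℝ) :
    (⨍ z in ball y r, |f z - c|) ≤ a ^ n * ⨍ z in ball x (a * r), |f z - c| := by
  have hv := jn_volr_pos y hr
  refine le_of_mul_le_mul_right ?_ hv
  rw [jn_avg_mul _ y hr, mul_right_comm, ← jn_volr_scale x y hr ha, mul_comm (volume.real _),
    jn_avg_mul _ x (mul_pos ha hr)]
  exact setIntegral_mono_set (jn_intOn (jn_locInt hf c) _ _)
    (Filter.Eventually.of_forall fun _ => abs_nonneg _) hs.eventuallyLE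

lemma jn_compare {f : EuclideanSpace ℝ (Fin n) → ℝ} (hf : LocallyIntegrable f volume) {M : ℝ}
    (hb : IsBMOBound f M)
    (x : EuclideanSpace ℝ (Fin n)) {r a : ℝ} (hr : 0 < r) (ha : 1 ≤ a) :
    |(⨍ z in ball x (a * r), f z) - ⨍ z in ball x r, f z| ≤ a ^ n * M := by
  have ha0 : 0 < a := by linarith
  rw [abs_sub_comm]
  refine (jn_avg_sub hf x hr _).trans ((jn_avg_sub_mono hf x x hr ha0
    (ball_subset_ball (by nlinarith)) _).trans ?_)
  gcongr
  exact hb x _ (mul_pos ha0 hr)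

/-- average over the double ball of the oscillation w.r.t. the average over the ball -/
lemma jn_double {f : EuclideanSpace ℝ (Fin n) → ℝ} (hf : LocallyIntegrable f volume) {M : ℝ}
    (hb : IsBMOBound f M) (x : EuclideanSpace ℝ (Fin n)) {r : ℝ} (hr : 0 < r) :
    (⨍ y in ball x (2 * r), |f y - ⨍ z in ball x r, f z|) ≤ (1 + 2 ^ n) * M := by
  have hr2 : 0 < 2 * r := by linarith
  have hv := jn_volr_pos x hr2
  have h1 := jn_compare hf hb x hr (a := 2) (by norm_num)
  have h2 := hb x _ hr2
  set c := ⨍ z in ball x r, f z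
  set c2 := ⨍ z in ball x (2 * r), f z
  refine le_of_mul_le_mul_right ?_ hv
  rw [jn_avg_mul _ x hr2]
  have h3 : ∫ y in ball x (2 * r), |f y - c| ≤ ∫ y in ball x (2 * r), (|f y - c2| + |c2 - c|) := by
    refine integral_mono (jn_intOn (jn_locInt hf c) _ _)
      ((jn_intOn (jn_locInt hf c2) _ _).add (integrableOn_const measure_ball_lt_top.ne)) ?_
    intro y
    exact abs_sub_le _ _ _
  rw [integral_add (jn_intOn (jn_locInt hf c2) _ _) (integrableOn_const measure_ball_lt_top.ne),
    ← jn_avg_mul (fun y => |f y - c2|) x hr2] at h3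
  simp only [integral_const, smul_eq_mul, measureReal_restrict_apply_univ] at h3
  nlinarith

lemma jn_lebesgue {g : EuclideanSpace ℝ (Fin n) → ℝ} (hg : LocallyIntegrable g volume) {r : ℝ}
    (hr : 0 < r) : ∀ᵐ x, Filter.Tendsto (fun k : ℕ => ⨍ y in ball x (r / 6 ^ k), g y)
      Filter.atTop (nhds (g x)) := by
  filter_upwards [IsUnifLocDoublingMeasure.ae_tendsto_average volume hg 1] with x hx
  have hd : Filter.Tendsto (fun k : ℕ => r / 6 ^ k) Filter.atTop (nhdsWithin 0 (Set.Ioi 0)) := by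
    refine tendsto_nhdsWithin_iff.2 ⟨?_, Filter.Eventually.of_forall fun k => ?_⟩
    · have := (tendsto_pow_atTop_nhds_zero_of_lt_one (r := (1/6 : ℝ)) (by norm_num)
        (by norm_num)).const_mul r
      simpa [div_eq_mul_inv] using this
    · simp only [Set.mem_Ioi]; positivity
  have h := hx (fun _ : ℕ => x) (fun k => r / 6 ^ k) hd
    (Filter.Eventually.of_forall fun k => mem_closedBall_self (by positivity))
  refine h.congr fun k => ?_
  have hk : 0 < r / 6 ^ k := by positivity
  have : (ball x (r / 6 ^ k) : Set _) =ᵐ[volume] closedBall x (r / 6 ^ k) := by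
    refine ae_eq_of_subset_of_measure_ge ball_subset_closedBall ?_
      measurableSet_ball.nullMeasurableSet measure_closedBall_lt_top.ne
    rw [Measure.addHaar_closedBall volume x hk.le, Measure.addHaar_ball_of_pos volume x hk]
  rw [setAverage_congr this]

/-- the constant in the John--Nirenberg level sets -/
noncomputable def jnA (n : ℕ) : ℝ := 2 ^ n * (1 + 2 ^ n)

lemma jnA_pos (n : ℕ) : 0 < jnA n := by unfold jnA; positivity

lemma jn_select {f : EuclideanSpace ℝ (Fin n) → ℝ} (hf : LocallyIntegrable f volume) {L : ℝ}
    (c : ℝ) {r : ℝ} (hr : 0 < r) (y : EuclideanSpace ℝ (Fin n))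
    (h0 : (⨍ z in ball y r, |f z - c|) ≤ L)
    (hy : ∃ k : ℕ, L < ⨍ z in ball y (r / 6 ^ k), |f z - c|) :
    ∃ ρ : ℝ, 0 < ρ ∧ ρ ≤ r ∧ L < (⨍ z in ball y ρ, |f z - c|) ∧
      |(⨍ z in ball y (6 * ρ), f z) - c| ≤ L := by
  classical
  have hs := Nat.find_spec hy
  have hm := fun m => Nat.find_min hy (m := m)
  generalize Nat.find hy = k at hs hm
  rcases k with _ | k
  · simp only [pow_zero, div_one] at hs
    linarith
  · refine ⟨r / 6 ^ (k + 1), by positivity, div_le_self hr.le (one_le_pow₀ (by norm_num)), hs, ?_⟩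
    have e : 6 * (r / 6 ^ (k + 1)) = r / 6 ^ k := by rw [pow_succ]; field_simp
    rw [e]
    exact (jn_avg_sub hf y (by positivity) c).trans (not_lt.1 (hm k (Nat.lt_succ_self k)))

lemma jn_step {f : EuclideanSpace ℝ (Fin n) → ℝ} (hf : LocallyIntegrable f volume) {M : ℝ}
    (hM : 0 < M) (hb : IsBMOBound f M) (k : ℕ)
    (ih : ∀ (x : EuclideanSpace ℝ (Fin n)) (r : ℝ), 0 < r →
      2 ^ k * volume {y ∈ ball x r | k * (2 * 6 ^ n * (jnA n * M)) < |f y - ⨍ z in ball x r, f z|}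
        ≤ volume (ball x r))
    (x : EuclideanSpace ℝ (Fin n)) (r : ℝ) (hr : 0 < r) :
    2 ^ (k + 1) * volume {y ∈ ball x r |
        ((k + 1 : ℕ) : ℝ) * (2 * 6 ^ n * (jnA n * M)) < |f y - ⨍ z in ball x r, f z|}
      ≤ volume (ball x r) := by
  have hAM : 0 < jnA n * M := mul_pos (jnA_pos n) hM
  set L : ℝ := 2 * 6 ^ n * (jnA n * M) with hL
  have hLpos : 0 < L := by positivity
  have hAL : jnA n * M ≤ L := by
    have : (1 : ℝ) ≤ 6 ^ n := one_le_pow₀ (by norm_num)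
    nlinarith
  have hD := jn_double hf hb x hr
  set c := ⨍ z in ball x r, f z with hc
  set t : Set (EuclideanSpace ℝ (Fin n)) :=
    {y ∈ ball x r | ∃ k : ℕ, L < ⨍ z in ball y (r / 6 ^ k), |f z - c|} with ht
  have hsel : ∀ y, ∃ ρ : ℝ, y ∈ t → (0 < ρ ∧ ρ ≤ r ∧ L < (⨍ z in ball y ρ, |f z - c|) ∧
      |(⨍ z in ball y (6 * ρ), f z) - c| ≤ L) := by
    intro y
    by_cases hy : y ∈ t
    · obtain ⟨ρ, h⟩ := jn_select hf (L := L) c hr y (by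
        refine (jn_avg_sub_mono hf x y hr (a := 2) (by norm_num) ?_ c).trans ?_
        · refine ball_subset_ball' ?_
          have := mem_ball.1 hy.1
          linarith
        · refine le_trans ?_ hAL
          rw [jnA, mul_assoc]
          gcongr) hy.2
      exact ⟨ρ, fun _ => h⟩
    · exact ⟨0, fun h => absurd h hy⟩
  choose ρ hρ using hsel
  obtain ⟨u, hut, hdis, hcov⟩ := Vitali.exists_disjoint_subfamily_covering_enlargement_closedBall
    t id ρ r (fun a ha => (hρ a ha).2.1) 5 (by norm_num)
  simp only [id] at hdis hcov
  have hdis' : u.PairwiseDisjoint fun a => ball a (ρ a) :=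
    hdis.mono fun a => ball_subset_closedBall
  have hucount : u.Countable := hdis'.countable_of_isOpen (fun _ _ => isOpen_ball)
    (fun a ha => nonempty_ball.2 (hρ a (hut ha)).1)
  -- sum of the measures of the selected balls
  have hsum : ENNReal.ofReal (2 * 6 ^ n) * ∑' a : u, volume (ball (a : EuclideanSpace ℝ (Fin n)) (ρ a))
      ≤ volume (ball x r) := by
    have h1 : ENNReal.ofReal L * ∑' a : u, volume (ball (a : EuclideanSpace ℝ (Fin n)) (ρ a))
        ≤ ENNReal.ofReal (jnA n * M) * volume (ball x r) := by
      calc ENNReal.ofReal L * ∑' a : u, volume (ball (a : EuclideanSpace ℝ (Fin n)) (ρ a))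
          = ∑' a : u, ENNReal.ofReal L * volume (ball (a : EuclideanSpace ℝ (Fin n)) (ρ a)) :=
            ENNReal.tsum_mul_left.symm
        _ ≤ ∑' a : u, ∫⁻ z in ball (a : EuclideanSpace ℝ (Fin n)) (ρ a),
              ENNReal.ofReal |f z - c| := by
            refine ENNReal.tsum_le_tsum fun a => ?_
            obtain ⟨h1, -, h3, -⟩ := hρ a (hut a.2)
            rw [← ofReal_integral_eq_lintegral_ofReal (jn_intOn (jn_locInt hf c) _ _)
              (Filter.Eventually.of_forall fun _ => abs_nonneg _), ← jn_avg_mul _ _ h1,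
              ENNReal.ofReal_mul (hLpos.le.trans h3.le), ofReal_measureReal measure_ball_lt_top.ne]
            gcongr
        _ = ∫⁻ z in ⋃ a ∈ u, ball a (ρ a), ENNReal.ofReal |f z - c| :=
            (lintegral_biUnion hucount (fun _ _ => measurableSet_ball) hdis' _).symm
        _ ≤ ∫⁻ z in ball x (2 * r), ENNReal.ofReal |f z - c| := by
            refine lintegral_mono_set (Set.iUnion₂_subset fun a ha => ball_subset_ball' ?_)
            have h1 := mem_ball.1 (hut ha).1
            have h2 := (hρ a (hut ha)).2.1
            linarith
        _ ≤ ENNReal.ofReal (jnA n * M) * volume (ball x r) := by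
            rw [← ofReal_integral_eq_lintegral_ofReal (jn_intOn (jn_locInt hf c) _ _)
              (Filter.Eventually.of_forall fun _ => abs_nonneg _),
              ← jn_avg_mul _ _ (by linarith : 0 < 2 * r),
              ← ofReal_measureReal (measure_ball_lt_top (μ := volume) (x := x) (r := r)).ne,
              ← ENNReal.ofReal_mul hAM.le, jn_volr_scale x x hr (by norm_num)]
            refine ENNReal.ofReal_le_ofReal ?_
            have hv := jn_volr_pos x hr
            calc _ ≤ ((1 + 2 ^ n) * M) * (2 ^ n * volume.real (ball x r)) := by gcongr
              _ = _ := by rw [jnA]; ring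
    rw [hL, ENNReal.ofReal_mul (by positivity), mul_comm (ENNReal.ofReal (2 * 6 ^ n)),
      mul_assoc] at h1
    exact (ENNReal.mul_le_mul_iff_right (by simpa using hAM) ENNReal.ofReal_ne_top).1 h1
  -- covering
  have hcover : volume {y ∈ ball x r | ((k + 1 : ℕ) : ℝ) * L < |f y - c|} ≤
      volume (⋃ a ∈ u, {y ∈ ball a (6 * ρ a) | k * L < |f y - ⨍ z in ball a (6 * ρ a), f z|}) := by
    refine measure_mono_ae ?_
    filter_upwards [jn_lebesgue (jn_locInt hf c) hr] with y hy hyS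
    obtain ⟨hyb, hyL⟩ := hyS
    push_cast at hyL
    have hkL : 0 ≤ (k : ℝ) * L := by positivity
    have hyt : y ∈ t := by
      refine ⟨hyb, ?_⟩
      have hlt : L < |f y - c| := by nlinarith
      exact (hy.eventually (lt_mem_nhds hlt)).exists
    obtain ⟨b, hbu, hsub⟩ := hcov y hyt
    have hyb5 := hsub (mem_closedBall_self (hρ y hyt).1.le)
    obtain ⟨h1, -, -, h4⟩ := hρ b (hut hbu)
    refine Set.mem_biUnion hbu ⟨?_, ?_⟩
    · have := mem_closedBall.1 hyb5
      rw [mem_ball]; linarith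
    · have := abs_sub_le (f y) (⨍ z in ball b (6 * ρ b), f z) c
      linarith
  calc 2 ^ (k + 1) * volume {y ∈ ball x r | ((k + 1 : ℕ) : ℝ) * L < |f y - c|}
      ≤ 2 ^ (k + 1) * ∑' a : u, volume {y ∈ ball (a : EuclideanSpace ℝ (Fin n)) (6 * ρ a) |
          k * L < |f y - ⨍ z in ball (a : EuclideanSpace ℝ (Fin n)) (6 * ρ a), f z|} := by
        gcongr
        exact hcover.trans (measure_biUnion_le _ hucount _)
    _ = 2 * ∑' a : u, 2 ^ k * volume {y ∈ ball (a : EuclideanSpace ℝ (Fin n)) (6 * ρ a) |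
          k * L < |f y - ⨍ z in ball (a : EuclideanSpace ℝ (Fin n)) (6 * ρ a), f z|} := by
        rw [ENNReal.tsum_mul_left, pow_succ]; ring
    _ ≤ 2 * ∑' a : u, ENNReal.ofReal (6 ^ n) *
          volume (ball (a : EuclideanSpace ℝ (Fin n)) (ρ a)) := by
        refine mul_le_mul_right (ENNReal.tsum_le_tsum fun a => ?_) _
        have h1 := (hρ a (hut a.2)).1
        refine (ih a _ (by positivity)).trans_eq ?_
        exact jn_vol_scale _ _ h1 (by norm_num)
    _ = ENNReal.ofReal (2 * 6 ^ n) *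
          ∑' a : u, volume (ball (a : EuclideanSpace ℝ (Fin n)) (ρ a)) := by
        rw [ENNReal.tsum_mul_left, ENNReal.ofReal_mul (by norm_num), ENNReal.ofReal_ofNat,
          mul_assoc]
    _ ≤ _ := hsum

lemma jn_level {f : EuclideanSpace ℝ (Fin n) → ℝ} (hf : LocallyIntegrable f volume) {M : ℝ}
    (hM : 0 < M) (hb : IsBMOBound f M) (k : ℕ) :
    ∀ (x : EuclideanSpace ℝ (Fin n)) (r : ℝ), 0 < r →
      2 ^ k * volume {y ∈ ball x r | k * (2 * 6 ^ n * (jnA n * M)) < |f y - ⨍ z in ball x r, f z|}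
        ≤ volume (ball x r) := by
  induction k with
  | zero =>
    intro x r _
    rw [pow_zero, one_mul]
    exact measure_mono fun y hy => hy.1
  | succ k ih => exact jn_step hf hM hb k ih

/-- the series in the `L^p` bound -/
noncomputable def jnS (p : ℝ) : ℝ := ∑' k : ℕ, ((k : ℝ) + 1) ^ p * (1 / 2) ^ k

lemma jnS_summable (p : ℝ) : Summable fun k : ℕ => ((k : ℝ) + 1) ^ p * (1 / 2 : ℝ) ^ k := by
  have h := summable_pow_mul_geometric_of_norm_lt_one (R := ℝ) ⌈p⌉₊ (r := 1 / 2) (by norm_num)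
  have h' := ((summable_nat_add_iff 1).2 h).mul_left 2
  refine Summable.of_nonneg_of_le (fun k => by positivity) (fun k => ?_) h'
  have e : (2 : ℝ) * (((k + 1 : ℕ) : ℝ) ^ ⌈p⌉₊ * (1 / 2) ^ (k + 1))
      = ((k : ℝ) + 1) ^ (⌈p⌉₊ : ℝ) * (1 / 2) ^ k := by
    rw [Real.rpow_natCast]; push_cast; ring
  rw [e]
  gcongr
  · have : (0 : ℝ) ≤ k := by positivity
    linarith
  · exact Nat.le_ceil p

lemma jnS_pos (p : ℝ) : 0 < jnS p :=
  (jnS_summable p).tsum_pos (fun k => by positivity) 0 (by simp)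

lemma jn_lintegral {f : EuclideanSpace ℝ (Fin n) → ℝ} (hf : LocallyIntegrable f volume) {M : ℝ}
    (hM : 0 < M) (hb : IsBMOBound f M) {p : ℝ} (hp : 1 ≤ p)
    (x : EuclideanSpace ℝ (Fin n)) {r : ℝ} (hr : 0 < r) :
    ∫⁻ y in ball x r, ENNReal.ofReal (|f y - ⨍ z in ball x r, f z| ^ p) ≤
      ENNReal.ofReal ((2 * 6 ^ n * jnA n) ^ p * jnS p * M ^ p) * volume (ball x r) := by
  have hlev := fun k => jn_level hf hM hb k x r hr
  have hA := jnA_pos n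
  set L : ℝ := 2 * 6 ^ n * (jnA n * M) with hL
  have hLpos : 0 < L := by positivity
  set c := ⨍ z in ball x r, f z with hc
  set S : ℕ → Set (EuclideanSpace ℝ (Fin n)) := fun k => {y | k * L < |f y - c|} with hS
  have hSm : ∀ k, NullMeasurableSet (S k) (volume.restrict (ball x r)) := fun k =>
    nullMeasurableSet_lt aemeasurable_const
      (jn_intOn (jn_locInt hf c) x r).aestronglyMeasurable.aemeasurable
  have hpt : ∀ y, ENNReal.ofReal (|f y - c| ^ p) ≤
      ∑' k : ℕ, (S k).indicator (fun _ => ENNReal.ofReal ((((k : ℝ) + 1) * L) ^ p)) y := by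
    intro y
    rcases (abs_nonneg (f y - c)).eq_or_lt with h0 | h0
    · rw [← h0, Real.zero_rpow (by linarith)]; simp
    · obtain ⟨m, hm⟩ : ∃ m, ⌈|f y - c| / L⌉₊ = m + 1 :=
        Nat.exists_eq_succ_of_ne_zero (Nat.ceil_pos.2 (div_pos h0 hLpos)).ne'
      have h1 : |f y - c| ≤ ((m : ℝ) + 1) * L := by
        have := Nat.le_ceil (|f y - c| / L)
        rw [hm, div_le_iff₀ hLpos] at this
        exact_mod_cast this
      have h2 : (m : ℝ) * L < |f y - c| := by
        have : m < ⌈|f y - c| / L⌉₊ := by omega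
        rwa [Nat.lt_ceil, lt_div_iff₀ hLpos] at this
      refine le_trans ?_ (ENNReal.le_tsum m)
      rw [Set.indicator_of_mem (by exact h2)]
      exact ENNReal.ofReal_le_ofReal (Real.rpow_le_rpow h0.le h1 (by linarith))
  have hvol : ∀ k, volume.restrict (ball x r) (S k) ≤
      ENNReal.ofReal ((1 / 2) ^ k) * volume (ball x r) := by
    intro k
    have e : volume.restrict (ball x r) (S k) = volume {y ∈ ball x r | k * L < |f y - c|} := by
      rw [Measure.restrict_apply' measurableSet_ball, Set.inter_comm]; rfl
    rw [e]
    have e2 : ENNReal.ofReal ((1 / 2) ^ k) = ((2 : ENNReal) ^ k)⁻¹ := by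
      rw [one_div, inv_pow, ENNReal.ofReal_inv_of_pos (by positivity),
        ENNReal.ofReal_pow (by norm_num), ENNReal.ofReal_ofNat]
    rw [e2, mul_comm (_⁻¹), ← div_eq_mul_inv, ENNReal.le_div_iff_mul_le (by simp) (by simp),
      mul_comm (volume _)]
    exact hlev k
  calc ∫⁻ y in ball x r, ENNReal.ofReal (|f y - c| ^ p)
      ≤ ∫⁻ y in ball x r,
          ∑' k : ℕ, (S k).indicator (fun _ => ENNReal.ofReal ((((k : ℝ) + 1) * L) ^ p)) y :=
        lintegral_mono hpt
    _ = ∑' k : ℕ, ∫⁻ y in ball x r,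
          (S k).indicator (fun _ => ENNReal.ofReal ((((k : ℝ) + 1) * L) ^ p)) y :=
        lintegral_tsum fun k => (aemeasurable_const.indicator₀ (hSm k))
    _ = ∑' k : ℕ, ENNReal.ofReal ((((k : ℝ) + 1) * L) ^ p) * volume.restrict (ball x r) (S k) := by
        congr 1; ext k; exact lintegral_indicator_const₀ (hSm k) _
    _ ≤ ∑' k : ℕ, ENNReal.ofReal (L ^ p * (((k : ℝ) + 1) ^ p * (1 / 2) ^ k)) *
          volume (ball x r) := by
        refine ENNReal.tsum_le_tsum fun k => ?_
        refine (mul_le_mul_right (hvol k) _).trans_eq ?_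
        rw [← mul_assoc, ← ENNReal.ofReal_mul (by positivity),
          Real.mul_rpow (by positivity) hLpos.le]
        congr 2; ring
    _ = _ := by
        rw [ENNReal.tsum_mul_right, ← ENNReal.ofReal_tsum_of_nonneg (fun k => by positivity)
          ((jnS_summable p).mul_left _), tsum_mul_left, ← jnS, hL, ← mul_assoc,
          Real.mul_rpow (by positivity) hM.le]
        congr 2; ring

end helpers

/-- For `f ∈ BMO(ℝⁿ)`: comparison of averages over concentric balls,
local `L^p` integrability, and the John–Nirenberg `L^p` oscillation bound
with constant depending only on `n` and `p`. -/
theorem bmo_avg_and_john_nirenberg (n : ℕ) (p : ℝ) (hp : 1 ≤ p) :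
    ∃ C > (0 : ℝ), ∀ (f : EuclideanSpace ℝ (Fin n) → ℝ) (M : ℝ),
      LocallyIntegrable f volume → IsBMOBound f M →
      (∀ r : ℝ, 1 ≤ r →
        |(⨍ x in ball (0 : EuclideanSpace ℝ (Fin n)) r, f x)
          - ⨍ x in ball (0 : EuclideanSpace ℝ (Fin n)) 1, f x| ≤ r ^ n * M) ∧
      (∀ r : ℝ, 0 < r →
        IntegrableOn (fun x => |f x| ^ p) (ball (0 : EuclideanSpace ℝ (Fin n)) r) volume ∧
        IntegrableOn (fun x => |f x - ⨍ z in ball (0 : EuclideanSpace ℝ (Fin n)) r, f z| ^ p)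
          (ball (0 : EuclideanSpace ℝ (Fin n)) r) volume ∧
        ⨍ x in ball (0 : EuclideanSpace ℝ (Fin n)) r,
            |f x - ⨍ z in ball (0 : EuclideanSpace ℝ (Fin n)) r, f z| ^ p ≤ C * M ^ p) := by
  have hA := jnA_pos n
  have hS := jnS_pos p
  have hp0 : 0 < p := by linarith
  have hC : 0 < (2 * 6 ^ n * jnA n) ^ p * jnS p := by positivity
  refine ⟨(2 * 6 ^ n * jnA n) ^ p * jnS p, hC, ?_⟩
  generalize hCe : (2 * 6 ^ n * jnA n) ^ p * jnS p = C at hC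
  intro f M hf hb
  refine ⟨fun r hr => by simpa using jn_compare hf hb 0 one_pos hr, fun r hr => ?_⟩
  have hM0 : 0 ≤ M := by
    refine le_trans ?_ (hb 0 1 one_pos)
    rw [setAverage_eq]
    exact smul_nonneg (by positivity) (integral_nonneg fun _ => abs_nonneg _)
  have hlin : ∀ M' : ℝ, M < M' →
      ∫⁻ y in ball (0 : EuclideanSpace ℝ (Fin n)) r,
        ENNReal.ofReal (|f y - ⨍ z in ball (0 : EuclideanSpace ℝ (Fin n)) r, f z| ^ p) ≤
      ENNReal.ofReal (C * M' ^ p) * volume (ball (0 : EuclideanSpace ℝ (Fin n)) r) := by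
    intro M' hM'
    have := jn_lintegral hf (hM0.trans_lt hM') (fun x r hr => (hb x r hr).trans hM'.le) hp 0 hr
    rwa [hCe] at this
  have hv := jn_volr_pos (0 : EuclideanSpace ℝ (Fin n)) hr
  set c := ⨍ z in ball (0 : EuclideanSpace ℝ (Fin n)) r, f z with hc
  have hfi := jn_intOn hf 0 r
  have hmeas : AEStronglyMeasurable (fun x => |f x - c| ^ p)
      (volume.restrict (ball (0 : EuclideanSpace ℝ (Fin n)) r)) :=
    ((jn_intOn (jn_locInt hf c) 0 r).aestronglyMeasurable.aemeasurable.pow_const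
      p).aestronglyMeasurable
  have hpInt : IntegrableOn (fun x => |f x - c| ^ p)
      (ball (0 : EuclideanSpace ℝ (Fin n)) r) volume := by
    refine ⟨hmeas, ?_⟩
    rw [hasFiniteIntegral_iff_ofReal (Filter.Eventually.of_forall fun _ => by positivity)]
    exact (hlin (M + 1) (by linarith)).trans_lt
      (ENNReal.mul_lt_top ENNReal.ofReal_lt_top measure_ball_lt_top)
  refine ⟨?_, hpInt, ?_⟩
  · have hpe : ENNReal.ofReal p ≠ 0 := by simpa using hp0
    have hpt : (ENNReal.ofReal p).toReal = p := ENNReal.toReal_ofReal hp0.le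
    have h1 : MemLp (fun x => f x - c) (ENNReal.ofReal p)
        (volume.restrict (ball (0 : EuclideanSpace ℝ (Fin n)) r)) := by
      refine (integrable_norm_rpow_iff (hfi.aestronglyMeasurable.sub aestronglyMeasurable_const)
        hpe ENNReal.ofReal_ne_top).1 ?_
      rw [hpt]
      exact hpInt
    have : IsFiniteMeasure (volume.restrict (ball (0 : EuclideanSpace ℝ (Fin n)) r)) :=
      ⟨by rw [Measure.restrict_apply_univ]; exact measure_ball_lt_top⟩
    have h2 := h1.add (memLp_const c)
    have h3 := (integrable_norm_rpow_iff h2.aestronglyMeasurable hpe ENNReal.ofReal_ne_top).2 h2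
    rw [hpt] at h3
    simpa [IntegrableOn] using h3
  · have hb' : ∀ M' : ℝ, M < M' →
        ⨍ x in ball (0 : EuclideanSpace ℝ (Fin n)) r, |f x - c| ^ p ≤ C * M' ^ p := by
      intro M' hM'
      have hM'0 : 0 < M' := hM0.trans_lt hM'
      have h := hlin M' hM'
      rw [← ofReal_integral_eq_lintegral_ofReal hpInt
        (Filter.Eventually.of_forall fun _ => by positivity),
        ← ofReal_measureReal (measure_ball_lt_top (μ := volume)).ne,
        ← ENNReal.ofReal_mul (by positivity), ENNReal.ofReal_le_ofReal_iff (by positivity),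
        ← jn_avg_mul _ _ hr] at h
      exact le_of_mul_le_mul_right h hv
    have hcont : Filter.Tendsto (fun M' : ℝ => C * M' ^ p) (nhdsWithin M (Set.Ioi M))
        (nhds (C * M ^ p)) :=
      (((Real.continuousAt_rpow_const M p (Or.inr hp0.le)).tendsto).const_mul C).mono_left
        nhdsWithin_le_nhds
    exact ge_of_tendsto hcont (Filter.eventually_of_mem self_mem_nhdsWithin hb')
end
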